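/- Let L be an even positive-definite lattice of rank ≥ 1 and M = 2U ⊕ L(−1). Suppose M admits a nonconstant modular form F (for some weight k, finite-index subgroup Γ ≤ O⁺(M) and finite-order character χ) whose zero set is contained in the union of the hyperplane sections {Z ∈ D•(M) : (Z,r) = 0} over all r ∈ M with (r,r) = −2 and div(r) = 2. Then L is isomorphic to nA_1 for some n with 1 ≤ n ≤ 4. -/

import Mathlib

open Matrix

namespace Refl

noncomputable section

variable {n : ℕ}

/-- ℂ-bilinear extension of the Gram pairing. -/
def cpair (B : Matrix (Fin n) (Fin n) ℤ) (Z W : Fin n → ℂ) : ℂ :=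
  ∑ i, ∑ j, (B i j : ℂ) * Z i * W j

/-- ℚ-bilinear extension of the Gram pairing. -/
def qpair (B : Matrix (Fin n) (Fin n) ℤ) (x y : Fin n → ℚ) : ℚ :=
  ∑ i, ∑ j, (B i j : ℚ) * x i * y j

/-- ℝ-bilinear extension of the Gram pairing. -/
def rpair (B : Matrix (Fin n) (Fin n) ℤ) (x y : Fin n → ℝ) : ℝ :=
  ∑ i, ∑ j, (B i j : ℝ) * x i * y j

def intQ (v : Fin n → ℤ) : Fin n → ℚ := fun i => (v i : ℚ)

def intR (v : Fin n → ℤ) : Fin n → ℝ := fun i => (v i : ℝ)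

def intC (v : Fin n → ℤ) : Fin n → ℂ := fun i => (v i : ℂ)

def ratR (v : Fin n → ℚ) : Fin n → ℝ := fun i => (v i : ℝ)

def ratC (v : Fin n → ℚ) : Fin n → ℂ := fun i => (v i : ℂ)

/-- (v, v) for an integral vector. -/
def qnorm (B : Matrix (Fin n) (Fin n) ℤ) (v : Fin n → ℤ) : ℤ := v ⬝ᵥ B.mulVec v

/-- Membership in the dual lattice (a vector of ℚ^n pairing integrally with the lattice). -/
def InDual (B : Matrix (Fin n) (Fin n) ℤ) (x : Fin n → ℚ) : Prop :=
  ∀ y : Fin n → ℤ, ∃ m : ℤ, qpair B x (intQ y) = (m : ℚ)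

/-- A rational vector lies in the lattice ℤ^n itself. -/
def InLat (x : Fin n → ℚ) : Prop := ∃ w : Fin n → ℤ, x = intQ w

/-- `B` is the Gram matrix of an even nondegenerate lattice of signature (p,q). -/
def IsEvenLatticeOfSignature (B : Matrix (Fin n) (Fin n) ℤ) (p q : ℕ) : Prop :=
  n = p + q ∧ B.IsSymm ∧ (∀ x : Fin n → ℤ, 2 ∣ qnorm B x) ∧ B.det ≠ 0 ∧
    ∃ P : Matrix (Fin n) (Fin n) ℝ, IsUnit P.det ∧
      Pᵀ * B.map (Int.cast : ℤ → ℝ) * P =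
        Matrix.diagonal (fun i : Fin n => if (i : ℕ) < p then (1 : ℝ) else -1)

/-- `B` is the Gram matrix of an even positive-definite lattice. -/
def IsEvenPosDef (B : Matrix (Fin n) (Fin n) ℤ) : Prop :=
  B.IsSymm ∧ (∀ x : Fin n → ℤ, 2 ∣ qnorm B x) ∧ (B.map (Int.cast : ℤ → ℝ)).PosDef

/-- The cone {Z | (Z,Z) = 0, (Z,conj Z) > 0}. -/
def Cone (B : Matrix (Fin n) (Fin n) ℤ) : Set (Fin n → ℂ) :=
  {Z | cpair B Z Z = 0 ∧ 0 < (cpair B Z (fun i => (starRingEnd ℂ) (Z i))).re}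

/-- `D` is one of the connected components of the cone (the affine cone `D•(M)`). -/
def IsComponent (B : Matrix (Fin n) (Fin n) ℤ) (D : Set (Fin n → ℂ)) : Prop :=
  ∃ Z ∈ Cone B, D = connectedComponentIn (Cone B) Z

/-- The action of an integral matrix on ℂ^n. -/
def actC (g : Matrix (Fin n) (Fin n) ℤ) (Z : Fin n → ℂ) : Fin n → ℂ :=
  (g.map (Int.cast : ℤ → ℂ)).mulVec Z

/-- The group O⁺(M): integral isometries preserving the chosen component. -/
def OPlus (B : Matrix (Fin n) (Fin n) ℤ) (D : Set (Fin n → ℂ)) :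
    Set (Matrix (Fin n) (Fin n) ℤ) :=
  {g | gᵀ * B * g = B ∧ actC g '' D = D}

/-- The stable orthogonal group Õ⁺(M): elements of O⁺(M) acting trivially on M^∨/M. -/
def StableOPlus (B : Matrix (Fin n) (Fin n) ℤ) (D : Set (Fin n → ℂ)) :
    Set (Matrix (Fin n) (Fin n) ℤ) :=
  {g | g ∈ OPlus B D ∧ ∀ x : Fin n → ℚ, InDual B x →
        ∃ w : Fin n → ℤ, (g.map (Int.cast : ℤ → ℚ)).mulVec x - x = intQ w}

/-- `Γ` is a finite-index subgroup of O⁺(M). -/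
structure IsFiniteIndexSubgroup (B : Matrix (Fin n) (Fin n) ℤ) (D : Set (Fin n → ℂ))
    (Γ : Set (Matrix (Fin n) (Fin n) ℤ)) : Prop where
  subset : Γ ⊆ OPlus B D
  one_mem : (1 : Matrix (Fin n) (Fin n) ℤ) ∈ Γ
  mul_mem : ∀ g ∈ Γ, ∀ h ∈ Γ, g * h ∈ Γ
  inv_mem : ∀ g ∈ Γ, ∃ h ∈ Γ, g * h = 1 ∧ h * g = 1
  finite_index : ∃ S : Finset (Matrix (Fin n) (Fin n) ℤ),
    ∀ g ∈ OPlus B D, ∃ s ∈ S, ∃ γ ∈ Γ, g = s * γ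

/-- `χ` is a character Γ → ℂ× with finite image (equivalently, of finite order). -/
structure IsCharacter (Γ : Set (Matrix (Fin n) (Fin n) ℤ))
    (χ : Matrix (Fin n) (Fin n) ℤ → ℂ) : Prop where
  ne_zero : ∀ g ∈ Γ, χ g ≠ 0
  map_mul : ∀ g ∈ Γ, ∀ h ∈ Γ, χ (g * h) = χ g * χ h
  finite_image : (χ '' Γ).Finite

/-- `F` is a modular form of weight `k` and character `χ` for `Γ` on the component `D`. -/
structure IsModularForm (B : Matrix (Fin n) (Fin n) ℤ) (D : Set (Fin n → ℂ))
    (Γ : Set (Matrix (Fin n) (Fin n) ℤ)) (χ : Matrix (Fin n) (Fin n) ℤ → ℂ)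
    (k : ℤ) (F : (Fin n → ℂ) → ℂ) : Prop where
  holo : DifferentiableOn ℂ F D
  homogeneous : ∀ t : ℂ, t ≠ 0 → ∀ Z ∈ D, F (t • Z) = t ^ (-k) * F Z
  equivariant : ∀ g ∈ Γ, ∀ Z ∈ D, F (actC g Z) = χ g * F Z

def NonConstantOn (D : Set (Fin n → ℂ)) (F : (Fin n → ℂ) → ℂ) : Prop :=
  ¬ ∃ c : ℂ, ∀ Z ∈ D, F Z = c

/-- `Z` lies on the rational quadratic divisor of the integral vector `v`. -/
def OrthZ (B : Matrix (Fin n) (Fin n) ℤ) (Z : Fin n → ℂ) (v : Fin n → ℤ) : Prop :=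
  cpair B Z (intC v) = 0

/-- `F` is nonconstant and its zero set is contained in hyperplanes of (-2)-vectors. -/
def Is2ReflectiveForm (B : Matrix (Fin n) (Fin n) ℤ) (D : Set (Fin n → ℂ))
    (F : (Fin n → ℂ) → ℂ) : Prop :=
  NonConstantOn D F ∧
    ∀ Z ∈ D, F Z = 0 → ∃ v : Fin n → ℤ, qnorm B v = -2 ∧ OrthZ B Z v

/-- The lattice is 2-reflective. -/
def Is2Reflective (B : Matrix (Fin n) (Fin n) ℤ) : Prop :=
  ∃ D : Set (Fin n → ℂ), IsComponent B D ∧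
    ∃ (Γ : Set (Matrix (Fin n) (Fin n) ℤ)) (χ : Matrix (Fin n) (Fin n) ℤ → ℂ)
      (k : ℤ) (F : (Fin n → ℂ) → ℂ),
      IsFiniteIndexSubgroup B D Γ ∧ IsCharacter Γ χ ∧
      IsModularForm B D Γ χ k F ∧ Is2ReflectiveForm B D F

/-- Primitivity of an integral vector : ℚv ∩ ℤ^n = ℤv. -/
def IsPrimitive (v : Fin n → ℤ) : Prop :=
  v ≠ 0 ∧ ∀ (a : ℚ) (w : Fin n → ℤ), (∀ i, a * (v i : ℚ) = (w i : ℚ)) →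
    ∃ m : ℤ, w = m • v

/-- The reflection σ_v maps the lattice into itself. -/
def ReflPreservesLat (B : Matrix (Fin n) (Fin n) ℤ) (v : Fin n → ℤ) : Prop :=
  ∀ x : Fin n → ℤ, ∃ y : Fin n → ℤ, ∀ i,
    (x i : ℚ) - (2 * ((x ⬝ᵥ B.mulVec v : ℤ) : ℚ) / (qnorm B v : ℚ)) * (v i : ℚ) = (y i : ℚ)

/-- The ℂ-linear extension of the reflection σ_v. -/
def reflC (B : Matrix (Fin n) (Fin n) ℤ) (v : Fin n → ℤ) (Z : Fin n → ℂ) : Fin n → ℂ :=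
  fun i => Z i - (2 * cpair B Z (intC v) / (qnorm B v : ℂ)) * (v i : ℂ)

/-- `v` is a reflective vector of the lattice `M` (w.r.t. the component `D`). -/
def IsReflectiveVector (B : Matrix (Fin n) (Fin n) ℤ) (D : Set (Fin n → ℂ))
    (v : Fin n → ℤ) : Prop :=
  IsPrimitive v ∧ qnorm B v < 0 ∧ ReflPreservesLat B v ∧ reflC B v '' D = D

/-- `F` is nonconstant and its zero set is contained in hyperplanes of reflective vectors. -/
def IsReflectiveForm (B : Matrix (Fin n) (Fin n) ℤ) (D : Set (Fin n → ℂ))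
    (F : (Fin n → ℂ) → ℂ) : Prop :=
  NonConstantOn D F ∧
    ∀ Z ∈ D, F Z = 0 → ∃ v : Fin n → ℤ, IsReflectiveVector B D v ∧ OrthZ B Z v

/-- The lattice is reflective. -/
def IsReflective (B : Matrix (Fin n) (Fin n) ℤ) : Prop :=
  ∃ D : Set (Fin n → ℂ), IsComponent B D ∧
    ∃ (Γ : Set (Matrix (Fin n) (Fin n) ℤ)) (χ : Matrix (Fin n) (Fin n) ℤ → ℂ)
      (k : ℤ) (F : (Fin n → ℂ) → ℂ),
      IsFiniteIndexSubgroup B D Γ ∧ IsCharacter Γ χ ∧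
      IsModularForm B D Γ χ k F ∧ IsReflectiveForm B D F

/-- Isomorphism of lattices given by Gram matrices. -/
def LatIso {m n : ℕ} (A : Matrix (Fin m) (Fin m) ℤ) (B : Matrix (Fin n) (Fin n) ℤ) : Prop :=
  ∃ e : (Fin m → ℤ) ≃ₗ[ℤ] (Fin n → ℤ), ∀ x y : Fin m → ℤ,
    e x ⬝ᵥ B.mulVec (e y) = x ⬝ᵥ A.mulVec y

/-- Orthogonal direct sum of lattices. -/
def dsum {m n : ℕ} (A : Matrix (Fin m) (Fin m) ℤ) (B : Matrix (Fin n) (Fin n) ℤ) :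
    Matrix (Fin (m + n)) (Fin (m + n)) ℤ :=
  Matrix.reindex finSumFinEquiv finSumFinEquiv (Matrix.fromBlocks A 0 0 B)

/-- The hyperbolic plane U. -/
def U : Matrix (Fin 2) (Fin 2) ℤ := !![0, 1; 1, 0]

/-- Gram matrix of the root lattice A_m. -/
def gramA (m : ℕ) : Matrix (Fin m) (Fin m) ℤ :=
  Matrix.of fun i j =>
    if i = j then 2 else if i.val + 1 = j.val ∨ j.val + 1 = i.val then -1 else 0

/-- Gram matrix of the root lattice D_m. -/
def gramD (m : ℕ) : Matrix (Fin m) (Fin m) ℤ :=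
  Matrix.of fun i j =>
    if i = j then 2
    else if (i.val + 1 = j.val ∧ j.val + 1 ≠ m) ∨ (j.val + 1 = i.val ∧ i.val + 1 ≠ m) then -1
    else if (i.val + 3 = m ∧ j.val + 1 = m) ∨ (j.val + 3 = m ∧ i.val + 1 = m) then -1
    else 0

/-- Gram matrix of the root lattice E_6. -/
def gramE6 : Matrix (Fin 6) (Fin 6) ℤ :=
  !![2, -1, 0, 0, 0, 0;
     -1, 2, -1, 0, 0, 0;
     0, -1, 2, -1, 0, -1;
     0, 0, -1, 2, -1, 0;
     0, 0, 0, -1, 2, 0;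
     0, 0, -1, 0, 0, 2]

/-- Gram matrix of the root lattice E_7. -/
def gramE7 : Matrix (Fin 7) (Fin 7) ℤ :=
  !![2, -1, 0, 0, 0, 0, 0;
     -1, 2, -1, 0, 0, 0, 0;
     0, -1, 2, -1, 0, 0, -1;
     0, 0, -1, 2, -1, 0, 0;
     0, 0, 0, -1, 2, -1, 0;
     0, 0, 0, 0, -1, 2, 0;
     0, 0, -1, 0, 0, 0, 2]

/-- Gram matrix of the root lattice E_8. -/
def gramE8 : Matrix (Fin 8) (Fin 8) ℤ :=
  !![2, -1, 0, 0, 0, 0, 0, 0;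
     -1, 2, -1, 0, 0, 0, 0, 0;
     0, -1, 2, -1, 0, 0, 0, -1;
     0, 0, -1, 2, -1, 0, 0, 0;
     0, 0, 0, -1, 2, -1, 0, 0;
     0, 0, 0, 0, -1, 2, -1, 0;
     0, 0, 0, 0, 0, -1, 2, 0;
     0, 0, -1, 0, 0, 0, 0, 2]

/-- Gram matrix of the Nikulin lattice N_8 (basis a_1,…,a_7,h with h=(a_1+⋯+a_8)/2). -/
def gramN8 : Matrix (Fin 8) (Fin 8) ℤ :=
  Matrix.of fun i j =>
    if i = j then (if i.val = 7 then 4 else 2)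
    else if i.val = 7 ∨ j.val = 7 then 1 else 0

/-- The lattice M = 2U ⊕ L(−1). -/
def M2U {r : ℕ} (L : Matrix (Fin r) (Fin r) ℤ) :
    Matrix (Fin (2 + (2 + r))) (Fin (2 + (2 + r))) ℤ :=
  dsum U (dsum U (-L))

/-- div(v) = d : the ideal (v, M) of ℤ is generated by d. -/
def DivEq (B : Matrix (Fin n) (Fin n) ℤ) (v : Fin n → ℤ) (d : ℤ) : Prop :=
  Ideal.span {a : ℤ | ∃ x : Fin n → ℤ, a = v ⬝ᵥ B.mulVec x} = Ideal.span {d}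

/-- Sum-of-divisors function σ₁ (on nonnegative integers). -/
def sigma1 (m : ℤ) : ℤ := ∑ d ∈ m.toNat.divisors, (d : ℤ)

end

end Refl

namespace Refl

open Complex Filter Topology Set Real

theorem exists_continuousOn_log {E : Type*} [NormedAddCommGroup E] [NormedSpace ℝ E] {S : Set E}
    (hS : Convex ℝ S) (hne : S.Nonempty) (ho : IsOpen S) {f : E → ℂ} (hf : ContinuousOn f S)
    (h0 : ∀ x ∈ S, f x ≠ 0) :
    ∃ η : E → ℂ, ContinuousOn η S ∧ ∀ x ∈ S, Complex.exp (η x) = f x := by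
  classical
  have : ContractibleSpace S := hS.contractibleSpace hne
  have : LocallyPathConnectedSpace S := ho.locallyPathConnectedSpace
  obtain ⟨a, ha⟩ := hne
  let f' : C(S, ℂ) := ⟨fun x => f x, continuousOn_iff_continuous_domRestrict.mp hf⟩
  obtain ⟨F, ⟨-, hF⟩, -⟩ := IsCoveringMapOn.existsUnique_continuousMap_lifts
    Complex.isCoveringMapOn_exp f' (a₀ := ⟨a, ha⟩) (e₀ := Complex.log (f a))
    (Complex.exp_log (h0 a ha)) (fun x => h0 x x.2)
  refine ⟨fun x => if hx : x ∈ S then F ⟨x, hx⟩ else 0, ?_, ?_⟩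
  · rw [continuousOn_iff_continuous_domRestrict]
    convert F.continuous using 1
    ext x
    simp
  · intro x hx
    have h1 : Complex.exp (F ⟨x, hx⟩) = f x := congrFun hF ⟨x, hx⟩
    simpa only [hx, dif_pos] using h1

/-- Two continuous logarithms of functions which agree up to a constant differ by a constant. -/
theorem exp_eq_const_of_preconnected {X : Type*} [TopologicalSpace X] {S : Set X}
    (hS : IsPreconnected S) {φ : X → ℂ} (hφ : ContinuousOn φ S) {c : ℂ}
    (h : ∀ x ∈ S, Complex.exp (φ x) = c) : ∀ x ∈ S, ∀ y ∈ S, φ x = φ y := by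
  intro x hx y hy
  have key : ∀ z ∈ S, ∃ m : ℤ, φ z - φ x = m * (2 * π * I) := by
    intro z hz
    obtain ⟨m, hm⟩ := Complex.exp_eq_exp_iff_exists_int.mp ((h z hz).trans (h x hx).symm)
    exact ⟨m, by rw [hm]; ring⟩
  have hπ : (2 * π : ℝ) ≠ 0 := by positivity
  have hre : ContinuousOn (fun z => (φ z - φ x).im / (2 * π)) S :=
    (Complex.continuous_im.comp_continuousOn (hφ.sub continuousOn_const)).div_const _
  have hval : ∀ z ∈ S, ∃ m : ℤ, (φ z - φ x).im / (2 * π) = m ∧ φ z - φ x = m * (2 * π * I) := by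
    intro z hz
    obtain ⟨m, hm⟩ := key z hz
    refine ⟨m, ?_, hm⟩
    rw [hm]
    simp
  obtain ⟨m, hm1, hm2⟩ := hval y hy
  have : (fun z => (φ z - φ x).im / (2 * π)) x = (fun z => (φ z - φ x).im / (2 * π)) y := by
    have hmaps : MapsTo (fun z => (φ z - φ x).im / (2 * π)) S (Set.range ((↑) : ℤ → ℝ)) := by
      intro z hz
      obtain ⟨m, hm, -⟩ := hval z hz
      exact ⟨m, hm.symm⟩
    have hd : IsDiscrete (Set.range ((↑) : ℤ → ℝ)) :=
      Int.isClosedEmbedding_coe_real.isDiscrete_range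
    exact hS.constant_of_mapsTo hd hre hmaps hx hy
  simp only [sub_self, zero_im, zero_div] at this
  rw [← this] at hm1
  have : m = 0 := by exact_mod_cast hm1.symm
  rw [this] at hm2
  simp only [Int.cast_zero, zero_mul] at hm2
  exact (sub_eq_zero.mp hm2).symm

/-- `j` is the winding number around `0` of the `1`-periodic loop `g`. -/
def Wind (g : ℝ → ℂ) (j : ℤ) : Prop :=
  ∃ φ : ℝ → ℂ, Continuous φ ∧ (∀ θ, Complex.exp (φ θ) = g θ) ∧
    ∀ θ, φ (θ + 1) = φ θ + j * (2 * π * I)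

theorem Wind.unique {g : ℝ → ℂ} {j j' : ℤ} (h : Wind g j) (h' : Wind g j') : j = j' := by
  obtain ⟨φ, hc, he, hp⟩ := h
  obtain ⟨φ', hc', he', hp'⟩ := h'
  have := exp_eq_const_of_preconnected (isPreconnected_univ (α := ℝ)) (φ := fun θ => φ θ - φ' θ)
    (hc.sub hc').continuousOn (c := 1) (fun θ _ => by
      rw [Complex.exp_sub, he, he', div_self]; rw [← he]; exact Complex.exp_ne_zero _)
    (0 + 1) trivial 0 trivial
  simp only [hp, hp'] at this
  have h2 : ((j : ℂ) - j') * (2 * π * I) = 0 := by linear_combination this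
  have := (mul_eq_zero.mp h2).resolve_right Complex.two_pi_I_ne_zero
  exact_mod_cast sub_eq_zero.mp this

theorem Wind.mul {g g' : ℝ → ℂ} {j j' : ℤ} (h : Wind g j) (h' : Wind g' j') :
    Wind (fun θ => g θ * g' θ) (j + j') := by
  obtain ⟨φ, hc, he, hp⟩ := h
  obtain ⟨φ', hc', he', hp'⟩ := h'
  refine ⟨fun θ => φ θ + φ' θ, hc.add hc', fun θ => by rw [Complex.exp_add, he, he'],
    fun θ => ?_⟩
  simp only [hp, hp']
  push_cast
  ring

theorem Wind.one : Wind (fun _ => 1) 0 :=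
  ⟨fun _ => 0, continuous_const, by simp, by simp⟩

theorem Wind.pow {g : ℝ → ℂ} {j : ℤ} (h : Wind g j) (n : ℕ) :
    Wind (fun θ => g θ ^ n) (n * j) := by
  induction n with
  | zero => simpa using Wind.one
  | succ n ih =>
    have := ih.mul h
    simp only [pow_succ]
    convert this using 1
    push_cast
    ring

theorem Wind.prod {ι : Type*} (s : Finset ι) {g : ι → ℝ → ℂ} {j : ι → ℤ}
    (h : ∀ i ∈ s, Wind (g i) (j i)) : Wind (fun θ => ∏ i ∈ s, g i θ) (∑ i ∈ s, j i) := by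
  classical
  induction s using Finset.induction_on with
  | empty => simpa using Wind.one
  | insert a s ha ih =>
    simp only [Finset.prod_insert ha, Finset.sum_insert ha]
    exact (h a (by simp)).mul (ih fun i hi => h i (by simp [hi]))

/-- Winding numbers are homotopy invariant. -/
theorem Wind.homotopy {H : ℝ → ℝ → ℂ} (hc : Continuous (fun p : ℝ × ℝ => H p.1 p.2))
    (h0 : ∀ s θ, H s θ ≠ 0) (hp : ∀ s θ, H s (θ + 1) = H s θ) {a b : ℝ} {j : ℤ}
    (h : Wind (H a) j) : Wind (H b) j := by
  obtain ⟨η, hη, he⟩ := exists_continuousOn_log (S := (univ : Set (ℝ × ℝ))) convex_univ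
    univ_nonempty isOpen_univ hc.continuousOn (fun x _ => h0 _ _)
  have hη : Continuous η := continuousOn_univ.mp hη
  have hcst : ∀ x y : ℝ × ℝ, η (x.1, x.2 + 1) - η x = η (y.1, y.2 + 1) - η y := by
    intro x y
    refine exp_eq_const_of_preconnected (isPreconnected_univ (α := ℝ × ℝ))
      (φ := fun x => η (x.1, x.2 + 1) - η x) ?_ (c := 1) ?_ x trivial y trivial
    · exact (by fun_prop : Continuous _).continuousOn
    · intro z _
      rw [Complex.exp_sub, he _ trivial, he _ trivial]
      simp only [hp]
      exact div_self (h0 _ _)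
  have hex : ∃ m : ℤ, η (0, 0 + 1) - η (0, 0) = m * (2 * π * I) := by
    have : Complex.exp (η (0, 0 + 1)) = Complex.exp (η (0, 0)) := by
      rw [he _ trivial, he _ trivial]; exact hp _ _
    obtain ⟨m, hm⟩ := Complex.exp_eq_exp_iff_exists_int.mp this
    exact ⟨m, by rw [hm]; ring⟩
  obtain ⟨m, hm⟩ := hex
  have hw : ∀ s, Wind (H s) m := fun s =>
    ⟨fun θ => η (s, θ), by fun_prop, fun θ => he _ trivial, fun θ => by
      have := hcst (s, θ) (0, 0)
      simp only at this
      rw [hm] at this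
      linear_combination this⟩
  rw [h.unique (hw a)]
  exact hw b

end Refl

namespace Refl

open Complex Filter Topology Set Real

theorem wind_circle_of_nonvanishing {H : ℂ → ℂ} {R ρ : ℝ} (hρ : 0 < ρ) (hR : ρ < R)
    (hH : ContinuousOn H (Metric.ball 0 R)) (h0 : ∀ q ∈ Metric.ball (0 : ℂ) R, H q ≠ 0) :
    Wind (fun θ => H (ρ * Complex.exp (2 * π * I * θ))) 0 := by
  obtain ⟨η, hη, he⟩ := exists_continuousOn_log (convex_ball (0 : ℂ) R)
    ⟨0, by simpa using hρ.trans hR⟩ Metric.isOpen_ball hH h0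
  have hmem : ∀ θ : ℝ, (ρ * Complex.exp (2 * π * I * θ) : ℂ) ∈ Metric.ball (0 : ℂ) R := by
    intro θ
    have : (2 * π * I * θ : ℂ) = ((2 * π * θ : ℝ) : ℂ) * I := by push_cast; ring
    rw [mem_ball_zero_iff, norm_mul, this, Complex.norm_exp_ofReal_mul_I]
    simpa [abs_of_pos hρ] using hR
  refine ⟨fun θ => η (ρ * Complex.exp (2 * π * I * θ)), ?_, fun θ => he _ (hmem θ), fun θ => ?_⟩
  · exact hη.comp_continuous (by fun_prop) hmem
  · have : (2 * π * I * ((θ + 1 : ℝ) : ℂ) : ℂ) = 2 * π * I * θ + 2 * π * I := by push_cast; ring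
    simp only [this, Complex.exp_add, Complex.exp_two_pi_mul_I]
    simp

theorem wind_circle_sub {u : ℂ} {ρ : ℝ} (hρ : 0 < ρ) (hu : ‖u‖ < ρ) :
    Wind (fun θ => ρ * Complex.exp (2 * π * I * θ) - u) 1 := by
  have hρ' : (ρ : ℂ) ≠ 0 := by exact_mod_cast hρ.ne'
  have hn : ∀ θ : ℝ, ‖u / (ρ * Complex.exp (2 * π * I * θ))‖ < 1 := by
    intro θ
    have : (2 * π * I * θ : ℂ) = ((2 * π * θ : ℝ) : ℂ) * I := by push_cast; ring
    rw [norm_div, norm_mul, this, Complex.norm_exp_ofReal_mul_I]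
    simpa [abs_of_pos hρ, div_lt_one hρ] using hu
  refine ⟨fun θ => Real.log ρ + 2 * π * I * θ +
    Complex.log (1 - u / (ρ * Complex.exp (2 * π * I * θ))), ?_, fun θ => ?_, fun θ => ?_⟩
  · refine Continuous.add (by fun_prop) ?_
    refine Continuous.clog ?_ fun θ => ?_
    · refine continuous_const.sub (continuous_const.div (by fun_prop) fun θ => ?_)
      exact mul_ne_zero hρ' (Complex.exp_ne_zero _)
    · have := Complex.mem_slitPlane_of_norm_lt_one (z := - (u / (ρ * Complex.exp (2 * π * I * θ))))
        (by rw [norm_neg]; exact hn θ)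
      simpa [sub_eq_add_neg] using this
  · have hne : (1 - u / (ρ * Complex.exp (2 * π * I * θ)) : ℂ) ≠ 0 := by
      intro h
      have := hn θ
      rw [← sub_eq_zero.mp h] at this
      simp at this
    rw [Complex.exp_add, Complex.exp_add, Complex.exp_log hne, ← Complex.ofReal_exp,
      Real.exp_log hρ]
    have := Complex.exp_ne_zero (2 * π * I * θ)
    field_simp
  · have : (2 * π * I * ((θ + 1 : ℝ) : ℂ) : ℂ) = 2 * π * I * θ + 2 * π * I := by push_cast; ring
    simp only [this, Complex.exp_add, Complex.exp_two_pi_mul_I]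
    push_cast
    ring_nf

theorem exists_factorization {G : ℂ → ℂ} {R : ℝ}
    (hG : AnalyticOnNhd ℂ G (Metric.closedBall 0 R)) {q₀ : ℂ}
    (hq₀ : q₀ ∈ Metric.closedBall (0 : ℂ) R) (hne : G q₀ ≠ 0) :
    ∃ (S : Finset ℂ) (d : ℂ → ℕ) (H : ℂ → ℂ), (∀ u ∈ S, d u ≠ 0) ∧
      (∀ u ∈ S, u ∈ Metric.closedBall (0 : ℂ) R ∧ G u = 0) ∧
      ContinuousOn H (Metric.ball 0 R) ∧ (∀ q ∈ Metric.ball (0 : ℂ) R, H q ≠ 0) ∧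
      ∀ q ∈ Metric.ball (0 : ℂ) R, G q = (∏ u ∈ S, (q - u) ^ d u) * H q := by
  classical
  set U := Metric.closedBall (0 : ℂ) R
  have hmer : MeromorphicOn G U := hG.meromorphicOn
  have hconn : IsPreconnected U := (convex_closedBall (0 : ℂ) R).isPreconnected
  have hord : ∀ u : U, meromorphicOrderAt G u ≠ ⊤ := by
    rintro ⟨u, hu⟩ htop
    rw [meromorphicOrderAt_eq_top_iff] at htop
    have h1 : ∃ᶠ z in 𝓝[≠] u, G z = 0 := htop.frequently
    exact hne (hG.eqOn_zero_of_preconnected_of_frequently_eq_zero hconn hu h1 hq₀)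
  have hfin : (MeromorphicOn.divisor G U).support.Finite :=
    (MeromorphicOn.divisor G U).finiteSupport (isCompact_closedBall _ _)
  obtain ⟨H, hHan, hH0, hHeq⟩ := hmer.extract_zeros_poles hord hfin
  set D := MeromorphicOn.divisor G U
  have hD0 : ∀ u, 0 ≤ D u := fun u => MeromorphicOn.AnalyticOnNhd.divisor_nonneg hG u
  have hprod : (∏ᶠ u, (fun z : ℂ => z - u) ^ D u) =
      fun q => ∏ u ∈ hfin.toFinset, (q - u) ^ (D u).toNat := by
    rw [finprod_eq_prod_of_mulSupport_subset (s := hfin.toFinset)]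
    · ext q
      rw [Finset.prod_apply]
      refine Finset.prod_congr rfl fun u _ => ?_
      conv_lhs => rw [← Int.toNat_of_nonneg (hD0 u)]
      rw [zpow_natCast]
      rfl
    · intro u hu
      simp only [Finite.coe_toFinset, Function.mem_support]
      intro h
      apply hu
      simp only [h, zpow_zero]
  refine ⟨hfin.toFinset, fun u => (D u).toNat, H, ?_, ?_, ?_, ?_, ?_⟩
  · intro u hu
    have : D u ≠ 0 := by simpa using hu
    have := hD0 u
    show (D u).toNat ≠ 0
    omega
  · intro u hu
    have hu' : D u ≠ 0 := by simpa using hu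
    have huU : u ∈ U := D.supportWithinDomain hu'
    refine ⟨huU, ?_⟩
    by_contra hGu
    apply hu'
    have : D u = (meromorphicOrderAt G u).untop₀ := MeromorphicOn.divisor_apply hmer huU
    rw [this]
    have h3 : meromorphicOrderAt G u = 0 := by
      rw [(hG u huU).meromorphicOrderAt_eq, (hG u huU).analyticOrderAt_eq_zero.mpr hGu]
      rfl
    rw [h3]; rfl
  · exact hHan.continuousOn.mono Metric.ball_subset_closedBall
  · exact fun q hq => hH0 ⟨q, Metric.ball_subset_closedBall hq⟩
  · intro q hq
    have hqU := Metric.ball_subset_closedBall hq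
    have h1 : ∀ᶠ z in 𝓝[≠] q, G z = (∏ u ∈ hfin.toFinset, (z - u) ^ (D u).toNat) * H z := by
      have h2 := hHeq
      rw [Filter.EventuallyEq, hprod, Filter.Eventually, mem_codiscreteWithin] at h2
      have h3 := h2 q hqU
      rw [disjoint_principal_right] at h3
      have hball : Metric.ball (0 : ℂ) R ∈ 𝓝[≠] q :=
        mem_nhdsWithin_of_mem_nhds (Metric.isOpen_ball.mem_nhds hq)
      filter_upwards [h3, hball] with z hz hzb
      by_contra hcon
      exact hz ⟨Metric.ball_subset_closedBall hzb, hcon⟩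
    have h4 : ContinuousAt G q := (hG q hqU).continuousAt
    have h5 : ContinuousAt (fun z => (∏ u ∈ hfin.toFinset, (z - u) ^ (D u).toNat) * H z) q := by
      have := (hHan q hqU).continuousAt
      fun_prop
    have h6 := h4.tendsto.mono_left (nhdsWithin_le_nhds (s := {q}ᶜ))
    have h7 := h5.tendsto.mono_left (nhdsWithin_le_nhds (s := {q}ᶜ))
    exact tendsto_nhds_unique (h6.congr' h1) h7

theorem wind_disc {G : ℂ → ℂ} (hG : DifferentiableOn ℂ G (Metric.ball 0 1)) {ρ' ρ : ℝ}
    (hρ' : 0 < ρ') (h1 : ρ' < ρ) (h2 : ρ < 1) (hnz : ∀ q : ℂ, ρ' < ‖q‖ → ‖q‖ < 1 → G q ≠ 0) :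
    ∃ n : ℕ, Wind (fun θ => G (ρ * Complex.exp (2 * π * I * θ))) n ∧
      (n = 0 → ∀ q ∈ Metric.ball (0 : ℂ) 1, G q ≠ 0) := by
  set R := (ρ + 1) / 2 with hRdef
  have hρ0 : 0 < ρ := hρ'.trans h1
  have hR1 : R < 1 := by rw [hRdef]; linarith
  have hρR : ρ < R := by rw [hRdef]; linarith
  have hsub : Metric.closedBall (0 : ℂ) R ⊆ Metric.ball 0 1 := Metric.closedBall_subset_ball hR1
  have han : AnalyticOnNhd ℂ G (Metric.closedBall 0 R) :=
    (hG.analyticOnNhd Metric.isOpen_ball).mono hsub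
  have hq : ((ρ : ℂ)) ∈ Metric.closedBall (0 : ℂ) R := by
    simp [abs_of_pos hρ0, hρR.le]
  have hGρ : G ρ ≠ 0 := hnz _ (by simpa [abs_of_pos hρ0] using h1)
    (by simpa [abs_of_pos hρ0] using h2)
  obtain ⟨S, d, H, hd, hS, hHc, hH0, hfac⟩ := exists_factorization han hq hGρ
  have hSρ : ∀ u ∈ S, ‖u‖ < ρ := by
    intro u hu
    by_contra hcon
    have h3 := (hS u hu).1
    rw [mem_closedBall_zero_iff] at h3
    exact hnz u (by linarith) (by linarith) (hS u hu).2
  have hmem : ∀ θ : ℝ, (ρ * Complex.exp (2 * π * I * θ) : ℂ) ∈ Metric.ball (0 : ℂ) R := by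
    intro θ
    have : (2 * π * I * θ : ℂ) = ((2 * π * θ : ℝ) : ℂ) * I := by push_cast; ring
    rw [mem_ball_zero_iff, norm_mul, this, Complex.norm_exp_ofReal_mul_I]
    simpa [abs_of_pos hρ0] using hρR
  refine ⟨∑ u ∈ S, d u, ?_, ?_⟩
  · have hw := (Wind.prod S (g := fun u θ => (ρ * Complex.exp (2 * π * I * θ) - u) ^ d u)
      (j := fun u => d u * 1) fun u hu => (wind_circle_sub hρ0 (hSρ u hu)).pow (d u)).mul
      (wind_circle_of_nonvanishing hρ0 hρR hHc hH0)
    convert hw using 1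
    · ext θ
      exact hfac _ (hmem θ)
    · simp
  · intro h0 q hqb
    have hSe : S = ∅ := by
      rw [Finset.eq_empty_iff_forall_notMem]
      intro u hu
      exact hd u hu ((Finset.sum_eq_zero_iff.mp h0) u hu)
    by_cases hq' : ‖q‖ < R
    · rw [hfac q (by simpa using hq'), hSe]
      simpa using hH0 q (by simpa using hq')
    · exact hnz q (by linarith) (by simpa using hqb)

end Refl

namespace Refl

open Complex Filter Topology Set Real

/-- A bounded `1`-periodic holomorphic function on the upper half plane without zeros near the
real axis has nonnegative winding number; if the winding number is `0`, then it has no zeros,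
and its value at the cusp is nonzero. -/
theorem wind_upperHalfPlane {g : ℂ → ℂ} (hg : DifferentiableOn ℂ g {ζ | 0 < ζ.im})
    (hper : ∀ ζ : ℂ, 0 < ζ.im → g (ζ + 1) = g ζ) {A C : ℝ}
    (hbd : ∀ ζ : ℂ, 0 < ζ.im → A ≤ ζ.im → ‖g ζ‖ ≤ C) {c δ : ℝ} (hc : 0 < c) (hcδ : c < δ)
    (hnz : ∀ ζ : ℂ, 0 < ζ.im → ζ.im < δ → g ζ ≠ 0) {j : ℤ}
    (hw : Wind (fun θ => g (θ + c * I)) j) :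
    0 ≤ j ∧ (j = 0 → (∀ ζ : ℂ, 0 < ζ.im → g ζ ≠ 0) ∧
      ∃ l : ℂ, l ≠ 0 ∧ Tendsto g (comap Complex.im atTop) (𝓝 l)) := by
  classical
  have hopen : IsOpen {ζ : ℂ | 0 < ζ.im} := isOpen_lt continuous_const Complex.continuous_im
  let g' : ℂ → ℂ := fun ζ => if 0 < ζ.im then g ζ else 0
  have hg'p : Function.Periodic g' ((1 : ℝ) : ℂ) := by
    intro ζ
    simp only [g', Complex.add_im, Complex.ofReal_one, Complex.one_im, add_zero]
    split_ifs with h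
    · exact hper ζ h
    · rfl
  have hg'd : ∀ ζ : ℂ, 0 < ζ.im → DifferentiableAt ℂ g' ζ := by
    intro ζ hζ
    refine (hg.differentiableAt (hopen.mem_nhds hζ)).congr_of_eventuallyEq ?_
    filter_upwards [hopen.mem_nhds hζ] with z hz
    simp only [g', if_pos (show 0 < z.im from hz)]
  have hI : ∀ B : ℝ, ∀ᶠ z in comap Complex.im atTop, B < z.im := fun B =>
    (eventually_gt_atTop B).comap _
  have hbd' : BoundedAtFilter (comap Complex.im atTop) g' := by
    refine Asymptotics.IsBigO.of_bound C ?_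
    filter_upwards [hI 0, hI A] with z hz hzA
    simp only [g', if_pos hz, Pi.one_apply, norm_one, mul_one]
    exact hbd z hz hzA.le
  have hd' : ∀ᶠ z in comap Complex.im atTop, DifferentiableAt ℂ g' z := by
    filter_upwards [hI 0] with z hz using hg'd z hz
  set G := Function.Periodic.cuspFunction 1 g'
  have hGq : ∀ ζ : ℂ, G (Complex.exp (2 * π * I * ζ)) = g' ζ := by
    intro ζ
    have := Function.Periodic.eq_cuspFunction (h := 1) one_ne_zero hg'p ζ
    simpa [Function.Periodic.qParam] using this
  have hsurj : ∀ q : ℂ, q ≠ 0 → ∃ ζ : ℂ, Complex.exp (2 * π * I * ζ) = q := by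
    intro q hq
    refine ⟨Complex.log q / (2 * π * I), ?_⟩
    rw [mul_div_cancel₀ _ Complex.two_pi_I_ne_zero, Complex.exp_log hq]
  have hnorm : ∀ ζ : ℂ, ‖Complex.exp (2 * π * I * ζ)‖ = Real.exp (-(2 * π * ζ.im)) := by
    intro ζ
    rw [Complex.norm_exp]
    congr 1
    simp
  have hπ := Real.pi_pos
  have him : ∀ (ζ : ℂ) (x : ℝ), ‖Complex.exp (2 * π * I * ζ)‖ < Real.exp (-(2 * π * x)) ↔
      x < ζ.im := by
    intro ζ x
    rw [hnorm, Real.exp_lt_exp, neg_lt_neg_iff]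
    exact mul_lt_mul_iff_right₀ (by positivity)
  have him' : ∀ (ζ : ℂ) (x : ℝ), Real.exp (-(2 * π * x)) < ‖Complex.exp (2 * π * I * ζ)‖ ↔
      ζ.im < x := by
    intro ζ x
    rw [hnorm, Real.exp_lt_exp, neg_lt_neg_iff]
    exact mul_lt_mul_iff_right₀ (by positivity)
  have hone : Real.exp (-(2 * π * 0)) = 1 := by simp
  have hGd : DifferentiableOn ℂ G (Metric.ball 0 1) := by
    intro q hq
    apply DifferentiableAt.differentiableWithinAt
    by_cases hq0 : q = 0
    · rw [hq0]
      exact Function.Periodic.differentiableAt_cuspFunction_zero one_pos hg'p hd' hbd'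
    · obtain ⟨ζ, rfl⟩ := hsurj q hq0
      have hζ : 0 < ζ.im := by
        rw [mem_ball_zero_iff, ← hone, him] at hq
        exact hq
      have := Function.Periodic.differentiableAt_cuspFunction (h := 1) one_ne_zero hg'p (hg'd ζ hζ)
      simpa [Function.Periodic.qParam] using this
  obtain ⟨n, hn, hn0⟩ := wind_disc hGd (ρ' := Real.exp (-(2 * π * δ)))
    (ρ := Real.exp (-(2 * π * c))) (Real.exp_pos _)
    (by rw [Real.exp_lt_exp, neg_lt_neg_iff]; exact (mul_lt_mul_iff_right₀ (by positivity)).mpr hcδ)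
    (by rw [Real.exp_lt_one_iff]; simp only [Left.neg_neg_iff]; positivity)
    (by
      intro q hq1 hq2
      have hq0 : q ≠ 0 := by
        rintro rfl
        rw [norm_zero] at hq1
        exact absurd hq1 (Real.exp_pos _).le.not_gt
      obtain ⟨ζ, rfl⟩ := hsurj q hq0
      rw [him'] at hq1
      rw [← hone, him] at hq2
      rw [hGq]
      simp only [g', if_pos hq2]
      exact hnz ζ hq2 hq1)
  have hw' : Wind (fun θ => g (θ + c * I)) n := by
    convert hn using 1
    ext θ
    have h1 : ((Real.exp (-(2 * π * c)) : ℝ) : ℂ) * Complex.exp (2 * π * I * θ) =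
        Complex.exp (2 * π * I * (θ + c * I)) := by
      rw [Complex.ofReal_exp, ← Complex.exp_add]
      congr 1
      push_cast
      linear_combination (-(2 * π * c : ℂ)) * Complex.I_sq
    rw [h1, hGq]
    have h2 : 0 < ((θ : ℂ) + c * I).im := by simpa using hc
    simp only [g', if_pos h2]
  have hj := hw.unique hw'
  refine ⟨by rw [hj]; positivity, fun hj0 => ?_⟩
  have hn' : n = 0 := by exact_mod_cast hj.symm.trans hj0
  have hG0 := hn0 hn'
  refine ⟨fun ζ hζ => ?_, G 0, hG0 0 (by simp), ?_⟩
  · have := hG0 (Complex.exp (2 * π * I * ζ)) (by rw [mem_ball_zero_iff, ← hone, him]; exact hζ)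
    rw [hGq] at this
    simpa only [g', if_pos hζ] using this
  · have := Function.Periodic.tendsto_at_I_inf one_pos hg'p hd' hbd'
    refine this.congr' ?_
    filter_upwards [hI 0] with z hz
    simp only [g', if_pos hz]

end Refl

namespace Refl

open Complex Filter Topology Set Real

/-- The positive cone of the quadratic form `v w - t y ^ 2`. -/
def PosCone (t : ℝ) : Set (ℝ × ℝ × ℝ) := {p | 0 < p.1 ∧ t * p.2.1 ^ 2 < p.1 * p.2.2}

/-- The vector of imaginary parts. -/
def imv (p : ℂ × ℂ × ℂ) : ℝ × ℝ × ℝ := (p.1.im, p.2.1.im, p.2.2.im)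

/-- The tube domain over the positive cone. -/
def Om (t : ℝ) : Set (ℂ × ℂ × ℂ) := {p | imv p ∈ PosCone t}

/-- The bilinear form of `2 (v w - t y ^ 2)` against an integral vector. -/
def sg {R : Type*} [CommRing R] (t : ℕ) (y : ℤ × ℤ × ℤ) (p : R × R × R) : R :=
  y.1 * p.2.2 + y.2.2 * p.1 - 2 * t * y.2.1 * p.2.1

/-- An Eichler transvection. -/
def eK {R : Type*} [CommRing R] (t : ℕ) (y e : ℤ × ℤ × ℤ) (n : ℤ) (p : R × R × R) : R × R × R :=
  (p.1 + sg t y p * e.1 - sg t e p * y.1 + n * sg t y p * y.1,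
   p.2.1 + sg t y p * e.2.1 - sg t e p * y.2.1 + n * sg t y p * y.2.1,
   p.2.2 + sg t y p * e.2.2 - sg t e p * y.2.2 + n * sg t y p * y.2.2)

/-- The data defining a transvection which preserves the positive cone. -/
structure EichlerData (t : ℕ) (y e : ℤ × ℤ × ℤ) (n : ℤ) : Prop where
  iso : y.1 * y.2.2 = t * y.2.1 ^ 2
  orth : y.1 * e.2.2 + y.2.2 * e.1 = 2 * t * y.2.1 * e.2.1
  norm : e.1 * e.2.2 - t * e.2.1 ^ 2 = -n
  nonneg₁ : 0 ≤ y.1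
  nonneg₃ : 0 ≤ y.2.2
  pos : 0 < y.1 + y.2.2

/-- Restriction of an orthogonal modular form to a Siegel-type subdomain of degree two. -/
structure HForm (t : ℕ) (k : ℤ) (h : ℂ × ℂ × ℂ → ℂ) : Prop where
  holo : DifferentiableOn ℂ h (Om t)
  trans : ∀ a b c : ℤ, ∀ p ∈ Om t, h (p.1 + a, p.2.1 + b, p.2.2 + c) = h p
  swap : ∀ p ∈ Om t, h (p.2.2, p.2.1, p.1) = h p
  sl2 : ∀ a b c d : ℤ, a * d - b * c = 1 → ∀ p ∈ Om t,
    h ((a * p.1 + b) / (c * p.1 + d), p.2.1 / (c * p.1 + d),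
      p.2.2 - t * c * p.2.1 ^ 2 / (c * p.1 + d)) = (c * p.1 + d) ^ k * h p
  eich : ∀ y e n, EichlerData t y e n → ∀ p ∈ Om t, h (eK t y e n p) = h p

theorem isOpen_posCone (t : ℝ) : IsOpen (PosCone t) := by
  have h1 : IsOpen {p : ℝ × ℝ × ℝ | 0 < p.1} := isOpen_lt continuous_const (by fun_prop)
  have h2 : IsOpen {p : ℝ × ℝ × ℝ | t * p.2.1 ^ 2 < p.1 * p.2.2} :=
    isOpen_lt (by fun_prop) (by fun_prop)
  exact h1.inter h2

theorem continuous_imv : Continuous imv := by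
  unfold imv
  exact (Complex.continuous_im.comp continuous_fst).prodMk
    ((Complex.continuous_im.comp (continuous_fst.comp continuous_snd)).prodMk
      (Complex.continuous_im.comp (continuous_snd.comp continuous_snd)))

theorem isOpen_Om (t : ℝ) : IsOpen (Om t) := (isOpen_posCone t).preimage continuous_imv

/-- Convexity of the regions `v w > a y ^ 2 + b v ^ 2 + c`. -/
theorem convex_region {a b c : ℝ} (ha : 0 ≤ a) (_hb : 0 ≤ b) (hc : 0 ≤ c) :
    Convex ℝ {p : ℝ × ℝ × ℝ | 0 < p.1 ∧ a * p.2.1 ^ 2 + b * p.1 ^ 2 + c < p.1 * p.2.2} := by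
  rintro ⟨v, y, w⟩ ⟨hv, h⟩ ⟨v', y', w'⟩ ⟨hv', h'⟩ α β hα hβ hαβ
  simp only at hv h hv' h'
  have hpos : 0 < α * v + β * v' := by
    rcases hα.eq_or_lt with rfl | hα'
    · have : β = 1 := by linarith
      subst this; simpa using hv'
    · have := mul_pos hα' hv
      have := mul_nonneg hβ hv'.le
      linarith
  refine ⟨by simpa using hpos, ?_⟩
  simp only [Prod.smul_mk, smul_eq_mul, Prod.mk_add_mk]
  have hcross : 2 * a * y * y' + 2 * b * v * v' + 2 * c < v * w' + v' * w := by
    have e1 : v * v' * (v * w' + v' * w) = v ^ 2 * (v' * w') + v' ^ 2 * (v * w) := by ring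
    have e2 : v ^ 2 * (a * y' ^ 2 + b * v' ^ 2 + c) + v' ^ 2 * (a * y ^ 2 + b * v ^ 2 + c) <
        v * v' * (v * w' + v' * w) := by
      rw [e1]
      exact add_lt_add (mul_lt_mul_of_pos_left h' (by positivity))
        (mul_lt_mul_of_pos_left h (by positivity))
    have e3 : v * v' * (2 * a * y * y' + 2 * b * v * v' + 2 * c) ≤
        v ^ 2 * (a * y' ^ 2 + b * v' ^ 2 + c) + v' ^ 2 * (a * y ^ 2 + b * v ^ 2 + c) := by
      nlinarith [mul_nonneg ha (sq_nonneg (v * y' - v' * y)), mul_nonneg hc (sq_nonneg (v - v'))]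
    exact lt_of_mul_lt_mul_left (e3.trans_lt e2) (by positivity)
  have hs : α ^ 2 + β ^ 2 + 2 * α * β = 1 := by
    have : (α + β) ^ 2 = 1 := by rw [hαβ]; ring
    linarith
  have key : (α * v + β * v') * (α * w + β * w') -
      (a * (α * y + β * y') ^ 2 + b * (α * v + β * v') ^ 2 + c) =
      α ^ 2 * (v * w - (a * y ^ 2 + b * v ^ 2 + c)) +
      β ^ 2 * (v' * w' - (a * y' ^ 2 + b * v' ^ 2 + c)) +
      α * β * (v * w' + v' * w - (2 * a * y * y' + 2 * b * v * v' + 2 * c)) := by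
    linear_combination c * hs
  have h1 : 0 < v * w - (a * y ^ 2 + b * v ^ 2 + c) := by linarith
  have h2 : 0 < v' * w' - (a * y' ^ 2 + b * v' ^ 2 + c) := by linarith
  have h3 : 0 < v * w' + v' * w - (2 * a * y * y' + 2 * b * v * v' + 2 * c) := by linarith
  rcases hα.eq_or_lt with rfl | hα'
  · have : β = 1 := by linarith
    subst this
    nlinarith
  · have := mul_pos (pow_pos hα' 2) h1
    have := mul_nonneg (pow_nonneg hβ 2) h2.le
    have := mul_nonneg (mul_nonneg hα hβ) h3.le
    linarith

theorem convex_posCone {t : ℝ} (ht : 0 ≤ t) : Convex ℝ (PosCone t) := by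
  have := convex_region ht (le_refl (0 : ℝ)) (le_refl (0 : ℝ))
  simpa [PosCone] using this

theorem sg_pos {t : ℕ} {y : ℤ × ℤ × ℤ} (hiso : y.1 * y.2.2 = t * y.2.1 ^ 2) (h1 : 0 ≤ y.1)
    (h3 : 0 ≤ y.2.2) (hp : 0 < y.1 + y.2.2) {Y : ℝ × ℝ × ℝ} (hY : Y ∈ PosCone t) :
    0 < sg t y Y := by
  obtain ⟨v, x, w⟩ := Y
  obtain ⟨a, b, c⟩ := y
  obtain ⟨hv, hvw⟩ := hY
  simp only [sg] at *
  have hiso' : (a : ℝ) * c = t * b ^ 2 := by exact_mod_cast hiso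
  have ha : (0 : ℝ) ≤ a := by exact_mod_cast h1
  have hc : (0 : ℝ) ≤ c := by exact_mod_cast h3
  have hac : (0 : ℝ) < a + c := by exact_mod_cast hp
  have ht : (0 : ℝ) ≤ t := Nat.cast_nonneg t
  have hw : 0 < w := by
    have : 0 < v * w := lt_of_le_of_lt (by positivity) hvw
    exact (pos_iff_pos_of_mul_pos this).mp hv
  have hs : 0 < a * w + c * v := by
    rcases ha.eq_or_lt with h | h
    · rw [← h] at hac ⊢
      have : 0 < (c : ℝ) := by linarith
      nlinarith
    · have := mul_pos h hw
      have := mul_nonneg hc hv.le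
      linarith
  have hbx : (2 * t * b * x) ^ 2 ≤ 4 * (a * c) * (t * x ^ 2) := by rw [hiso']; nlinarith
  have h4 : 4 * (a * c) * (t * x ^ 2) ≤ 4 * (a * c) * (v * w) :=
    mul_le_mul_of_nonneg_left hvw.le (by positivity)
  by_cases hac0 : (a : ℝ) * c = 0
  · have : (2 * t * b * x) ^ 2 ≤ 0 := by rw [hac0] at hbx; simpa using hbx
    have : 2 * t * b * x = 0 := by
      have := le_antisymm this (sq_nonneg _)
      exact pow_eq_zero_iff (two_ne_zero) |>.mp this
    rw [this]; linarith
  · have hac1 : (0 : ℝ) < a * c := lt_of_le_of_ne (by positivity) (Ne.symm hac0)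
    have h5 : 4 * (a * c) * (t * x ^ 2) < 4 * (a * c) * (v * w) :=
      mul_lt_mul_of_pos_left hvw (by positivity)
    have h6 : (2 * t * b * x) ^ 2 < (a * w + c * v) ^ 2 := by
      nlinarith [sq_nonneg (a * w - c * v)]
    have := abs_lt_of_sq_lt_sq h6 hs.le
    linarith [(abs_lt.mp this).2]

theorem mem_posCone_of_sg_pos {t : ℕ} {y : ℤ × ℤ × ℤ} (hiso : y.1 * y.2.2 = t * y.2.1 ^ 2)
    (h1 : 0 ≤ y.1) (h3 : 0 ≤ y.2.2) (hp : 0 < y.1 + y.2.2) {Y : ℝ × ℝ × ℝ}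
    (hQ : t * Y.2.1 ^ 2 < Y.1 * Y.2.2) (hY : 0 < sg t y Y) : Y ∈ PosCone t := by
  refine ⟨?_, hQ⟩
  by_contra hneg
  have ht : (0 : ℝ) ≤ t := Nat.cast_nonneg t
  have hne : Y.1 ≠ 0 := by
    intro h0
    rw [h0, zero_mul] at hQ
    exact absurd hQ (not_lt.mpr (by positivity))
  have hlt : Y.1 < 0 := lt_of_le_of_ne (not_lt.mp hneg) hne
  have := sg_pos hiso h1 h3 hp (Y := -Y) ⟨by simpa using hlt, by simpa using hQ⟩
  simp only [sg, Prod.snd_neg, Prod.fst_neg] at this hY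
  linarith

section
variable {t : ℕ} {y e : ℤ × ℤ × ℤ} {n : ℤ} {R : Type*} [CommRing R]

theorem EichlerData.iso' (hd : EichlerData t y e n) : (y.1 : R) * y.2.2 = t * y.2.1 ^ 2 := by
  exact_mod_cast congrArg (Int.cast : ℤ → R) hd.iso

theorem EichlerData.orth' (hd : EichlerData t y e n) :
    (y.1 : R) * e.2.2 + y.2.2 * e.1 = 2 * t * y.2.1 * e.2.1 := by
  exact_mod_cast congrArg (Int.cast : ℤ → R) hd.orth

theorem EichlerData.norm' (hd : EichlerData t y e n) :
    (e.1 : R) * e.2.2 - t * e.2.1 ^ 2 = -n := by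
  exact_mod_cast congrArg (Int.cast : ℤ → R) hd.norm

theorem EichlerData.neg (hd : EichlerData t y e n) : EichlerData t y (-e) n where
  iso := hd.iso
  orth := by have := hd.orth; simp only [Prod.snd_neg, Prod.fst_neg]; linear_combination -this
  norm := by have := hd.norm; simp only [Prod.snd_neg, Prod.fst_neg]; linear_combination this
  nonneg₁ := hd.nonneg₁
  nonneg₃ := hd.nonneg₃
  pos := hd.pos

theorem EichlerData.smul (hd : EichlerData t y e n) (j : ℤ) :
    EichlerData t y (j • e) (j ^ 2 * n) where
  iso := hd.iso
  orth := by
    have := hd.orth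
    simp only [Prod.smul_fst, Prod.smul_snd, smul_eq_mul]; linear_combination j * this
  norm := by
    have := hd.norm
    simp only [Prod.smul_fst, Prod.smul_snd, smul_eq_mul]; linear_combination j ^ 2 * this
  nonneg₁ := hd.nonneg₁
  nonneg₃ := hd.nonneg₃
  pos := hd.pos

theorem sg_eK (hd : EichlerData t y e n) (p : R × R × R) : sg t y (eK t y e n p) = sg t y p := by
  have h1 := hd.iso' (R := R)
  have h2 := hd.orth' (R := R)
  simp only [sg, eK]
  linear_combination
    (2 * (n * (y.1 * p.2.2 + y.2.2 * p.1 - 2 * t * y.2.1 * p.2.1) -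
      (e.1 * p.2.2 + e.2.2 * p.1 - 2 * t * e.2.1 * p.2.1))) * h1 +
    (y.1 * p.2.2 + y.2.2 * p.1 - 2 * t * y.2.1 * p.2.1) * h2

theorem norm_eK (hd : EichlerData t y e n) (p : R × R × R) :
    (eK t y e n p).1 * (eK t y e n p).2.2 - t * (eK t y e n p).2.1 ^ 2 =
      p.1 * p.2.2 - t * p.2.1 ^ 2 := by
  have h1 := hd.iso' (R := R)
  have h2 := hd.orth' (R := R)
  have h3 := hd.norm' (R := R)
  simp only [eK]
  have hs : sg t y p = y.1 * p.2.2 + y.2.2 * p.1 - 2 * t * y.2.1 * p.2.1 := rfl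
  have he : sg t e p = e.1 * p.2.2 + e.2.2 * p.1 - 2 * t * e.2.1 * p.2.1 := rfl
  generalize sg t y p = s at *
  generalize sg t e p = u at *
  linear_combination s ^ 2 * h3 + s * (n * s - u) * h2 + (n * s - u) ^ 2 * h1
    - (n * s - u) * hs - s * he

theorem eK_neg_eK (hd : EichlerData t y e n) (p : R × R × R) :
    eK t y (-e) n (eK t y e n p) = p := by
  have h1 := sg_eK hd p
  have h2 := hd.orth' (R := R)
  have h3 := hd.norm' (R := R)
  have h4 : sg t (-e) (eK t y e n p) = -sg t e p + 2 * n * sg t y p := by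
    have hs : sg t y p = y.1 * p.2.2 + y.2.2 * p.1 - 2 * t * y.2.1 * p.2.1 := rfl
    have he : sg t e p = e.1 * p.2.2 + e.2.2 * p.1 - 2 * t * e.2.1 * p.2.1 := rfl
    have hx : sg t (-e) (eK t y e n p) = -(e.1 * (eK t y e n p).2.2 + e.2.2 * (eK t y e n p).1
        - 2 * t * e.2.1 * (eK t y e n p).2.1) := by simp [sg]; ring
    rw [hx]
    simp only [eK]
    generalize sg t y p = s at *
    generalize sg t e p = u at *
    linear_combination (-2 * s) * h3 - (n * s - u) * h2 + he
  have h5 : eK t y (-e) n (eK t y e n p) =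
    ((eK t y e n p).1 - sg t y p * e.1 - (-sg t e p + 2 * n * sg t y p) * y.1 +
        n * sg t y p * y.1,
     (eK t y e n p).2.1 - sg t y p * e.2.1 - (-sg t e p + 2 * n * sg t y p) * y.2.1 +
        n * sg t y p * y.2.1,
     (eK t y e n p).2.2 - sg t y p * e.2.2 - (-sg t e p + 2 * n * sg t y p) * y.2.2 +
        n * sg t y p * y.2.2) := by
    conv_lhs => rw [eK, h1, h4]
    simp only [Prod.fst_neg, Prod.snd_neg, Int.cast_neg]
    ext <;> simp only <;> ring
  rw [h5]
  simp only [eK]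
  ext <;> simp only <;> ring

end

theorem imv_eK (t : ℕ) (y e : ℤ × ℤ × ℤ) (n : ℤ) (p : ℂ × ℂ × ℂ) :
    imv (eK t y e n p) = eK t y e n (imv p) := by
  have hs : ∀ y : ℤ × ℤ × ℤ, (sg t y p).im = sg t y (imv p) := by
    intro y
    simp [sg, imv]
  have h1 : ∀ (z : ℂ) (m : ℤ), (z * m).im = z.im * m := by intro z m; simp
  have h2 : ∀ (z : ℂ) (m : ℤ), ((m : ℂ) * z).im = m * z.im := by intro z m; simp
  simp only [imv, eK, Complex.add_im, Complex.sub_im, h1, h2, hs]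

theorem eK_mem_posCone {t : ℕ} {y e : ℤ × ℤ × ℤ} {n : ℤ} (hd : EichlerData t y e n)
    {Y : ℝ × ℝ × ℝ} (hY : Y ∈ PosCone t) : eK t y e n Y ∈ PosCone t := by
  apply mem_posCone_of_sg_pos hd.iso hd.nonneg₁ hd.nonneg₃ hd.pos
  · have := norm_eK hd Y
    have := hY.2
    linarith
  · rw [sg_eK hd]
    exact sg_pos hd.iso hd.nonneg₁ hd.nonneg₃ hd.pos hY

end Refl

namespace Refl

open Complex Filter Topology Set Real

/-- `h` is bounded by `C` on the real points over the imaginary part `Y`. -/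
def BdOver (h : ℂ × ℂ × ℂ → ℂ) (Y : ℝ × ℝ × ℝ) (C : ℝ) : Prop := ∀ Z, imv Z = Y → ‖h Z‖ ≤ C

section
variable {t : ℕ} {k : ℤ} {h : ℂ × ℂ × ℂ → ℂ}

theorem HForm.bdd_over_compact (H : HForm t k h) {K : Set (ℝ × ℝ × ℝ)} (hK : IsCompact K)
    (hKc : K ⊆ PosCone t) : ∃ C, ∀ Y ∈ K, BdOver h Y C := by
  let m : (ℝ × ℝ × ℝ) × (ℝ × ℝ × ℝ) → ℂ × ℂ × ℂ := fun q =>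
    (q.1.1 + q.2.1 * I, q.1.2.1 + q.2.2.1 * I, q.1.2.2 + q.2.2.2 * I)
  have hm : Continuous m := by fun_prop
  have himv : ∀ q, imv (m q) = q.2 := by
    intro q; simp [imv, m]
  have hbox : IsCompact (Icc (0 : ℝ) 1 ×ˢ (Icc (0 : ℝ) 1 ×ˢ Icc (0 : ℝ) 1)) :=
    isCompact_Icc.prod (isCompact_Icc.prod isCompact_Icc)
  have hcont : ContinuousOn (fun q => h (m q))
      ((Icc (0 : ℝ) 1 ×ˢ (Icc (0 : ℝ) 1 ×ˢ Icc (0 : ℝ) 1)) ×ˢ K) := by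
    refine H.holo.continuousOn.comp hm.continuousOn ?_
    rintro q ⟨-, hq⟩
    change imv (m q) ∈ PosCone t
    rw [himv]; exact hKc hq
  obtain ⟨C, hC⟩ := (hbox.prod hK).exists_bound_of_continuousOn hcont
  refine ⟨C, fun Y hY Z hZ => ?_⟩
  have hZ' : Z ∈ Om t := by change imv Z ∈ PosCone t; rw [hZ]; exact hKc hY
  rw [← H.trans (-⌊Z.1.re⌋) (-⌊Z.2.1.re⌋) (-⌊Z.2.2.re⌋) Z hZ']
  have := hC ((Int.fract Z.1.re, Int.fract Z.2.1.re, Int.fract Z.2.2.re), Y)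
    ⟨⟨⟨Int.fract_nonneg _, (Int.fract_lt_one _).le⟩, ⟨Int.fract_nonneg _, (Int.fract_lt_one _).le⟩,
      ⟨Int.fract_nonneg _, (Int.fract_lt_one _).le⟩⟩, hY⟩
  refine le_of_eq_of_le (congrArg (fun z => ‖h z‖) ?_) this
  subst hZ
  refine Prod.ext ?_ (Prod.ext ?_ ?_) <;>
    apply Complex.ext <;> simp [m, imv, Int.fract, sub_eq_add_neg]

theorem HForm.bdOver_segment (H : HForm t k h) {Y₀ Y₁ : ℝ × ℝ × ℝ} (h₀ : Y₀ ∈ PosCone t)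
    (h₁ : Y₁ ∈ PosCone t) {C : ℝ} (b₀ : BdOver h Y₀ C) (b₁ : BdOver h Y₁ C) {s : ℝ}
    (hs : s ∈ Icc (0 : ℝ) 1) : BdOver h (Y₀ + s • (Y₁ - Y₀)) C := by
  have hseg : ∀ s ∈ Icc (0 : ℝ) 1, Y₀ + s • (Y₁ - Y₀) ∈ PosCone t := by
    intro s hs
    have := (convex_posCone (Nat.cast_nonneg t)).add_smul_sub_mem h₀ h₁ hs
    simpa using this
  obtain ⟨C', hC'⟩ := H.bdd_over_compact (K := (fun s : ℝ => Y₀ + s • (Y₁ - Y₀)) '' Icc 0 1)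
    (isCompact_Icc.image (by fun_prop)) (by rintro _ ⟨s, hs, rfl⟩; exact hseg s hs)
  intro Z hZ
  let l : ℂ → ℂ × ℂ × ℂ := fun ζ => (Z.1 + (ζ - s * I) * ((Y₁.1 - Y₀.1 : ℝ) : ℂ),
    Z.2.1 + (ζ - s * I) * ((Y₁.2.1 - Y₀.2.1 : ℝ) : ℂ),
    Z.2.2 + (ζ - s * I) * ((Y₁.2.2 - Y₀.2.2 : ℝ) : ℂ))
  have hl : Differentiable ℂ l := by fun_prop
  have hZ1 : Z.1.im = Y₀.1 + s * (Y₁.1 - Y₀.1) := congrArg Prod.fst hZ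
  have hZ2 : Z.2.1.im = Y₀.2.1 + s * (Y₁.2.1 - Y₀.2.1) := congrArg (fun p => p.2.1) hZ
  have hZ3 : Z.2.2.im = Y₀.2.2 + s * (Y₁.2.2 - Y₀.2.2) := congrArg (fun p => p.2.2) hZ
  have him : ∀ ζ : ℂ, imv (l ζ) = Y₀ + ζ.im • (Y₁ - Y₀) := by
    intro ζ
    refine Prod.ext ?_ (Prod.ext ?_ ?_) <;> simp [imv, l, hZ1, hZ2, hZ3] <;> ring
  have hcl : closure (Complex.im ⁻¹' Ioo (0 : ℝ) 1) ⊆ {ζ | ζ.im ∈ Icc (0 : ℝ) 1} := by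
    refine closure_minimal (fun z hz => ⟨hz.1.le, hz.2.le⟩) ?_
    exact isClosed_Icc.preimage Complex.continuous_im
  have hd : DifferentiableOn ℂ (fun ζ => h (l ζ)) {ζ | ζ.im ∈ Icc (0 : ℝ) 1} := by
    refine H.holo.comp hl.differentiableOn ?_
    intro ζ hζ
    change imv (l ζ) ∈ PosCone t
    rw [him]; exact hseg _ hζ
  have key := PhragmenLindelof.horizontal_strip (a := 0) (b := 1) (f := fun ζ => h (l ζ)) (C := C)
    (z := s * I) ⟨hd.mono (fun z hz => ⟨hz.1.le, hz.2.le⟩), (hd.continuousOn).mono hcl⟩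
    ⟨0, by simpa using Real.pi_pos, 0, by
      refine Asymptotics.IsBigO.of_bound C' ?_
      refine eventually_inf_principal.mpr (Eventually.of_forall fun z hz => ?_)
      simpa using hC' _ ⟨z.im, ⟨hz.1.le, hz.2.le⟩, rfl⟩ (l z) (him z)⟩
    (fun z hz => b₀ _ (by rw [him, hz]; simp)) (fun z hz => b₁ _ (by rw [him, hz]; simp))
    (by simpa using hs.1) (by simpa using hs.2)
  simpa [l] using key

theorem HForm.bdOver_eK (H : HForm t k h) {y e : ℤ × ℤ × ℤ} {n : ℤ} (hd : EichlerData t y e n)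
    {Y : ℝ × ℝ × ℝ} (hY : Y ∈ PosCone t) {C : ℝ} (b : BdOver h Y C) :
    BdOver h (eK t y e n Y) C := by
  intro Z hZ
  have h1 : imv (eK t y (-e) n Z) = Y := by rw [imv_eK, hZ, eK_neg_eK hd]
  have h2 := eK_neg_eK hd.neg Z
  rw [neg_neg] at h2
  rw [← h2, H.eich y e n hd _ (by change imv _ ∈ PosCone t; rw [h1]; exact hY)]
  exact b _ h1

/-- The Koecher principle along an isotropic direction. -/
theorem HForm.bdOver_add (H : HForm t k h) {y e : ℤ × ℤ × ℤ} {n : ℤ} (hd : EichlerData t y e n)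
    (hn : 0 < n) {Y : ℝ × ℝ × ℝ} (hY : Y ∈ PosCone t) {C : ℝ} (b : BdOver h Y C) {η : ℝ}
    (hη : 0 ≤ η) : BdOver h (Y + η • ((y.1 : ℝ), (y.2.1 : ℝ), (y.2.2 : ℝ))) C := by
  have hσ := sg_pos hd.iso hd.nonneg₁ hd.nonneg₃ hd.pos hY
  have hnσ : 0 < n * sg t y Y := mul_pos (by exact_mod_cast hn) hσ
  obtain ⟨j, hj⟩ := exists_nat_gt (η / (n * sg t y Y))
  have hj' : η < (j : ℝ) ^ 2 * (n * sg t y Y) := by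
    have h1 : η < j * (n * sg t y Y) := (div_lt_iff₀ hnσ).mp hj
    have h2 : (j : ℝ) ≤ (j : ℝ) ^ 2 := by exact_mod_cast Nat.le_self_pow two_ne_zero j
    exact h1.trans_le (mul_le_mul_of_nonneg_right h2 hnσ.le)
  have hpos : 0 < (j : ℝ) ^ 2 * (n * sg t y Y) := hη.trans_lt hj'
  have hdj := hd.smul (j : ℤ)
  have m1 := H.bdOver_segment (eK_mem_posCone hdj hY) (eK_mem_posCone hdj.neg hY)
    (H.bdOver_eK hdj hY b) (H.bdOver_eK hdj.neg hY b) (s := 1 / 2) (by constructor <;> norm_num)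
  set y' : ℝ × ℝ × ℝ := ((y.1 : ℝ), (y.2.1 : ℝ), (y.2.2 : ℝ)) with hy'
  have hmid : eK t y ((j : ℤ) • e) ((j : ℤ) ^ 2 * n) Y + (1 / 2 : ℝ) •
      (eK t y (-((j : ℤ) • e)) ((j : ℤ) ^ 2 * n) Y - eK t y ((j : ℤ) • e) ((j : ℤ) ^ 2 * n) Y) =
      Y + ((j : ℝ) ^ 2 * (n * sg t y Y)) • y' := by
    refine Prod.ext ?_ (Prod.ext ?_ ?_) <;> simp [eK, sg, hy'] <;> ring
  rw [hmid] at m1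
  have hY1 : Y + ((j : ℝ) ^ 2 * (n * sg t y Y)) • y' ∈ PosCone t := by
    rw [← hmid]
    have := (convex_posCone (Nat.cast_nonneg t)).add_smul_sub_mem (eK_mem_posCone hdj hY)
      (eK_mem_posCone hdj.neg hY) (show (1 / 2 : ℝ) ∈ Icc (0 : ℝ) 1 by constructor <;> norm_num)
    exact this
  have := H.bdOver_segment hY hY1 b m1 (s := η / ((j : ℝ) ^ 2 * (n * sg t y Y)))
    ⟨by positivity, by rw [div_le_one hpos]; exact hj'.le⟩
  rw [add_sub_cancel_left, smul_smul, div_mul_cancel₀ _ hpos.ne'] at this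
  exact this

end

/-- The transvections used to reach the rational isotropic directions. -/
theorem eichlerData_rat {t : ℕ} (N p : ℤ) (hN : N ≠ 0) :
    EichlerData t (N ^ 2, p * N, t * p ^ 2) (0, N, 2 * t * p) (t * N ^ 2) where
  iso := by simp only; ring
  orth := by simp only; ring
  norm := by simp only; ring
  nonneg₁ := by positivity
  nonneg₃ := by positivity
  pos := by have : 0 < N ^ 2 := by positivity
            have : (0 : ℤ) ≤ t * p ^ 2 := by positivity
            simp only; omega

theorem eichlerData_inf {t : ℕ} (n : ℤ) : EichlerData t (0, 0, 1) (0, n, 0) (t * n ^ 2) where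
  iso := by simp
  orth := by simp
  norm := by simp
  nonneg₁ := by simp
  nonneg₃ := by simp
  pos := by simp

end Refl

namespace Refl

open Complex Filter Topology Set Real MatrixGroups ModularForm
open UpperHalfPlane (denom_ne_zero)
open scoped UpperHalfPlane

theorem coe_sl_smul (γ : SL(2, ℤ)) (z : ℍ) :
    ((γ • z : ℍ) : ℂ) = (γ 0 0 * z + γ 0 1) / (γ 1 0 * z + γ 1 1) := by
  rw [UpperHalfPlane.specialLinearGroup_apply]
  simp

theorem sl_det_eq (γ : SL(2, ℤ)) : γ 0 0 * γ 1 1 - γ 0 1 * γ 1 0 = 1 := by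
  have := γ.det_coe
  rwa [Matrix.det_fin_two] at this

/-- A holomorphic function with the transformation and growth properties of a modular form. -/
theorem exists_modularForm {f : ℂ → ℂ} {k : ℤ} (Γ : Subgroup SL(2, ℤ)) [Γ.FiniteIndex]
    (hf : DifferentiableOn ℂ f {z | 0 < z.im})
    (hmod : ∀ γ ∈ Γ, ∀ z : ℂ, 0 < z.im →
      f ((γ 0 0 * z + γ 0 1) / (γ 1 0 * z + γ 1 1)) = (γ 1 0 * z + γ 1 1) ^ k * f z)
    (hbd : ∀ γ : SL(2, ℤ), ∃ A C : ℝ, ∀ z : ℂ, 0 < z.im → A ≤ z.im →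
      ‖(γ 1 0 * z + γ 1 1) ^ (-k) * f ((γ 0 0 * z + γ 0 1) / (γ 1 0 * z + γ 1 1))‖ ≤ C) :
    ∃ F : ModularForm (Γ.map (Matrix.SpecialLinearGroup.mapGL ℝ)) k, ∀ z : ℍ, F z = f z := by
  refine ⟨{ toFun := fun z => f z, slash_action_eq' := ?_, holo' := ?_, bdd_at_cusps' := ?_ },
    fun z => rfl⟩
  · rintro _ ⟨γ, hγ, rfl⟩
    have : (fun z : ℍ => f z) ∣[k] γ = fun z : ℍ => f z := by
      funext z
      rw [ModularForm.slash_action_eq'_iff, coe_sl_smul]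
      exact hmod γ hγ z z.im_pos
    exact this
  · rw [UpperHalfPlane.mdifferentiable_iff]
    refine hf.congr fun z hz => ?_
    simp [UpperHalfPlane.ofComplex_apply_of_im_pos hz]
  · intro c hc
    rw [Subgroup.IsArithmetic.isCusp_iff_isCusp_SL2Z] at hc
    rw [OnePoint.isBoundedAt_iff_forall_SL2Z hc]
    intro γ _
    rw [UpperHalfPlane.isBoundedAtImInfty_iff]
    obtain ⟨A, C, hAC⟩ := hbd γ
    refine ⟨C, A, fun z hz => ?_⟩
    have := hAC z z.im_pos hz
    rw [ModularForm.SL_slash_apply, coe_sl_smul, mul_comm]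
    exact this

/-- Modular forms of level one and negative weight vanish. -/
theorem levelOne_neg_weight {f : ℂ → ℂ} {k : ℤ} (hk : k < 0)
    (hf : DifferentiableOn ℂ f {z | 0 < z.im})
    (hmod : ∀ a b c d : ℤ, a * d - b * c = 1 → ∀ z : ℂ, 0 < z.im →
      f ((a * z + b) / (c * z + d)) = (c * z + d) ^ k * f z)
    {A C : ℝ} (hbd : ∀ z : ℂ, 0 < z.im → A ≤ z.im → ‖f z‖ ≤ C) {z : ℂ} (hz : 0 < z.im) :
    f z = 0 := by
  obtain ⟨F, hF⟩ := exists_modularForm (k := k) (⊤ : Subgroup SL(2, ℤ)) hf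
    (fun γ _ z hz => hmod _ _ _ _ (sl_det_eq γ) z hz) (fun γ => ⟨A, C, fun z hz hA => by
      rw [hmod _ _ _ _ (sl_det_eq γ) z hz, ← mul_assoc, ← zpow_add₀, neg_add_cancel, zpow_zero,
        one_mul]
      · exact hbd z hz hA
      · exact denom_ne_zero γ ⟨z, hz⟩⟩)
  have h0 := ModularForm.isZero_of_neg_weight hk F
  have := hF ⟨z, hz⟩
  rw [h0] at this
  simpa using this.symm

/-- Modular functions of weight zero for a subgroup of finite index are constant. -/
theorem modular_weight_zero_const {f : ℂ → ℂ} (Γ : Subgroup SL(2, ℤ)) [Γ.FiniteIndex]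
    (hf : DifferentiableOn ℂ f {z | 0 < z.im})
    (hmod : ∀ γ ∈ Γ, ∀ z : ℂ, 0 < z.im →
      f ((γ 0 0 * z + γ 0 1) / (γ 1 0 * z + γ 1 1)) = f z)
    (hbd : ∀ γ : SL(2, ℤ), ∃ A C : ℝ, ∀ z : ℂ, 0 < z.im → A ≤ z.im →
      ‖f ((γ 0 0 * z + γ 0 1) / (γ 1 0 * z + γ 1 1))‖ ≤ C) {z w : ℂ} (hz : 0 < z.im)
    (hw : 0 < w.im) : f z = f w := by
  obtain ⟨F, hF⟩ := exists_modularForm (k := 0) Γ hf (by simpa using hmod) (by simpa using hbd)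
  obtain ⟨c, hc⟩ := ModularForm.eq_const_of_weight_zero F
  have h1 := hF ⟨z, hz⟩
  have h2 := hF ⟨w, hw⟩
  rw [hc] at h1 h2
  exact h1.symm.trans h2

/-- Every point of the upper half plane is equivalent to one of imaginary part at least `1 / 2`. -/
theorem exists_half_le_im {z : ℂ} (hz : 0 < z.im) : ∃ a b c d : ℤ, a * d - b * c = 1 ∧
    1 / 2 ≤ ((a * z + b) / (c * z + d)).im := by
  obtain ⟨γ, h1, -⟩ := ModularGroup.exists_one_half_le_im_smul_and_norm_denom_le ⟨z, hz⟩
  refine ⟨_, _, _, _, sl_det_eq γ, ?_⟩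
  rw [← UpperHalfPlane.coe_im, coe_sl_smul] at h1
  exact h1

/-- A nowhere vanishing form of level one with nonzero value at the cusp has weight zero. -/
theorem weight_eq_zero_of_nonvanishing {f : ℂ → ℂ} {k : ℤ}
    (hf : DifferentiableOn ℂ f {z | 0 < z.im})
    (hmod : ∀ a b c d : ℤ, a * d - b * c = 1 → ∀ z : ℂ, 0 < z.im →
      f ((a * z + b) / (c * z + d)) = (c * z + d) ^ k * f z)
    (hne : ∀ z : ℂ, 0 < z.im → f z ≠ 0) {l : ℂ} (hl : l ≠ 0)
    (hlim : Tendsto f (comap Complex.im atTop) (𝓝 l)) : k = 0 := by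
  have hev : ∀ g : ℂ → ℂ, ∀ m : ℂ, Tendsto g (comap Complex.im atTop) (𝓝 m) →
      ∃ A C : ℝ, ∀ z : ℂ, 0 < z.im → A ≤ z.im → ‖g z‖ ≤ C := by
    intro g m hg
    have := (hg.norm).eventually_lt_const (lt_add_one ‖m‖)
    rw [eventually_comap] at this
    obtain ⟨A, hA⟩ := eventually_atTop.mp this
    exact ⟨A, _, fun z _ hz => (hA z.im hz z rfl).le⟩
  rcases lt_trichotomy k 0 with hk | hk | hk
  · obtain ⟨A, C, h⟩ := hev f l hlim
    exact absurd (levelOne_neg_weight hk hf hmod h (z := Complex.I) (by simp)) (hne Complex.I (by simp))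
  · exact hk
  · obtain ⟨A, C, h⟩ := hev (fun z => (f z)⁻¹) l⁻¹ (hlim.inv₀ hl)
    have := levelOne_neg_weight (f := fun z => (f z)⁻¹) (k := -k) (by omega)
      (hf.inv hne) (fun a b c d hd z hz => by
        rw [hmod a b c d hd z hz, mul_inv, _root_.zpow_neg]) h (z := Complex.I) (by simp)
    exact absurd (inv_eq_zero.mp this) (hne Complex.I (by simp))

end Refl

namespace Refl

open Complex Filter Topology Set Real

/-- A region of imaginary parts which meets no mirror. -/
def Reg (t : ℝ) : Set (ℝ × ℝ × ℝ) :=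
  {p | (0 < p.1 ∧ t * p.2.1 ^ 2 + 1 / 4 * p.1 ^ 2 < p.1 * p.2.2) ∧
    t * p.2.1 ^ 2 + 1 / 4 < p.1 * p.2.2 ∧ 0 < p.2.1 ∧ p.2.1 < p.1}

/-- Translation by an integral vector. -/
def tr (e : ℤ × ℤ × ℤ) (p : ℂ × ℂ × ℂ) : ℂ × ℂ × ℂ := (p.1 + e.1, p.2.1 + e.2.1, p.2.2 + e.2.2)

theorem convex_reg {t : ℝ} (ht : 0 ≤ t) : Convex ℝ (Reg t) := by
  have h1 := convex_region ht (by norm_num : (0 : ℝ) ≤ 1 / 4) (le_refl (0 : ℝ))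
  have h2 := convex_region ht (le_refl (0 : ℝ)) (by norm_num : (0 : ℝ) ≤ 1 / 4)
  have h3 : Convex ℝ {p : ℝ × ℝ × ℝ | 0 < p.2.1} :=
    convex_halfSpace_gt (f := fun p : ℝ × ℝ × ℝ => p.2.1)
      ⟨fun _ _ => rfl, fun _ _ => rfl⟩ 0
  have h4 : Convex ℝ {p : ℝ × ℝ × ℝ | p.2.1 - p.1 < 0} :=
    convex_halfSpace_lt (f := fun p : ℝ × ℝ × ℝ => p.2.1 - p.1)
      ⟨fun _ _ => by simp; ring, fun _ _ => by simp; ring⟩ 0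
  convert h1.inter (h2.inter (h3.inter h4)) using 1
  ext p
  simp only [Reg, mem_ofPred_eq, mem_inter_iff, sub_neg]
  constructor
  · rintro ⟨⟨a, b⟩, c, d, e⟩; exact ⟨⟨a, by linarith⟩, ⟨a, by linarith⟩, d, e⟩
  · rintro ⟨⟨a, b⟩, ⟨-, c⟩, d, e⟩; exact ⟨⟨a, by linarith⟩, by linarith, d, e⟩

theorem isOpen_reg (t : ℝ) : IsOpen (Reg t) := by
  have h1 : IsOpen {p : ℝ × ℝ × ℝ | 0 < p.1} := isOpen_lt continuous_const (by fun_prop)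
  have h2 : IsOpen {p : ℝ × ℝ × ℝ | t * p.2.1 ^ 2 + 1 / 4 * p.1 ^ 2 < p.1 * p.2.2} :=
    isOpen_lt (by fun_prop) (by fun_prop)
  have h3 : IsOpen {p : ℝ × ℝ × ℝ | t * p.2.1 ^ 2 + 1 / 4 < p.1 * p.2.2} :=
    isOpen_lt (by fun_prop) (by fun_prop)
  have h4 : IsOpen {p : ℝ × ℝ × ℝ | 0 < p.2.1} := isOpen_lt continuous_const (by fun_prop)
  have h5 : IsOpen {p : ℝ × ℝ × ℝ | p.2.1 < p.1} := isOpen_lt (by fun_prop) (by fun_prop)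
  exact (h1.inter h2).inter (h3.inter (h4.inter h5))

theorem reg_subset {t : ℝ} : Reg t ⊆ PosCone t := by
  rintro p ⟨⟨h1, h2⟩, -⟩
  exact ⟨h1, by nlinarith [sq_nonneg p.1]⟩

theorem imv_tr (e : ℤ × ℤ × ℤ) (p : ℂ × ℂ × ℂ) : imv (tr e p) = imv p := by
  simp [imv, tr]

theorem tr_tr (e e' : ℤ × ℤ × ℤ) (p : ℂ × ℂ × ℂ) : tr e (tr e' p) = tr (e + e') p := by
  simp only [tr, Prod.fst_add, Prod.snd_add, Int.cast_add]
  refine Prod.ext ?_ (Prod.ext ?_ ?_) <;> simp only <;> ring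

theorem imv_smul_add (r s : ℝ) (p q : ℂ × ℂ × ℂ) :
    imv (r • p + s • q) = r • imv p + s • imv q := by
  simp [imv]

theorem convex_preimage_imv {S : Set (ℝ × ℝ × ℝ)} (hS : Convex ℝ S) : Convex ℝ (imv ⁻¹' S) := by
  intro p hp q hq a b ha hb hab
  change imv _ ∈ S
  rw [imv_smul_add]
  exact hS hp hq ha hb hab

/-- The vector of imaginary parts stays in the cone along an isotropic direction. -/
theorem add_mem_posCone {t : ℕ} {y e : ℤ × ℤ × ℤ} {n : ℤ} (hd : EichlerData t y e n)
    {Y : ℝ × ℝ × ℝ} (hY : Y ∈ PosCone t) {s : ℝ} (hs : 0 ≤ s) :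
    Y + s • ((y.1 : ℝ), (y.2.1 : ℝ), (y.2.2 : ℝ)) ∈ PosCone t := by
  have hσ := sg_pos hd.iso hd.nonneg₁ hd.nonneg₃ hd.pos hY
  have h1 := hd.iso' (R := ℝ)
  refine mem_posCone_of_sg_pos hd.iso hd.nonneg₁ hd.nonneg₃ hd.pos ?_ ?_
  · have h2 := hY.2
    have h3 := mul_nonneg hs hσ.le
    simp only [sg] at h3
    simp only [Prod.fst_add, Prod.snd_add, Prod.smul_mk, smul_eq_mul]
    have h4 : (Y.1 + s * y.1) * (Y.2.2 + s * y.2.2) - t * (Y.2.1 + s * y.2.1) ^ 2 =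
        Y.1 * Y.2.2 - t * Y.2.1 ^ 2 +
          s * (y.1 * Y.2.2 + y.2.2 * Y.1 - 2 * t * y.2.1 * Y.2.1) := by
      linear_combination s ^ 2 * h1
    linarith
  · refine lt_of_lt_of_eq hσ ?_
    simp only [sg, Prod.fst_add, Prod.snd_add, Prod.smul_mk, smul_eq_mul]
    linear_combination (-2 * s) * h1

section
variable {t : ℕ} {k : ℤ} {h : ℂ × ℂ × ℂ → ℂ}

theorem HForm.tr (H : HForm t k h) (e : ℤ × ℤ × ℤ) {p : ℂ × ℂ × ℂ} (hp : p ∈ Om t) :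
    h (tr e p) = h p := H.trans _ _ _ p hp

/-- `h` has a logarithm on the region over `Reg`, with additive periods. -/
theorem HForm.exists_log (H : HForm t k h) (ht : 0 < t) (hne : ∀ p, imv p ∈ Reg t → h p ≠ 0) :
    ∃ (Λ : ℂ × ℂ × ℂ → ℂ) (w : ℤ × ℤ × ℤ →+ ℤ), ContinuousOn Λ (imv ⁻¹' Reg t) ∧
      (∀ p ∈ imv ⁻¹' Reg t, Complex.exp (Λ p) = h p) ∧
      ∀ e, ∀ p ∈ imv ⁻¹' Reg t, Λ (Refl.tr e p) - Λ p = w e * (2 * π * I) := by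
  have ht' : (0 : ℝ) ≤ t := Nat.cast_nonneg t
  have hconv := convex_preimage_imv (convex_reg ht')
  have hop := (isOpen_reg t).preimage continuous_imv
  have ht1 : (1 : ℝ) ≤ t := by exact_mod_cast ht
  have hnon : imv ⁻¹' Reg t ≠ (∅ : Set (ℂ × ℂ × ℂ)) := by
    refine Set.nonempty_iff_ne_empty.mp ⟨(I, (1 / (2 * t) : ℝ) * I, I), ?_⟩
    have e1 : t * (1 / (2 * (t : ℝ))) ^ 2 = 1 / (4 * t) := by field_simp; norm_num
    have e2 : 1 / (4 * (t : ℝ)) ≤ 1 / 4 := by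
      apply one_div_le_one_div_of_le <;> linarith
    have e3 : 1 / (2 * (t : ℝ)) ≤ 1 / 2 := by
      apply one_div_le_one_div_of_le <;> linarith
    have e4 : 0 < 1 / (2 * (t : ℝ)) := by positivity
    have e5 : imv (I, ((1 / (2 * t) : ℝ) : ℂ) * I, I) = (1, 1 / (2 * (t : ℝ)), 1) := by
      simp only [imv, I_im, mul_I_im, ofReal_re]
    change imv _ ∈ Reg t
    rw [e5]
    refine ⟨⟨by norm_num, ?_⟩, ?_, e4, by simp only; linarith⟩ <;> simp only [e1] <;> linarith
  have hsub : imv ⁻¹' Reg t ⊆ Om t := fun p hp => reg_subset hp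
  obtain ⟨Λ, hΛ, hexp⟩ := exists_continuousOn_log hconv (Set.nonempty_iff_ne_empty.mpr hnon) hop
    (H.holo.continuousOn.mono hsub) (fun p hp => hne p hp)
  obtain ⟨p₀, hp₀⟩ := Set.nonempty_iff_ne_empty.mpr hnon
  have htr : ∀ e, ∀ p ∈ imv ⁻¹' Reg t, Refl.tr e p ∈ imv ⁻¹' Reg (t : ℝ) := by
    intro e p hp; change imv _ ∈ Reg (t : ℝ); rw [imv_tr]; exact hp
  have hw : ∀ e : ℤ × ℤ × ℤ, ∃ m : ℤ, ∀ p ∈ imv ⁻¹' Reg (t : ℝ),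
      Λ (Refl.tr e p) - Λ p = m * (2 * π * I) := by
    intro e
    have : Complex.exp (Λ (Refl.tr e p₀)) = Complex.exp (Λ p₀) := by
      rw [hexp _ (htr e _ hp₀), hexp _ hp₀, H.tr e (hsub hp₀)]
    obtain ⟨m, hm⟩ := Complex.exp_eq_exp_iff_exists_int.mp this
    refine ⟨m, fun p hp => ?_⟩
    rw [exp_eq_const_of_preconnected hconv.isPreconnected
      (φ := fun p => Λ (Refl.tr e p) - Λ p) (c := 1) ?_ ?_ p hp p₀ hp₀, hm]
    · ring
    · refine (hΛ.comp (Continuous.continuousOn ?_) (htr e)).sub hΛ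
      unfold Refl.tr; fun_prop
    · intro q hq
      rw [Complex.exp_sub, hexp _ (htr e _ hq), hexp _ hq, H.tr e (hsub hq),
        div_self (hne q hq)]
  choose w hw using hw
  have hinj : ∀ a b : ℤ, (a : ℂ) * (2 * π * I) = b * (2 * π * I) → a = b := by
    intro a b hab
    exact_mod_cast mul_right_cancel₀ Complex.two_pi_I_ne_zero hab
  refine ⟨Λ, AddMonoidHom.mk' w ?_, hΛ, hexp, hw⟩
  intro a b
  apply hinj
  have h1 := hw a _ (htr b _ hp₀)
  have h2 := hw b _ hp₀
  rw [tr_tr] at h1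
  rw [← hw (a + b) _ hp₀]
  push_cast
  linear_combination h1 + h2

end

end Refl

namespace Refl

open Complex Filter Topology Set Real

/-- The complex line through `p` in an integral direction. -/
def ln (d : ℤ × ℤ × ℤ) (p : ℂ × ℂ × ℂ) (ζ : ℂ) : ℂ × ℂ × ℂ :=
  (p.1 + ζ * d.1, p.2.1 + ζ * d.2.1, p.2.2 + ζ * d.2.2)

theorem imv_ln (d : ℤ × ℤ × ℤ) (p : ℂ × ℂ × ℂ) (ζ : ℂ) :
    imv (ln d p ζ) = imv p + ζ.im • ((d.1 : ℝ), (d.2.1 : ℝ), (d.2.2 : ℝ)) := by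
  simp [imv, ln]

theorem ln_add_one (d : ℤ × ℤ × ℤ) (p : ℂ × ℂ × ℂ) (ζ : ℂ) :
    ln d p (ζ + 1) = tr d (ln d p ζ) := by
  simp only [ln, tr]
  refine Prod.ext ?_ (Prod.ext ?_ ?_) <;> simp only <;> ring

theorem differentiable_ln (d : ℤ × ℤ × ℤ) (p : ℂ × ℂ × ℂ) : Differentiable ℂ (ln d p) := by
  unfold ln; fun_prop

section
variable {t : ℕ} {k : ℤ} {h : ℂ × ℂ × ℂ → ℂ}

/-- Zero counting along isotropic lines: the period of a logarithm of `h` is nonnegative, and if it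
vanishes then `h` has no zeros on the line. -/
theorem HForm.line (H : HForm t k h) {Λ : ℂ × ℂ × ℂ → ℂ} {w : ℤ × ℤ × ℤ →+ ℤ}
    (hΛ : ContinuousOn Λ (imv ⁻¹' Reg t)) (hne : ∀ p, imv p ∈ Reg t → h p ≠ 0)
    (hexp : ∀ p ∈ imv ⁻¹' Reg t, Complex.exp (Λ p) = h p)
    (hw : ∀ e, ∀ p ∈ imv ⁻¹' Reg t, Λ (Refl.tr e p) - Λ p = w e * (2 * π * I))
    {d e : ℤ × ℤ × ℤ} {n : ℤ} (hd : EichlerData t d e n) (hn : 0 < n) {p : ℂ × ℂ × ℂ}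
    (hp : imv p ∈ Reg t) :
    0 ≤ w d ∧ (w d = 0 → ∀ ζ : ℂ, 0 < ζ.im → h (ln d p ζ) ≠ 0) := by
  have hpc := reg_subset hp
  obtain ⟨δ, hδ, hreg⟩ : ∃ δ > 0, ∀ s : ℝ, |s| < δ →
      imv p + s • ((d.1 : ℝ), (d.2.1 : ℝ), (d.2.2 : ℝ)) ∈ Reg t := by
    have hc : Continuous fun s : ℝ => imv p + s • ((d.1 : ℝ), (d.2.1 : ℝ), (d.2.2 : ℝ)) := by
      fun_prop
    have := (isOpen_reg (t : ℝ)).preimage hc |>.mem_nhds (x := 0) (by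
      change imv p + (0 : ℝ) • _ ∈ Reg (t : ℝ); rw [zero_smul, add_zero]; exact hp)
    obtain ⟨δ, hδ, h⟩ := Metric.mem_nhds_iff.mp this
    exact ⟨δ, hδ, fun s hs => h (by simpa using hs)⟩
  obtain ⟨C, hC⟩ := H.bdd_over_compact (isCompact_singleton (x := imv p))
    (by simpa using hpc)
  have hmem : ∀ ζ : ℂ, 0 ≤ ζ.im → ln d p ζ ∈ Om t := by
    intro ζ hζ
    change imv _ ∈ PosCone t
    rw [imv_ln]; exact add_mem_posCone hd hpc hζ
  have hmemR : ∀ ζ : ℂ, |ζ.im| < δ → imv (ln d p ζ) ∈ Reg t := by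
    intro ζ hζ
    rw [imv_ln]; exact hreg _ hζ
  have hδ2 : ∀ θ : ℝ, |((θ : ℂ) + (δ / 2 : ℝ) * I).im| < δ := by
    intro θ
    have e : ((θ : ℂ) + (δ / 2 : ℝ) * I).im = δ / 2 := by
      rw [add_im, ofReal_im, mul_I_im, ofReal_re, zero_add]
    rw [e, abs_of_pos (by positivity)]; linarith
  have key := wind_upperHalfPlane (g := fun ζ => h (ln d p ζ)) (A := 0) (C := C) (c := δ / 2)
    (δ := δ) (j := w d)
    (H.holo.comp (differentiable_ln d p).differentiableOn (fun ζ hζ => hmem ζ (le_of_lt hζ)))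
    (fun ζ hζ => by rw [ln_add_one, H.tr d (hmem ζ hζ.le)])
    (fun ζ hζ _ => H.bdOver_add hd hn hpc (hC _ rfl) hζ.le _ (imv_ln d p ζ))
    (by positivity) (by linarith)
    (fun ζ hζ hζ' => hne _ (hmemR ζ (by rwa [abs_of_pos hζ])))
    ⟨fun θ => Λ (ln d p (θ + (δ / 2 : ℝ) * I)), ?_, ?_, ?_⟩
  · exact ⟨key.1, fun h0 => (key.2 h0).1⟩
  · refine hΛ.comp_continuous ?_ ?_
    · exact (differentiable_ln d p).continuous.comp (by fun_prop)
    · intro θ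
      exact hmemR _ (hδ2 θ)
  · intro θ
    exact hexp _ (hmemR _ (hδ2 θ))
  · intro θ
    have h1 := hw d (ln d p (θ + (δ / 2 : ℝ) * I)) (hmemR _ (hδ2 θ))
    rw [← ln_add_one] at h1
    have h2 : ((θ + 1 : ℝ) : ℂ) + (δ / 2 : ℝ) * I = θ + (δ / 2 : ℝ) * I + 1 := by push_cast; ring
    simp only [h2]
    linear_combination h1

theorem HForm.neg (H : HForm t k h) {p : ℂ × ℂ × ℂ} (hp : p ∈ Om t) :
    h (p.1, -p.2.1, p.2.2) = (-1) ^ k * h p := by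
  have := H.sl2 (-1) 0 0 (-1) (by norm_num) p hp
  simpa [div_neg] using this

theorem HForm.heis (H : HForm t k h) (n : ℤ) {p : ℂ × ℂ × ℂ} (hp : p ∈ Om t) :
    h (p.1, p.2.1 + n * p.1, p.2.2 + 2 * t * n * p.2.1 + t * n ^ 2 * p.1) = h p := by
  rw [← H.eich (0, 0, 1) (0, n, 0) (t * n ^ 2) (eichlerData_inf n) p hp]
  congr 1
  simp only [eK, sg]
  refine Prod.ext ?_ (Prod.ext ?_ ?_) <;> simp <;> ring

theorem neg_mem_Om {p : ℂ × ℂ × ℂ} (hp : p ∈ Om t) : (p.1, -p.2.1, p.2.2) ∈ Om t := by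
  obtain ⟨h1, h2⟩ := hp
  refine ⟨h1, ?_⟩
  simpa [imv] using h2

/-- The periods of a logarithm of `h` are multiples of a single linear form. -/
theorem HForm.periods (H : HForm t k h) (ht : 0 < t) {Λ : ℂ × ℂ × ℂ → ℂ} {w : ℤ × ℤ × ℤ →+ ℤ}
    (hΛ : ContinuousOn Λ (imv ⁻¹' Reg t)) (hne : ∀ p, imv p ∈ Reg t → h p ≠ 0)
    (hexp : ∀ p ∈ imv ⁻¹' Reg t, Complex.exp (Λ p) = h p)
    (hw : ∀ e, ∀ p ∈ imv ⁻¹' Reg t, Λ (Refl.tr e p) - Λ p = w e * (2 * π * I)) :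
    ∃ A : ℤ, ∀ a b c, w (a, b, c) = A * (a - t * b + c) := by
  have ht' : (0 : ℝ) ≤ t := Nat.cast_nonneg t
  have ht1 : (1 : ℝ) ≤ t := by exact_mod_cast ht
  have hinj : ∀ a b : ℤ, (a : ℂ) * (2 * π * I) = b * (2 * π * I) → a = b := by
    intro a b hab
    exact_mod_cast mul_right_cancel₀ Complex.two_pi_I_ne_zero hab
  have hconv := convex_preimage_imv (convex_reg ht')
  have hsub : imv ⁻¹' Reg t ⊆ Om t := fun p hp => reg_subset hp
  have htr : ∀ e, ∀ p ∈ imv ⁻¹' Reg t, Refl.tr e p ∈ imv ⁻¹' Reg (t : ℝ) := by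
    intro e p hp; change imv _ ∈ Reg (t : ℝ); rw [imv_tr]; exact hp
  -- a point fixed in both regions
  let p₀ : ℂ × ℂ × ℂ := (I, (1 / (2 * t) : ℝ) * I, I)
  have hp₀ : imv p₀ = (1, 1 / (2 * (t : ℝ)), 1) := by
    simp only [p₀, imv, I_im, mul_I_im, ofReal_re]
  have hp₀R : imv p₀ ∈ Reg t := by
    have e1 : t * (1 / (2 * (t : ℝ))) ^ 2 = 1 / (4 * t) := by field_simp; norm_num
    have e2 : 1 / (4 * (t : ℝ)) ≤ 1 / 4 := by
      apply one_div_le_one_div_of_le <;> linarith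
    have e3 : 1 / (2 * (t : ℝ)) ≤ 1 / 2 := by
      apply one_div_le_one_div_of_le <;> linarith
    have e4 : 0 < 1 / (2 * (t : ℝ)) := by positivity
    rw [hp₀]
    refine ⟨⟨by norm_num, ?_⟩, ?_, e4, by simp only; linarith⟩ <;> simp only [e1] <;> linarith
  have hswap : w (1, 0, 0) = w (0, 0, 1) := by
    let S := imv ⁻¹' (Reg (t : ℝ) ∩ {q | (q.2.2, q.2.1, q.1) ∈ Reg t})
    have hSc : Convex ℝ S := by
      refine convex_preimage_imv ((convex_reg ht').inter ?_)
      exact (convex_reg ht').is_linear_preimage (f := fun q : ℝ × ℝ × ℝ => (q.2.2, q.2.1, q.1))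
        ⟨fun _ _ => rfl, fun _ _ => rfl⟩
    have hS₀ : p₀ ∈ S := ⟨hp₀R, by rw [hp₀] at hp₀R ⊢; exact hp₀R⟩
    have hS₁ : Refl.tr (0, 0, 1) p₀ ∈ S := by
      change imv _ ∈ Reg (t : ℝ) ∩ {q | (q.2.2, q.2.1, q.1) ∈ Reg t}; rw [imv_tr]; exact hS₀
    have := exp_eq_const_of_preconnected hSc.isPreconnected
      (φ := fun p => Λ (p.2.2, p.2.1, p.1) - Λ p) (c := 1) ?_ ?_ _ hS₁ p₀ hS₀
    · have e1 := hw (1, 0, 0) p₀ hp₀R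
      have e2 := hw (0, 0, 1) p₀ hp₀R
      apply hinj
      rw [← e1, ← e2]
      simp only [Refl.tr, p₀] at this ⊢
      linear_combination this
    · refine (hΛ.comp (Continuous.continuousOn (by fun_prop)) ?_).sub (hΛ.mono fun p hp => hp.1)
      intro p hp; exact hp.2
    · intro p hp
      rw [Complex.exp_sub, hexp _ hp.1, hexp _ hp.2, H.swap p (hsub hp.1), div_self (hne p hp.1)]
  have hS1 : w (1, 0, 0) = w (1, 1, t) := by
    let f : ℂ × ℂ × ℂ → ℂ × ℂ × ℂ := fun p => (p.1, p.1 - p.2.1, p.2.2 - 2 * t * p.2.1 + t * p.1)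
    have hf : ∀ p ∈ imv ⁻¹' Reg t, f p ∈ imv ⁻¹' Reg (t : ℝ) := by
      rintro p ⟨⟨h1, h2⟩, h3, h4, h5⟩
      have e : imv (f p) = ((imv p).1, (imv p).1 - (imv p).2.1,
          (imv p).2.2 - 2 * t * (imv p).2.1 + t * (imv p).1) := by simp [imv, f]
      change imv (f p) ∈ Reg (t : ℝ)
      rw [e]
      refine ⟨⟨h1, ?_⟩, ?_, sub_pos.mpr h5, ?_⟩
      · simp only; linarith
      · simp only; linarith
      · simp only; linarith
    have hhf : ∀ p ∈ imv ⁻¹' Reg t, h (f p) = (-1) ^ k * h p := by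
      intro p hp
      rw [← H.neg (hsub hp), ← H.heis 1 (neg_mem_Om (hsub hp))]
      congr 1
      refine Prod.ext ?_ (Prod.ext ?_ ?_) <;> simp [f] <;> ring
    have := exp_eq_const_of_preconnected hconv.isPreconnected
      (φ := fun p => Λ (f p) - Λ p) (c := (-1) ^ k) ?_ ?_ _ (htr (1, 0, 0) _ hp₀R) p₀ hp₀R
    · have e1 := hw (1, 0, 0) p₀ hp₀R
      have e2 := hw (1, 1, t) (f p₀) (hf _ hp₀R)
      apply hinj
      rw [← e1, ← e2]
      have e3 : f (Refl.tr (1, 0, 0) p₀) = Refl.tr (1, 1, t) (f p₀) := by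
        simp only [f, Refl.tr]
        refine Prod.ext ?_ (Prod.ext ?_ ?_) <;> simp <;> ring
      rw [e3] at this
      linear_combination -this
    · refine (hΛ.comp (Continuous.continuousOn ?_) hf).sub hΛ
      fun_prop
    · intro p hp
      rw [Complex.exp_sub, hexp _ hp, hexp _ (hf p hp), hhf p hp, mul_div_assoc,
        div_self (hne p hp), mul_one]
  have hlin : ∀ a b c, w (a, b, c) = a * w (1, 0, 0) + b * w (0, 1, 0) + c * w (0, 0, 1) := by
    intro a b c
    have : ((a, b, c) : ℤ × ℤ × ℤ) = a • (1, 0, 0) + b • (0, 1, 0) + c • (0, 0, 1) := by simp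
    rw [this, map_add, map_add, map_zsmul, map_zsmul, map_zsmul]
    simp
  refine ⟨w (0, 0, 1), fun a b c => ?_⟩
  have h1 := hlin 1 1 t
  rw [hlin a b c, hswap]
  rw [← hS1, hswap] at h1
  linear_combination b * (-h1)

end

end Refl

namespace Refl

open Complex Filter Topology Set Real

section
variable {t : ℕ} {k : ℤ} {h : ℂ × ℂ × ℂ → ℂ}

theorem mem_Om_zero {τ ω : ℂ} (hτ : 0 < τ.im) (hω : 0 < ω.im) : (τ, 0, ω) ∈ Om t := by
  refine ⟨hτ, ?_⟩
  have := mul_pos hτ hω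
  simpa [imv] using this

theorem im_moebius_pos {a b c d : ℤ} (hdet : a * d - b * c = 1) {z : ℂ} (hz : 0 < z.im) :
    0 < ((a * z + b) / (c * z + d)).im := by
  let γ : Matrix.SpecialLinearGroup (Fin 2) ℤ :=
    ⟨!![a, b; c, d], by rw [Matrix.det_fin_two_of, hdet]⟩
  have e := coe_sl_smul γ ⟨z, hz⟩
  have e2 := (γ • (⟨z, hz⟩ : UpperHalfPlane)).im_pos
  rw [← UpperHalfPlane.coe_im, e] at e2
  simpa [γ] using e2

/-- For index larger than four, non-vanishing on the regular region forces weight zero. -/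
theorem HForm.weight_eq_zero (H : HForm t k h) (ht : 4 < t)
    (hne : ∀ p, imv p ∈ Reg t → h p ≠ 0) : k = 0 := by
  obtain ⟨Λ, w, hΛ, hexp, hw⟩ := H.exists_log (by omega) hne
  obtain ⟨A, hA⟩ := H.periods (by omega) hΛ hne hexp hw
  have ht0 : (4 : ℝ) < t := by exact_mod_cast ht
  have htZ : (4 : ℤ) < t := by exact_mod_cast ht
  have hR : ∀ y : ℝ, 0 < y → y ≤ 1 / 2 → ((1, y, t + 1) : ℝ × ℝ × ℝ) ∈ Reg t := by
    intro y hy hy'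
    have e : (t : ℝ) * y ^ 2 ≤ t * (1 / 4) := by
      apply mul_le_mul_of_nonneg_left _ (by linarith)
      nlinarith
    refine ⟨⟨by norm_num, ?_⟩, ?_, hy, ?_⟩ <;> simp only <;> linarith
  have hmem : ∀ (y : ℝ) (θ : ℝ), imv (I, (y : ℂ) * I, θ + ((t : ℝ) + 1 : ℝ) * I) =
      (1, y, (t : ℝ) + 1) := by
    intro y θ
    simp only [imv, add_im, ofReal_im, mul_I_im, ofReal_re, zero_add, I_im]
  have hp₀ : imv (I, ((1 / 2 : ℝ) : ℂ) * I, ((0 : ℝ) : ℂ) + ((t : ℝ) + 1 : ℝ) * I) ∈ Reg t := by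
    rw [hmem]; exact hR _ (by norm_num) le_rfl
  have hA0 : A = 0 := by
    have h1 := (H.line hΛ hne hexp hw (eichlerData_inf 1) (by nlinarith) hp₀).1
    have h2 := (H.line hΛ hne hexp hw (eichlerData_rat 2 1 (by norm_num)) (by nlinarith) hp₀).1
    rw [hA] at h1 h2
    nlinarith
  have hw0 : ∀ e, w e = 0 := by
    rintro ⟨a, b, c⟩
    rw [hA, hA0, zero_mul]
  have hz : ∀ τ ω : ℂ, 0 < τ.im → τ.im ^ 2 / 4 < τ.im * ω.im → 1 / 4 < τ.im * ω.im →
      h (τ, 0, ω) ≠ 0 := by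
    intro τ ω h1 h2 h3
    have hc : ∀ᶠ ε : ℝ in 𝓝 0, (0 < τ.im - ε ∧
        t * ε ^ 2 + 1 / 4 * (τ.im - ε) ^ 2 < (τ.im - ε) * (ω.im - t * ε)) ∧
        t * ε ^ 2 + 1 / 4 < (τ.im - ε) * (ω.im - t * ε) ∧ ε < τ.im - ε := by
      refine ((ContinuousAt.eventually_lt (by fun_prop) (by fun_prop) ?_).and
        (ContinuousAt.eventually_lt (by fun_prop) (by fun_prop) ?_)).and
        ((ContinuousAt.eventually_lt (by fun_prop) (by fun_prop) ?_).and
        (ContinuousAt.eventually_lt (by fun_prop) (by fun_prop) ?_)) <;> simp <;> linarith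
    obtain ⟨ε, hε, hε0⟩ := ((hc.filter_mono nhdsWithin_le_nhds).and
      (self_mem_nhdsWithin : Ioi (0 : ℝ) ∈ 𝓝[>] (0 : ℝ))).exists
    have hε0' : 0 < ε := hε0
    have hreg : imv (τ - ε * I, ε * I, ω - (t * ε : ℝ) * I) ∈ Reg (t : ℝ) := by
      simp only [imv, sub_im, mul_I_im, ofReal_re]
      exact ⟨hε.1, hε.2.1, hε0', hε.2.2⟩
    have := (H.line hΛ hne hexp hw (eichlerData_rat 1 (-1) (by norm_num)) (by nlinarith) hreg).2
      (hw0 _) (ε * I) (by simpa using hε0')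
    convert this using 2
    simp only [ln]
    refine Prod.ext ?_ (Prod.ext ?_ ?_) <;> push_cast <;> ring
  let g : ℂ → ℂ := fun ω => h (I, 0, ω)
  have hOm : ∀ ω : ℂ, 0 < ω.im → (I, 0, ω) ∈ Om t := fun ω hω =>
    mem_Om_zero (by norm_num) hω
  have hg : DifferentiableOn ℂ g {ζ | 0 < ζ.im} :=
    H.holo.comp (Differentiable.differentiableOn (by fun_prop)) hOm
  have hmod : ∀ a b c d : ℤ, a * d - b * c = 1 → ∀ z : ℂ, 0 < z.im →
      g ((a * z + b) / (c * z + d)) = (c * z + d) ^ k * g z := by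
    intro a b c d hdet z hz
    have e := H.sl2 a b c d hdet (z, 0, I) (mem_Om_zero hz (by norm_num))
    have e2 := H.swap _ (hOm z hz)
    simp only at e2
    rw [e2] at e
    simp only [g]
    rw [← e]
    have e3 := im_moebius_pos hdet hz
    rw [← H.swap _ (hOm _ e3)]
    congr 1
    simp
  have hnv : ∀ z : ℂ, 0 < z.im → g z ≠ 0 := by
    intro z hz'
    obtain ⟨a, b, c, d, hdet, him⟩ := exists_half_le_im hz'
    have := hz I ((a * z + b) / (c * z + d)) (by norm_num) (by rw [I_im]; linarith) (by rw [I_im]; linarith)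
    have e := hmod a b c d hdet z hz'
    intro h0
    rw [h0, mul_zero] at e
    exact this e
  have hwind : Wind (fun θ : ℝ => g (θ + ((t : ℝ) + 1 : ℝ) * I)) 0 := by
    let K : ℝ → ℝ → ℂ := fun s θ =>
      h (I, ((max 0 (min (1 / 2) s) : ℝ) : ℂ) * I, θ + ((t : ℝ) + 1 : ℝ) * I)
    have hcl : ∀ s : ℝ, 0 ≤ max 0 (min (1 / 2) s) ∧ max 0 (min (1 / 2) s) ≤ 1 / 2 := fun s =>
      ⟨le_max_left _ _, max_le (by norm_num) (min_le_left _ _)⟩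
    have hKm : ∀ s θ : ℝ,
        (I, ((max 0 (min (1 / 2) s) : ℝ) : ℂ) * I, θ + ((t : ℝ) + 1 : ℝ) * I) ∈ Om t := by
      intro s θ
      change imv _ ∈ PosCone t
      rw [hmem]
      rcases (hcl s).1.eq_or_lt with h0 | h0
      · rw [← h0]; refine ⟨one_pos, ?_⟩; simp; linarith
      · exact reg_subset (hR _ h0 (hcl s).2)
    have hW1 : Wind (K 1) 0 := by
      have e : max 0 (min (1 / 2) 1) = (1 / 2 : ℝ) := by norm_num
      have hin : ∀ θ : ℝ, imv (I, ((1 / 2 : ℝ) : ℂ) * I, θ + ((t : ℝ) + 1 : ℝ) * I) ∈ Reg t := by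
        intro θ; rw [hmem]; exact hR _ (by norm_num) le_rfl
      refine ⟨fun θ => Λ (I, ((1 / 2 : ℝ) : ℂ) * I, θ + ((t : ℝ) + 1 : ℝ) * I), ?_, ?_, ?_⟩
      · exact hΛ.comp_continuous (by fun_prop) hin
      · intro θ
        simp only [K]
        rw [e, hexp _ (hin θ)]
      · intro θ
        have := hw (0, 0, 1) _ (hin θ)
        rw [hw0] at this
        rw [← sub_eq_iff_eq_add', ← this]
        congr 2
        simp [Refl.tr]
        ring_nf
    have := Wind.homotopy (H := K) (a := 1) (b := 0) ?_ ?_ ?_ hW1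
    · convert this using 2 with θ
      simp [K, g]
    · exact H.holo.continuousOn.comp_continuous (by fun_prop) fun p => hKm p.1 p.2
    · intro s θ
      rcases (hcl s).1.eq_or_lt with h0 | h0
      · simp only [K]
        rw [← h0, ofReal_zero, zero_mul]
        have e : ((θ : ℂ) + ((t : ℝ) + 1 : ℝ) * I).im = t + 1 := by
          rw [add_im, ofReal_im, mul_I_im, ofReal_re, zero_add]
        refine hz _ _ (by norm_num) ?_ ?_ <;> rw [e, I_im] <;> linarith
      · exact hne _ (by rw [hmem]; exact hR _ h0 (hcl s).2)
    · intro s θ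
      have := H.trans 0 0 1 _ (hKm s θ)
      simp only [K]
      rw [← this]
      congr 1
      refine Prod.ext ?_ (Prod.ext ?_ ?_) <;> simp
      ring
  obtain ⟨C, hC⟩ := H.bdd_over_compact (isCompact_singleton (x := ((1, 0, 1) : ℝ × ℝ × ℝ)))
    (by rw [singleton_subset_iff]; exact ⟨one_pos, by norm_num⟩)
  have key := (wind_upperHalfPlane (g := g) (A := 1) (C := C) (c := (t : ℝ) + 1)
    (δ := (t : ℝ) + 2) (j := 0) hg ?_ ?_ (by linarith) (by linarith) (fun ζ h1 _ => hnv ζ h1)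
    hwind).2 rfl
  · obtain ⟨l, hl, hlim⟩ := key.2
    exact weight_eq_zero_of_nonvanishing hg hmod hnv hl hlim
  · intro ζ hζ
    have := H.trans 0 0 1 _ (hOm ζ hζ)
    simpa [g] using this
  · intro ζ hζ h1
    refine H.bdOver_add (eichlerData_inf 1) (by nlinarith) (Y := (1, 0, 1))
      ⟨one_pos, by norm_num⟩ (hC _ rfl) (η := ζ.im - 1) (by linarith) _ ?_
    simp [imv]

end

end Refl

namespace Refl

open Complex Filter Topology Set Real

section
variable {t : ℕ} {h : ℂ × ℂ × ℂ → ℂ}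

theorem HForm.weight_zero_const_left (H : HForm t 0 h) (ht : 0 < t) (a : ℤ) {b : ℕ} (hb : 0 < b) {τ τ' ω : ℂ}
    (hτ : 0 < τ.im) (hτ' : 0 < τ'.im) (hω : 0 < ω.im) :
    h (τ, ((a / b : ℝ) : ℂ), ω) = h (τ', ((a / b : ℝ) : ℂ), ω) := by
  set μ : ℝ := a / b with hμ
  have hbR : (b : ℝ) ≠ 0 := by exact_mod_cast hb.ne'
  have hμb : (μ : ℂ) * b = a := by
    have : μ * b = a := by rw [hμ]; field_simp
    exact_mod_cast this
  have hmem : ∀ (x : ℝ) (z : ℂ), 0 < z.im → (z, (x : ℂ), ω) ∈ Om t := by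
    intro x z hz
    refine ⟨hz, ?_⟩
    simpa [imv] using mul_pos hz hω
  have hmem2 : ∀ (C D : ℤ) (z : ℂ), 0 < z.im →
      (z, (μ : ℂ) * (C * z + D), ω + t * C * μ ^ 2 * (C * z + D)) ∈ Om t ∧
      imv (z, (μ : ℂ) * (C * z + D), ω + t * C * μ ^ 2 * (C * z + D)) =
        (z.im, μ * C * z.im, ω.im + t * (μ * C) ^ 2 * z.im) := by
    intro C D z hz
    have e : imv (z, (μ : ℂ) * (C * z + D), ω + t * C * μ ^ 2 * (C * z + D)) =
        (z.im, μ * C * z.im, ω.im + t * (μ * C) ^ 2 * z.im) := by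
      have e1 : (μ : ℂ) * (C * z + D) = ((μ * C : ℝ) : ℂ) * z + ((μ * D : ℝ) : ℂ) := by
        push_cast; ring
      have e2 : ω + t * C * μ ^ 2 * (C * z + D) =
          ω + ((t * (μ * C) ^ 2 : ℝ) : ℂ) * z + ((t * C * μ ^ 2 * D : ℝ) : ℂ) := by
        push_cast; ring
      simp only [imv, e1, e2, add_im, im_ofReal_mul, ofReal_im, add_zero]
    refine ⟨?_, e⟩
    change imv _ ∈ PosCone t
    rw [e]
    refine ⟨hz, ?_⟩
    simp only
    nlinarith [mul_pos hz hω]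
  have hsl : ∀ A B C D : ℤ, A * D - B * C = 1 → ∀ z : ℂ, 0 < z.im →
      h ((A * z + B) / (C * z + D), (μ : ℂ), ω) =
        h (z, (μ : ℂ) * (C * z + D), ω + t * C * μ ^ 2 * (C * z + D)) := by
    intro A B C D hdet z hz
    have hne : (C : ℂ) * z + D ≠ 0 := by
      intro h0
      have := im_moebius_pos hdet hz
      rw [h0, div_zero] at this
      simp at this
    have := H.sl2 A B C D hdet _ (hmem2 C D z hz).1
    rw [zpow_zero, one_mul] at this
    rw [← this]
    congr 1
    refine Prod.ext rfl (Prod.ext ?_ ?_)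
    · simp only; field_simp
    · simp only; field_simp; ring
  have : NeZero (b ^ 2) := ⟨by positivity⟩
  refine modular_weight_zero_const (f := fun z => h (z, (μ : ℂ), ω))
    (CongruenceSubgroup.Gamma (b ^ 2)) ?_ ?_ ?_ hτ hτ'
  · exact H.holo.comp (Differentiable.differentiableOn (by fun_prop)) fun z hz => hmem μ z hz
  · intro γ hγ z hz
    rw [CongruenceSubgroup.Gamma_mem] at hγ
    obtain ⟨-, -, h3, h4⟩ := hγ
    obtain ⟨c', hc'⟩ := (ZMod.intCast_zmod_eq_zero_iff_dvd _ _).mp h3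
    obtain ⟨d', hd'⟩ := (ZMod.intCast_eq_intCast_iff_dvd_sub 1 (γ 1 1) (b ^ 2)).mp
      (by rw [h4, Int.cast_one])
    rw [hsl _ _ _ _ (sl_det_eq γ) z hz]
    have hC : ((γ 1 0 : ℤ) : ℂ) = b ^ 2 * c' := by rw [hc']; push_cast; ring
    have hD : ((γ 1 1 : ℤ) : ℂ) = 1 + b ^ 2 * d' := by
      rw [eq_add_of_sub_eq' hd']; push_cast; ring
    have e1 := H.heis (a * b * c') (p := (z, (μ : ℂ) + (a * b * d' : ℤ),
      ω - (t * c' * γ 1 1 * a ^ 2 : ℤ))) ?_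
    · have e2 := H.trans 0 (a * b * d') (-(t * c' * γ 1 1 * a ^ 2)) _ (hmem μ z hz)
      have e3 : ((z + (0 : ℤ), (μ : ℂ) + (a * b * d' : ℤ),
          ω + (-(t * c' * γ 1 1 * a ^ 2) : ℤ)) : ℂ × ℂ × ℂ) = (z, (μ : ℂ) + (a * b * d' : ℤ),
          ω - (t * c' * γ 1 1 * a ^ 2 : ℤ)) := by
        simp [sub_eq_add_neg]
      simp only at e2
      rw [e3] at e2
      rw [← e2, ← e1]
      congr 1
      refine Prod.ext rfl (Prod.ext ?_ ?_)
      · simp only [hC, hD]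
        push_cast
        rw [← hμb]; ring
      · simp only
        push_cast
        rw [hD, hC, ← hμb]; ring
    · have e : (μ : ℂ) + (a * b * d' : ℤ) = ((μ + (a * b * d' : ℤ) : ℝ) : ℂ) := by push_cast; rfl
      have e' : ∀ m : ℤ, (ω - (m : ℂ)).im = ω.im := by simp
      refine ⟨hz, ?_⟩
      simp only [imv, e, ofReal_im, e']
      simpa using mul_pos hz hω
  · intro γ
    obtain ⟨K, hK⟩ := H.bdd_over_compact
      (isCompact_singleton (x := ((1, μ * γ 1 0, ω.im + t * (μ * γ 1 0) ^ 2) : ℝ × ℝ × ℝ)))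
      (by
        rw [singleton_subset_iff]
        refine ⟨one_pos, ?_⟩
        simp only
        nlinarith)
    refine ⟨1, K, fun z hz h1 => ?_⟩
    rw [hsl _ _ _ _ (sl_det_eq γ) z hz]
    refine H.bdOver_add (eichlerData_rat b (a * γ 1 0) (by exact_mod_cast hb.ne')) ?_ ?_
      (hK _ rfl) (η := (z.im - 1) / b ^ 2) (by
        have : 0 ≤ z.im - 1 := by linarith
        positivity) _ ?_
    · have : 0 < b ^ 2 := by positivity
      exact_mod_cast Nat.mul_pos ht this
    · refine ⟨one_pos, ?_⟩
      simp only
      nlinarith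
    · rw [(hmem2 _ _ z hz).2]
      refine Prod.ext ?_ (Prod.ext ?_ ?_)
      · simp; field_simp; ring
      · simp; rw [hμ]; field_simp; ring
      · simp; rw [hμ]; field_simp; ring

theorem convex_slice (τ ω : ℂ) : Convex ℝ {x : ℂ | (τ, x, ω) ∈ Om t} := by
  intro x hx y hy a b ha hb hab
  have := convex_preimage_imv (convex_posCone (Nat.cast_nonneg t)) hx hy ha hb hab
  have e : a • (τ, x, ω) + b • (τ, y, ω) = (τ, a • x + b • y, ω) := by
    simp only [Prod.smul_mk, Prod.mk_add_mk, ← add_smul, hab, one_smul]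
  rw [e] at this
  exact this

theorem isOpen_slice (τ ω : ℂ) : IsOpen {x : ℂ | (τ, x, ω) ∈ Om t} :=
  (isOpen_Om (t : ℝ)).preimage (by fun_prop : Continuous fun x : ℂ => (τ, x, ω))

/-- Forms of weight zero are constant. -/
theorem HForm.weight_zero_const (H : HForm t 0 h) (ht : 0 < t) :
    ∃ c, ∀ p ∈ Om t, h p = c := by
  have hmem : ∀ (x : ℝ) (z ω : ℂ), 0 < z.im → 0 < ω.im → (z, (x : ℂ), ω) ∈ Om t := by
    intro x z ω hz hω
    refine ⟨hz, ?_⟩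
    simpa [imv] using mul_pos hz hω
  have hrat : ∀ (a : ℤ) (b : ℕ), 0 < b → ∀ τ τ' ω ω' : ℂ, 0 < τ.im → 0 < τ'.im → 0 < ω.im →
      0 < ω'.im → h (τ, ((a / b : ℝ) : ℂ), ω) = h (τ', ((a / b : ℝ) : ℂ), ω') := by
    intro a b hb τ τ' ω ω' h1 h2 h3 h4
    rw [H.weight_zero_const_left ht a hb h1 h2 h3, ← H.swap _ (hmem _ _ _ h2 h3),
      H.weight_zero_const_left ht a hb h3 h4 h2, ← H.swap _ (hmem _ _ _ h4 h2)]
  have hreal : ∀ (x : ℝ) (τ τ' ω ω' : ℂ), 0 < τ.im → 0 < τ'.im → 0 < ω.im →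
      0 < ω'.im → h (τ, (x : ℂ), ω) = h (τ', (x : ℂ), ω') := by
    intro x τ τ' ω ω' h1 h2 h3 h4
    have hc : ∀ τ ω : ℂ, 0 < τ.im → 0 < ω.im → Continuous fun x : ℝ => h (τ, (x : ℂ), ω) :=
      fun τ ω h1 h3 => H.holo.continuousOn.comp_continuous (by fun_prop)
        fun x => hmem x τ ω h1 h3
    have := Rat.denseRange_cast (𝕜 := ℝ) |>.equalizer (hc τ ω h1 h3) (hc τ' ω' h2 h4) ?_
    · exact congrFun this x
    · funext q
      have := hrat q.num q.den q.pos τ τ' ω ω' h1 h2 h3 h4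
      simp only [Function.comp]
      rw [Rat.cast_def]
      exact this
  have hstrip : ∀ x τ τ' ω ω' : ℂ, (τ, x, ω) ∈ Om t → (τ', x, ω') ∈ Om t →
      h (τ, x, ω) = h (τ', x, ω') := by
    intro x τ τ' ω ω' hx hx'
    have hpos : ∀ τ ω : ℂ, (τ, x, ω) ∈ Om t → 0 < τ.im ∧ 0 < ω.im := by
      rintro τ ω ⟨h1, h2⟩
      refine ⟨h1, ?_⟩
      simp only [imv] at h1 h2
      have : 0 ≤ t * x.im ^ 2 := by positivity
      exact (pos_iff_pos_of_mul_pos (this.trans_lt h2)).mp h1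
    let S := {x : ℂ | (τ, x, ω) ∈ Om t} ∩ {x : ℂ | (τ', x, ω') ∈ Om t}
    have hSo : IsOpen S := (isOpen_slice τ ω).inter (isOpen_slice τ' ω')
    have hSc : IsPreconnected S := ((convex_slice τ ω).inter (convex_slice τ' ω')).isPreconnected
    have han : ∀ τ ω : ℂ, AnalyticOnNhd ℂ (fun x => h (τ, x, ω)) {x | (τ, x, ω) ∈ Om t} :=
      fun τ ω => (H.holo.comp (f := fun x => (τ, x, ω))
        (Differentiable.differentiableOn (by fun_prop)) fun x hx => hx).analyticOnNhd (isOpen_slice τ ω)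
    have h0 : (0 : ℂ) ∈ S := by
      have := hpos τ ω hx
      have := hpos τ' ω' hx'
      exact ⟨mem_Om_zero (by tauto) (by tauto), mem_Om_zero (by tauto) (by tauto)⟩
    refine ((han τ ω).mono inter_subset_left).eqOn_of_preconnected_of_frequently_eq
      ((han τ' ω').mono inter_subset_right) hSc h0 ?_ ⟨hx, hx'⟩
    have hlim : Tendsto (fun x : ℝ => (x : ℂ)) (𝓝[≠] 0) (𝓝[≠] 0) := by
      refine tendsto_nhdsWithin_of_tendsto_nhds_of_eventually_within _ ?_ ?_
      · exact (continuous_ofReal.tendsto' 0 0 ofReal_zero).mono_left nhdsWithin_le_nhds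
      · filter_upwards [self_mem_nhdsWithin] with x hx
        simpa using hx
    refine hlim.frequently (Eventually.frequently (Eventually.of_forall fun x => ?_))
    exact hreal x τ τ' ω ω' (hpos _ _ hx).1 (hpos _ _ hx').1 (hpos _ _ hx).2 (hpos _ _ hx').2
  refine ⟨h (I, 0, I), ?_⟩
  have hup : ∀ τ x ω : ℂ, 0 < x.im → (τ, x, ω) ∈ Om t → h (τ, x, ω) = h (I, 0, I) := by
    intro τ x ω hx hp
    have hI := mem_Om_zero (t := t) hx (show 0 < I.im by norm_num)
    have e := H.heis 1 hI
    rw [hstrip 0 x I I I hI (mem_Om_zero (by norm_num) (by norm_num))] at e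
    rw [← e]
    simp only [Int.cast_one, one_mul, mul_zero, add_zero, zero_add, one_pow, mul_one]
    refine hstrip _ _ _ _ _ hp ⟨hx, ?_⟩
    simp [imv]
    nlinarith
  have hdown : ∀ τ x ω : ℂ, x.im < 0 → (τ, x, ω) ∈ Om t → h (τ, x, ω) = h (I, 0, I) := by
    intro τ x ω hx hp
    have := H.neg hp
    rw [zpow_zero, one_mul] at this
    rw [← this]
    exact hup _ _ _ (by simpa using hx) (neg_mem_Om hp)
  rintro ⟨τ, x, ω⟩ hp
  rcases lt_trichotomy x.im 0 with hx | hx | hx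
  · exact hdown _ _ _ hx hp
  · have hc : ContinuousAt (fun ε : ℝ => h (τ, x + ε * I, ω)) 0 := by
      refine ContinuousAt.comp (g := h) (f := fun ε : ℝ => (τ, x + ε * I, ω)) ?_ (by fun_prop)
      exact H.holo.continuousOn.continuousAt ((isOpen_Om _).mem_nhds (by simpa using hp))
    have h1 := hc.tendsto.mono_left (nhdsWithin_le_nhds (s := Ioi 0))
    simp only [ofReal_zero, zero_mul, add_zero] at h1
    refine tendsto_nhds_unique h1 (tendsto_const_nhds.congr' ?_)
    have hS : ∀ᶠ ε : ℝ in 𝓝 0, (τ, x + ε * I, ω) ∈ Om t :=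
      ((isOpen_Om (t : ℝ)).preimage
        (by fun_prop : Continuous fun ε : ℝ => (τ, x + ε * I, ω))).mem_nhds (by simpa using hp)
    filter_upwards [hS.filter_mono nhdsWithin_le_nhds, self_mem_nhdsWithin] with ε h2 h3
    refine (hup _ _ _ ?_ h2).symm
    simpa [hx] using h3
  · exact hup _ _ _ hx hp

end

end Refl

namespace Refl

open Complex Filter Topology Set Matrix

section
variable {n : ℕ} {R : Type*} [CommRing R]

/-- The bilinear extension of the Gram pairing to a commutative ring. -/
def bf (B : Matrix (Fin n) (Fin n) ℤ) (x y : Fin n → R) : R := ∑ i, ∑ j, (B i j : R) * x i * y j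

variable (B : Matrix (Fin n) (Fin n) ℤ)

theorem bf_eq_dotProduct (x y : Fin n → R) :
    bf B x y = x ⬝ᵥ (B.map (Int.cast : ℤ → R)).mulVec y := by
  simp only [bf, dotProduct, Matrix.mulVec, Matrix.map_apply, Finset.mul_sum]
  refine Finset.sum_congr rfl fun i _ => Finset.sum_congr rfl fun j _ => by ring

theorem bf_int (x y : Fin n → ℤ) : bf B x y = x ⬝ᵥ B.mulVec y := by
  rw [bf_eq_dotProduct]
  rfl

theorem bf_add_left (x y z : Fin n → R) : bf B (x + y) z = bf B x z + bf B y z := by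
  simp only [bf_eq_dotProduct, add_dotProduct]

theorem bf_add_right (x y z : Fin n → R) : bf B z (x + y) = bf B z x + bf B z y := by
  simp only [bf_eq_dotProduct, Matrix.mulVec_add, dotProduct_add]

theorem bf_smul_left (a : R) (x y : Fin n → R) : bf B (a • x) y = a * bf B x y := by
  simp only [bf_eq_dotProduct, smul_dotProduct, smul_eq_mul]

theorem bf_smul_right (a : R) (x y : Fin n → R) : bf B x (a • y) = a * bf B x y := by
  simp only [bf_eq_dotProduct, Matrix.mulVec_smul, dotProduct_smul, smul_eq_mul]

theorem bf_zero_left (x : Fin n → R) : bf B 0 x = 0 := by simp [bf]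

theorem bf_zero_right (x : Fin n → R) : bf B x 0 = 0 := by simp [bf]

theorem bf_neg_matrix (x y : Fin n → R) : bf (-B) x y = -bf B x y := by
  simp [bf, Finset.sum_neg_distrib]

variable {B} in
theorem bf_comm (hB : B.IsSymm) (x y : Fin n → R) : bf B x y = bf B y x := by
  rw [bf, Finset.sum_comm, bf]
  refine Finset.sum_congr rfl fun i _ => Finset.sum_congr rfl fun j _ => ?_
  rw [← hB.apply i j]; ring

theorem bf_map {S : Type*} [CommRing S] (f : R →+* S) (x y : Fin n → R) :
    bf B (fun i => f (x i)) (fun i => f (y i)) = f (bf B x y) := by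
  simp [bf, map_sum]

theorem bf_intC (x y : Fin n → ℤ) : bf B (intC x) (intC y) = ((bf B x y : ℤ) : ℂ) :=
  bf_map B (Int.castRingHom ℂ) x y

theorem cpair_eq_bf (x y : Fin n → ℂ) : cpair B x y = bf B x y := rfl

theorem qnorm_eq_bf (x : Fin n → ℤ) : qnorm B x = bf B x x := (bf_int B x x).symm

variable {m : ℕ} (A : Matrix (Fin m) (Fin m) ℤ)

theorem bf_dsum (x x' : Fin m → R) (y y' : Fin n → R) :
    bf (dsum A B) (Fin.append x y) (Fin.append x' y') = bf A x x' + bf B y y' := by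
  simp only [bf, dsum, Fin.sum_univ_add, Fin.append_left, Fin.append_right, Matrix.reindex_apply,
    Matrix.submatrix_apply, finSumFinEquiv_symm_apply_castAdd, finSumFinEquiv_symm_apply_natAdd,
    Matrix.fromBlocks_apply₁₁, Matrix.fromBlocks_apply₁₂, Matrix.fromBlocks_apply₂₁,
    Matrix.fromBlocks_apply₂₂]
  simp

theorem bf_U (a b c d : R) : bf U ![a, b] ![c, d] = a * d + b * c := by
  simp [bf, U, Fin.sum_univ_two]

end

section
variable {r : ℕ} {R : Type*} [CommRing R]

/-- Coordinates on `2U ⊕ L(-1)`, with the second hyperbolic plane scaled by `ε = ±1`. -/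
def vec (ε : ℤ) (a b c d : R) (z : Fin r → R) : Fin (2 + (2 + r)) → R :=
  Fin.append ![a, b] (Fin.append ![ε * c, ε * d] z)

variable {ε : ℤ}

theorem bf_vec (hε : ε * ε = 1) (L : Matrix (Fin r) (Fin r) ℤ) (a b c d a' b' c' d' : R)
    (z z' : Fin r → R) :
    bf (M2U L) (vec ε a b c d z) (vec ε a' b' c' d' z') =
      a * b' + b * a' + c * d' + d * c' - bf L z z' := by
  have : (ε : R) * ε = 1 := by exact_mod_cast congrArg (Int.cast : ℤ → R) hε
  rw [M2U, vec, vec, bf_dsum, bf_dsum, bf_U, bf_U, bf_neg_matrix]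
  linear_combination (c * d' + d * c') * this

theorem vec_add (a b c d a' b' c' d' : R) (z z' : Fin r → R) :
    vec ε a b c d z + vec ε a' b' c' d' z' = vec ε (a + a') (b + b') (c + c') (d + d') (z + z') := by
  ext i
  refine Fin.addCases (fun i => ?_) (fun i => Fin.addCases (fun i => ?_) (fun i => ?_) i) i
  · fin_cases i <;> simp [vec, Fin.append_left]
  · fin_cases i <;> simp [vec, Fin.append_left, Fin.append_right, mul_add]
  · simp [vec, Fin.append_right]

theorem smul_vec (s a b c d : R) (z : Fin r → R) :
    s • vec ε a b c d z = vec ε (s * a) (s * b) (s * c) (s * d) (s • z) := by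
  ext i
  refine Fin.addCases (fun i => ?_) (fun i => Fin.addCases (fun i => ?_) (fun i => ?_) i) i
  · fin_cases i <;> simp [vec, Fin.append_left]
  · fin_cases i <;> simp [vec, Fin.append_left, Fin.append_right, mul_left_comm]
  · simp [vec, Fin.append_right]

theorem exists_vec (hε : ε * ε = 1) (Z : Fin (2 + (2 + r)) → R) :
    ∃ a b c d z, Z = vec ε a b c d z := by
  have : (ε : R) * ε = 1 := by exact_mod_cast congrArg (Int.cast : ℤ → R) hε
  refine ⟨Z (Fin.castAdd _ 0), Z (Fin.castAdd _ 1), ε * Z (Fin.natAdd 2 (Fin.castAdd _ 0)),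
    ε * Z (Fin.natAdd 2 (Fin.castAdd _ 1)), fun i => Z (Fin.natAdd 2 (Fin.natAdd 2 i)), ?_⟩
  ext i
  refine Fin.addCases (fun i => ?_) (fun i => Fin.addCases (fun i => ?_) (fun i => ?_) i) i
  · fin_cases i <;> simp [vec, Fin.append_left]
  · fin_cases i <;> simp [vec, Fin.append_left, Fin.append_right, ← mul_assoc, this]
  · simp [vec, Fin.append_right]

theorem intC_vec (a b c d : ℤ) (z : Fin r → ℤ) :
    intC (vec ε a b c d z) = vec ε (a : ℂ) b c d (intC z) := by
  ext i
  refine Fin.addCases (fun i => ?_) (fun i => Fin.addCases (fun i => ?_) (fun i => ?_) i) i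
  · fin_cases i <;> simp [vec, intC, Fin.append_left]
  · fin_cases i <;> simp [vec, intC, Fin.append_left, Fin.append_right]
  · simp [vec, intC, Fin.append_right]

theorem conj_vec (a b c d : ℂ) (z : Fin r → ℂ) :
    (fun i => (starRingEnd ℂ) (vec ε a b c d z i)) = vec ε ((starRingEnd ℂ) a) ((starRingEnd ℂ) b)
      ((starRingEnd ℂ) c) ((starRingEnd ℂ) d) (fun i => (starRingEnd ℂ) (z i)) := by
  ext i
  refine Fin.addCases (fun i => ?_) (fun i => Fin.addCases (fun i => ?_) (fun i => ?_) i) i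
  · fin_cases i <;> simp [vec, Fin.append_left]
  · fin_cases i <;> simp [vec, Fin.append_left, Fin.append_right]
  · simp [vec, Fin.append_right]

end

section
variable {n : ℕ} (B : Matrix (Fin n) (Fin n) ℤ)

/-- The rank one endomorphism `x ↦ (p, x) v`. -/
def rk (v p : Fin n → ℤ) : Matrix (Fin n) (Fin n) ℤ :=
  Matrix.of fun i j => v i * ∑ l, B l j * p l

theorem actC_rk (v p : Fin n → ℤ) (Z : Fin n → ℂ) :
    actC (rk B v p) Z = bf B (intC p) Z • intC v := by
  ext i
  simp only [actC, rk, Matrix.mulVec, dotProduct, Matrix.map_apply, Matrix.of_apply, Pi.smul_apply,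
    intC, smul_eq_mul, bf]
  rw [Finset.sum_comm, Finset.sum_mul]
  refine Finset.sum_congr rfl fun j _ => ?_
  push_cast
  rw [Finset.mul_sum, Finset.sum_mul, Finset.sum_mul]
  refine Finset.sum_congr rfl fun l _ => by ring

theorem actC_add (g g' : Matrix (Fin n) (Fin n) ℤ) (Z : Fin n → ℂ) :
    actC (g + g') Z = actC g Z + actC g' Z := by
  simp only [actC]
  rw [Matrix.map_add _ (by simp), Matrix.add_mulVec]

theorem actC_zsmul (m : ℤ) (g : Matrix (Fin n) (Fin n) ℤ) (Z : Fin n → ℂ) :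
    actC (m • g) Z = (m : ℂ) • actC g Z := by
  have : (m • g).map (Int.cast : ℤ → ℂ) = (m : ℂ) • g.map (Int.cast : ℤ → ℂ) := by
    ext i j
    simp only [Matrix.map_apply, Matrix.smul_apply, smul_eq_mul, Int.cast_mul]
  rw [actC, this, Matrix.smul_mulVec, actC]

theorem actC_one (Z : Fin n → ℂ) : actC 1 Z = Z := by
  simp [actC]

theorem actC_mul (g g' : Matrix (Fin n) (Fin n) ℤ) (Z : Fin n → ℂ) :
    actC (g * g') Z = actC g (actC g' Z) := by
  simp only [actC, Matrix.mulVec_mulVec]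
  congr 1
  exact Matrix.map_mul (f := Int.castRingHom ℂ)

theorem actC_smul (g : Matrix (Fin n) (Fin n) ℤ) (s : ℂ) (Z : Fin n → ℂ) :
    actC g (s • Z) = s • actC g Z := by
  simp only [actC, Matrix.mulVec_smul]

theorem actC_conj (g : Matrix (Fin n) (Fin n) ℤ) (Z : Fin n → ℂ) :
    actC g (fun i => (starRingEnd ℂ) (Z i)) = fun i => (starRingEnd ℂ) (actC g Z i) := by
  ext i
  simp [actC, Matrix.mulVec, dotProduct]

theorem actC_intC (g : Matrix (Fin n) (Fin n) ℤ) (v : Fin n → ℤ) :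
    actC g (intC v) = intC (g.mulVec v) := by
  ext i
  simp [actC, intC, Matrix.mulVec, dotProduct]

theorem differentiable_actC (g : Matrix (Fin n) (Fin n) ℤ) : Differentiable ℂ (actC g) :=
  (Matrix.mulVecLin (g.map (Int.cast : ℤ → ℂ))).toContinuousLinearMap.differentiable

theorem bf_actC (g : Matrix (Fin n) (Fin n) ℤ) (Z W : Fin n → ℂ) :
    bf B (actC g Z) (actC g W) = bf (gᵀ * B * g) Z W := by
  have e : (gᵀ * B * g).map (Int.cast : ℤ → ℂ) =
      (g.map (Int.cast : ℤ → ℂ))ᵀ * B.map (Int.cast : ℤ → ℂ) * g.map (Int.cast : ℤ → ℂ) := by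
    have h1 : (gᵀ * B * g).map (Int.cast : ℤ → ℂ) = _ :=
      Matrix.map_mul (f := Int.castRingHom ℂ)
    have h2 : (gᵀ * B).map (Int.cast : ℤ → ℂ) = _ := Matrix.map_mul (f := Int.castRingHom ℂ)
    exact h1.trans (congrArg (· * g.map (Int.cast : ℤ → ℂ)) h2)
  rw [bf_eq_dotProduct, bf_eq_dotProduct, e, actC, actC, ← Matrix.mulVec_mulVec,
    ← Matrix.mulVec_mulVec, Matrix.dotProduct_mulVec _ (_)ᵀ, Matrix.vecMul_transpose]

variable {B}

theorem bf_injective {A B : Matrix (Fin n) (Fin n) ℤ}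
    (h : ∀ Z W : Fin n → ℂ, bf A Z W = bf B Z W) : A = B := by
  ext i j
  have := h (Pi.single i 1) (Pi.single j 1)
  simpa [bf_eq_dotProduct] using this

theorem isometry_of_bf {g : Matrix (Fin n) (Fin n) ℤ}
    (h : ∀ Z W, bf B (actC g Z) (actC g W) = bf B Z W) : gᵀ * B * g = B :=
  bf_injective fun Z W => by rw [← bf_actC, h]

end

end Refl

namespace Refl

open Complex Filter Topology Set Matrix

section
variable {n : ℕ} {B : Matrix (Fin n) (Fin n) ℤ} {D : Set (Fin n → ℂ)}
  {g g' : Matrix (Fin n) (Fin n) ℤ} {Z : Fin n → ℂ}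

theorem isometry_inv (hB : B.det ≠ 0) (hg : gᵀ * B * g = B) :
    ∃ g', g * g' = 1 ∧ g' * g = 1 ∧ g'ᵀ * B * g' = B := by
  have hdet : g.det * g.det = 1 := by
    have := congrArg Matrix.det hg
    rw [det_mul, det_mul, det_transpose] at this
    apply mul_right_cancel₀ hB
    linear_combination this
  have hu : IsUnit g.det := IsUnit.of_mul_eq_one _ hdet
  have h1 := Matrix.mul_nonsing_inv g hu
  have h2 := Matrix.nonsing_inv_mul g hu
  refine ⟨g⁻¹, h1, h2, ?_⟩
  have h3 : (g⁻¹)ᵀ * gᵀ = 1 := by rw [← transpose_mul, h1, transpose_one]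
  calc (g⁻¹)ᵀ * B * g⁻¹ = (g⁻¹)ᵀ * (gᵀ * B * g) * g⁻¹ := by rw [hg]
    _ = ((g⁻¹)ᵀ * gᵀ) * B * (g * g⁻¹) := by simp only [Matrix.mul_assoc]
    _ = B := by rw [h3, h1, Matrix.one_mul, Matrix.mul_one]

theorem bf_actC_of_isometry (hg : gᵀ * B * g = B) (Z W : Fin n → ℂ) :
    bf B (actC g Z) (actC g W) = bf B Z W := by
  rw [bf_actC, hg]

theorem actC_mem_cone (hg : gᵀ * B * g = B) (hZ : Z ∈ Cone B) : actC g Z ∈ Cone B := by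
  obtain ⟨h1, h2⟩ := hZ
  rw [cpair_eq_bf] at h1 h2
  refine ⟨?_, ?_⟩
  · rw [cpair_eq_bf, bf_actC_of_isometry hg, h1]
  · rw [cpair_eq_bf, ← actC_conj, bf_actC_of_isometry hg]; exact h2

theorem smul_mem_cone {s : ℂ} (hs : s ≠ 0) (hZ : Z ∈ Cone B) : s • Z ∈ Cone B := by
  obtain ⟨h1, h2⟩ := hZ
  rw [cpair_eq_bf] at h1 h2
  refine ⟨?_, ?_⟩
  · rw [cpair_eq_bf, bf_smul_left, bf_smul_right, h1]; simp
  · have e : (fun i => (starRingEnd ℂ) ((s • Z) i)) =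
        (starRingEnd ℂ) s • fun i => (starRingEnd ℂ) (Z i) := by
      ext i; simp
    rw [cpair_eq_bf, e, bf_smul_left, bf_smul_right, ← mul_assoc, Complex.mul_conj,
      re_ofReal_mul]
    exact mul_pos (normSq_pos.mpr hs) h2

theorem IsComponent.subset_cone (hD : IsComponent B D) : D ⊆ Cone B := by
  obtain ⟨Z, -, rfl⟩ := hD
  exact connectedComponentIn_subset _ _

theorem IsComponent.isPreconnected (hD : IsComponent B D) : IsPreconnected D := by
  obtain ⟨Z, -, rfl⟩ := hD
  exact isPreconnected_connectedComponentIn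

theorem IsComponent.subset_of_isPreconnected (hD : IsComponent B D) {S : Set (Fin n → ℂ)}
    (hS : IsPreconnected S) (hSC : S ⊆ Cone B) (hZ : Z ∈ D) (hZS : Z ∈ S) : S ⊆ D := by
  obtain ⟨Z₀, h0, rfl⟩ := hD
  rw [connectedComponentIn_eq hZ]
  exact hS.subset_connectedComponentIn hZS hSC

theorem IsComponent.actC_mem (hD : IsComponent B D) (hg : gᵀ * B * g = B) (hZ : Z ∈ D)
    (hgZ : actC g Z ∈ D) {W : Fin n → ℂ} (hW : W ∈ D) : actC g W ∈ D := by
  refine hD.subset_of_isPreconnected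
    (hD.isPreconnected.image _ (differentiable_actC g).continuous.continuousOn) ?_ hgZ
    (mem_image_of_mem _ hZ) (mem_image_of_mem _ hW)
  rintro _ ⟨W, hW, rfl⟩
  exact actC_mem_cone hg (hD.subset_cone hW)

theorem mem_OPlus (hB : B.det ≠ 0) (hD : IsComponent B D) (hg : gᵀ * B * g = B) (hZ : Z ∈ D)
    (hgZ : actC g Z ∈ D) : g ∈ OPlus B D := by
  refine ⟨hg, subset_antisymm ?_ fun W hW => ?_⟩
  · rintro _ ⟨W, hW, rfl⟩
    exact hD.actC_mem hg hZ hgZ hW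
  · obtain ⟨g', h1, h2, hg'⟩ := isometry_inv hB hg
    refine ⟨actC g' W, hD.actC_mem hg' hgZ ?_ hW, ?_⟩
    · rw [← actC_mul, h2, actC_one]; exact hZ
    · rw [← actC_mul, h1, actC_one]

theorem OPlus_actC_mem (hg : g ∈ OPlus B D) (hZ : Z ∈ D) : actC g Z ∈ D := by
  rw [← hg.2]; exact mem_image_of_mem _ hZ

theorem OPlus_mul (hg : g ∈ OPlus B D) (hg' : g' ∈ OPlus B D) : g * g' ∈ OPlus B D := by
  refine ⟨?_, ?_⟩
  · calc (g * g')ᵀ * B * (g * g') = g'ᵀ * (gᵀ * B * g) * g' := by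
          simp only [transpose_mul, Matrix.mul_assoc]
      _ = B := by rw [hg.1, hg'.1]
  · have : actC (g * g') = actC g ∘ actC g' := by ext1 Z; exact actC_mul g g' Z
    rw [this, image_comp, hg'.2, hg.2]

theorem OPlus_one : (1 : Matrix (Fin n) (Fin n) ℤ) ∈ OPlus B D := by
  refine ⟨by simp, ?_⟩
  have : actC (1 : Matrix (Fin n) (Fin n) ℤ) = id := by ext1 Z; exact actC_one Z
  rw [this, image_id]

theorem OPlus_inv (hB : B.det ≠ 0) (hg : g ∈ OPlus B D) :
    ∃ g' ∈ OPlus B D, g * g' = 1 ∧ g' * g = 1 := by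
  obtain ⟨g', h1, h2, hg'⟩ := isometry_inv hB hg.1
  refine ⟨g', ⟨hg', ?_⟩, h1, h2⟩
  have : actC g' ∘ actC g = id := by ext1 Z; rw [Function.comp, ← actC_mul, h2, actC_one]; rfl
  conv_lhs => rw [← hg.2]
  rw [← image_comp, this, image_id]

/-- The Eichler transvection for an isotropic `y` orthogonal to `e` with `(e, e) = 2 m`. -/
def trv (B : Matrix (Fin n) (Fin n) ℤ) (y e : Fin n → ℤ) (m : ℤ) : Matrix (Fin n) (Fin n) ℤ :=
  1 + rk B e y + (-1 : ℤ) • rk B y e + (-m) • rk B y y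

theorem actC_trv (y e : Fin n → ℤ) (m : ℤ) (Z : Fin n → ℂ) :
    actC (trv B y e m) Z = Z + bf B (intC y) Z • intC e +
      (-bf B (intC e) Z - m * bf B (intC y) Z) • intC y := by
  rw [trv, actC_add, actC_add, actC_add, actC_one, actC_zsmul, actC_zsmul, actC_rk, actC_rk,
    actC_rk]
  push_cast
  module

theorem isometry_trv (hB : B.IsSymm) {y e : Fin n → ℤ} {m : ℤ} (hy : bf B y y = 0)
    (hye : bf B y e = 0) (he : bf B e e = 2 * m) : (trv B y e m)ᵀ * B * trv B y e m = B := by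
  refine isometry_of_bf fun Z W => ?_
  have hey : bf B e y = 0 := by rw [bf_comm hB, hye]
  rw [actC_trv, actC_trv]
  simp only [bf_add_left, bf_add_right, bf_smul_left, bf_smul_right, bf_intC, hy, hye, hey, he]
  rw [bf_comm hB Z (intC y), bf_comm hB Z (intC e)]
  push_cast
  ring

/-- The reflection in a vector of norm `-2`. -/
theorem isometry_refl (hB : B.IsSymm) {v : Fin n → ℤ} (hv : bf B v v = -2) :
    (1 + rk B v v)ᵀ * B * (1 + rk B v v) = B := by
  refine isometry_of_bf fun Z W => ?_
  simp only [actC_add, actC_one, actC_rk, bf_add_left, bf_add_right, bf_smul_left, bf_smul_right,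
    bf_intC, hv]
  rw [bf_comm hB Z (intC v)]
  push_cast
  ring

/-- The action of `SL₂` on a sum of two hyperbolic planes. -/
def slm (B : Matrix (Fin n) (Fin n) ℤ) (e₁ e₂ e₃ e₄ : Fin n → ℤ) (a b c d : ℤ) :
    Matrix (Fin n) (Fin n) ℤ :=
  1 + ((a - 1) • rk B e₁ e₂ + (-b) • rk B e₁ e₃) + (c • rk B e₂ e₄ + (d - 1) • rk B e₂ e₁) +
    ((a - 1) • rk B e₃ e₄ + b • rk B e₃ e₁) + ((-c) • rk B e₄ e₂ + (d - 1) • rk B e₄ e₃)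

theorem actC_slm (e₁ e₂ e₃ e₄ : Fin n → ℤ) (a b c d : ℤ) (Z : Fin n → ℂ) :
    actC (slm B e₁ e₂ e₃ e₄ a b c d) Z = Z +
      ((a - 1) * bf B (intC e₂) Z - b * bf B (intC e₃) Z) • intC e₁ +
      (c * bf B (intC e₄) Z + (d - 1) * bf B (intC e₁) Z) • intC e₂ +
      ((a - 1) * bf B (intC e₄) Z + b * bf B (intC e₁) Z) • intC e₃ +
      (-c * bf B (intC e₂) Z + (d - 1) * bf B (intC e₃) Z) • intC e₄ := by
  simp only [slm, actC_add, actC_one, actC_zsmul, actC_rk]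
  push_cast
  module

end

section
variable {r : ℕ} {L : Matrix (Fin r) (Fin r) ℤ}

theorem M2U_isSymm (hL : L.IsSymm) : (M2U L).IsSymm := by
  have hU : U.IsSymm := by ext i j; fin_cases i <;> fin_cases j <;> rfl
  have hd : ∀ {m n : ℕ} {A : Matrix (Fin m) (Fin m) ℤ} {B : Matrix (Fin n) (Fin n) ℤ},
      A.IsSymm → B.IsSymm → (dsum A B).IsSymm := by
    intro m n A B hA hB
    rw [dsum, Matrix.reindex_apply]
    exact (Matrix.IsSymm.fromBlocks hA (by simp) hB).submatrix _
  exact hd hU (hd hU hL.neg)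

theorem M2U_det_ne_zero (hL : L.det ≠ 0) : (M2U L).det ≠ 0 := by
  have hd : ∀ {m n : ℕ} (A : Matrix (Fin m) (Fin m) ℤ) (B : Matrix (Fin n) (Fin n) ℤ),
      (dsum A B).det = A.det * B.det := by
    intro m n A B
    rw [dsum, Matrix.det_reindex_self, Matrix.det_fromBlocks_zero₂₁]
  have hU : U.det = -1 := by simp [U, Matrix.det_fin_two_of]
  rw [M2U, hd, hd, hU, Matrix.det_neg]
  simp [hL]

theorem IsEvenPosDef.det_ne_zero (hL : IsEvenPosDef L) : L.det ≠ 0 := by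
  have := hL.2.2.det_pos
  have e : (L.map (Int.cast : ℤ → ℝ)).det = L.det := by
    exact (RingHom.map_det (Int.castRingHom ℝ) L).symm
  rw [e] at this
  exact_mod_cast this.ne'

variable {ε : ℤ}

theorem actC_slm_vec (hε : ε * ε = 1) (a b c d : ℤ) (z₁ z₂ z₃ z₄ : ℂ) (z : Fin r → ℂ) :
    actC (slm (M2U L) (vec ε 1 0 0 0 0) (vec ε 0 1 0 0 0) (vec ε 0 0 1 0 0) (vec ε 0 0 0 1 0)
      a b c d) (vec ε z₁ z₂ z₃ z₄ z) =
      vec ε (a * z₁ - b * z₄) (d * z₂ + c * z₃) (a * z₃ + b * z₂) (-c * z₁ + d * z₄) z := by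
  have h0 : intC (0 : Fin r → ℤ) = 0 := by ext; simp [intC]
  rw [actC_slm]
  simp only [intC_vec, bf_vec hε, h0, smul_vec, vec_add, bf_zero_left]
  simp only [smul_zero, add_zero]
  congr 1 <;> push_cast <;> ring

theorem isometry_slm (hε : ε * ε = 1) {a b c d : ℤ} (hdet : a * d - b * c = 1) :
    let g := slm (M2U L) (vec ε 1 0 0 0 0) (vec ε 0 1 0 0 0) (vec ε 0 0 1 0 0) (vec ε 0 0 0 1 0)
      a b c d
    gᵀ * M2U L * g = M2U L := by
  refine isometry_of_bf fun Z W => ?_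
  obtain ⟨z₁, z₂, z₃, z₄, z, rfl⟩ := exists_vec hε Z
  obtain ⟨w₁, w₂, w₃, w₄, w, rfl⟩ := exists_vec hε W
  rw [actC_slm_vec hε, actC_slm_vec hε, bf_vec hε, bf_vec hε]
  have : (a : ℂ) * d - b * c = 1 := by exact_mod_cast hdet
  linear_combination (z₁ * w₂ + z₂ * w₁ + z₃ * w₄ + z₄ * w₃) * this

end

end Refl

namespace Refl

open Complex Filter Topology Set Matrix

section
variable {r : ℕ} {L : Matrix (Fin r) (Fin r) ℤ} {ε : ℤ}

theorem bf_self_pos (hL : IsEvenPosDef L) {y : Fin r → ℝ} (hy : y ≠ 0) : 0 < bf L y y := by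
  have := hL.2.2.dotProduct_mulVec_pos hy
  rw [bf_eq_dotProduct]
  simpa using this

theorem bf_self_nonneg (hL : IsEvenPosDef L) (y : Fin r → ℝ) : 0 ≤ bf L y y := by
  rcases eq_or_ne y 0 with rfl | hy
  · rw [bf_zero_left]
  · exact (bf_self_pos hL hy).le

theorem bf_sq_le (hL : IsEvenPosDef L) (x y : Fin r → ℝ) :
    bf L x y ^ 2 ≤ bf L x x * bf L y y := by
  rcases eq_or_ne y 0 with rfl | hy
  · simp [bf_zero_right]
  · have hc := bf_self_pos hL hy
    have := bf_self_nonneg hL (bf L y y • x + (-bf L x y) • y)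
    simp only [bf_add_left, bf_add_right, bf_smul_left, bf_smul_right] at this
    rw [bf_comm hL.1 y x] at this
    have h2 : 0 ≤ bf L y y * (bf L x x * bf L y y - bf L x y ^ 2) := by linarith
    nlinarith [nonneg_of_mul_nonneg_right h2 hc]

/-- The imaginary part of a complex vector. -/
def ivec (z : Fin r → ℂ) : Fin r → ℝ := fun i => (z i).im

/-- The real part of a complex vector. -/
def rvec (z : Fin r → ℂ) : Fin r → ℝ := fun i => (z i).re

theorem bf_complex (hL : L.IsSymm) (z : Fin r → ℂ) :
    bf L z z = (bf L (rvec z) (rvec z) - bf L (ivec z) (ivec z) : ℝ) +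
        (2 * bf L (rvec z) (ivec z) : ℝ) * I ∧
    bf L z (fun i => (starRingEnd ℂ) (z i)) =
      (bf L (rvec z) (rvec z) + bf L (ivec z) (ivec z) : ℝ) := by
  have e1 : z = (fun i => Complex.ofRealHom (rvec z i)) +
      I • fun i => Complex.ofRealHom (ivec z i) := by
    ext i
    simp [rvec, ivec, mul_comm I]
  have e2 : (fun i => (starRingEnd ℂ) (z i)) = (fun i => Complex.ofRealHom (rvec z i)) +
      (-I) • fun i => Complex.ofRealHom (ivec z i) := by
    ext i
    apply Complex.ext <;> simp [rvec, ivec]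
  have hI := Complex.I_mul_I
  generalize rvec z = x at *
  generalize ivec z = y at *
  refine ⟨?_, ?_⟩
  · rw [e1]
    simp only [bf_add_left, bf_add_right, bf_smul_left, bf_smul_right, bf_map]
    rw [bf_comm hL y x]
    push_cast [Complex.ofRealHom_eq_coe]
    linear_combination ((bf L y y : ℝ) : ℂ) * hI
  · rw [e2, e1]
    simp only [bf_add_left, bf_add_right, bf_smul_left, bf_smul_right, bf_map]
    rw [bf_comm hL y x]
    push_cast [Complex.ofRealHom_eq_coe]
    linear_combination -((bf L y y : ℝ) : ℂ) * hI

/-- The tube domain model. -/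
def Tube (L : Matrix (Fin r) (Fin r) ℤ) : Set (ℂ × (Fin r → ℂ) × ℂ) :=
  {p | 0 < p.1.im ∧ bf L (ivec p.2.1) (ivec p.2.1) < 2 * (p.1.im * p.2.2.im)}

/-- The embedding of the tube domain in the affine cone. -/
noncomputable def Zt (L : Matrix (Fin r) (Fin r) ℤ) (ε : ℤ) (p : ℂ × (Fin r → ℂ) × ℂ) : Fin (2 + (2 + r)) → ℂ :=
  vec ε (-(p.1 * p.2.2) + bf L p.2.1 p.2.1 / 2) 1 p.1 p.2.2 p.2.1

theorem Zt_mem_cone_iff (hL : L.IsSymm) (hε : ε * ε = 1) (p : ℂ × (Fin r → ℂ) × ℂ) :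
    Zt L ε p ∈ Cone (M2U L) ↔ bf L (ivec p.2.1) (ivec p.2.1) < 2 * (p.1.im * p.2.2.im) := by
  obtain ⟨τ, z, ω⟩ := p
  obtain ⟨h1, h2⟩ := bf_complex hL z
  have e1 : cpair (M2U L) (Zt L ε (τ, z, ω)) (Zt L ε (τ, z, ω)) = 0 := by
    rw [cpair_eq_bf, Zt, bf_vec hε]
    ring
  have e2 : (cpair (M2U L) (Zt L ε (τ, z, ω)) fun i => (starRingEnd ℂ) (Zt L ε (τ, z, ω) i)).re =
      2 * (2 * (τ.im * ω.im) - bf L (ivec z) (ivec z)) := by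
    rw [cpair_eq_bf, Zt, conj_vec, bf_vec hε, h2, h1]
    simp only [map_add, map_neg, map_mul, map_div₀, Complex.conj_ofNat, Complex.conj_ofReal,
      Complex.conj_I, map_one]
    simp
    ring
  simp only [Cone, mem_ofPred_eq, e1, e2, true_and]
  constructor <;> intro h <;> linarith

theorem convex_tube (hL : IsEvenPosDef L) : Convex ℝ (Tube L) := by
  rintro ⟨τ, z, ω⟩ ⟨h1, h2⟩ ⟨τ', z', ω'⟩ ⟨h1', h2'⟩ α β hα hβ hαβ
  simp only at h1 h2 h1' h2'
  have hv : 0 < α * τ.im + β * τ'.im := by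
    rcases hα.eq_or_lt with rfl | hα'
    · have : β = 1 := by linarith
      subst this; simpa using h1'
    · have := mul_pos hα' h1
      have := mul_nonneg hβ h1'.le
      linarith
  refine ⟨by simpa using hv, ?_⟩
  have e : ivec (α • z + β • z') = α • ivec z + β • ivec z' := by
    ext i; simp [ivec]
  simp only [Prod.smul_mk, Prod.mk_add_mk, e, bf_add_left, bf_add_right, bf_smul_left,
    bf_smul_right, add_im, Complex.smul_im, smul_eq_mul]
  rw [bf_comm hL.1 (ivec z') (ivec z)]
  have hq := bf_self_nonneg hL (τ'.im • ivec z + (-τ.im) • ivec z')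
  simp only [bf_add_left, bf_add_right, bf_smul_left, bf_smul_right] at hq
  rw [bf_comm hL.1 (ivec z') (ivec z)] at hq
  generalize bf L (ivec z) (ivec z) = A at *
  generalize bf L (ivec z') (ivec z') = C at *
  generalize bf L (ivec z) (ivec z') = b at *
  generalize τ.im = v at *
  generalize τ'.im = v' at *
  generalize ω.im = w at *
  generalize ω'.im = w' at *
  have hcross : b < v * w' + v' * w := by
    have e2 : v' ^ 2 * A + v ^ 2 * C < v' ^ 2 * (2 * (v * w)) + v ^ 2 * (2 * (v' * w')) :=
      add_lt_add (mul_lt_mul_of_pos_left h2 (by positivity))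
        (mul_lt_mul_of_pos_left h2' (by positivity))
    have e3 : (v * v') * b < (v * v') * (v * w' + v' * w) := by nlinarith
    exact lt_of_mul_lt_mul_left e3 (by positivity)
  rcases hα.eq_or_lt with rfl | hα'
  · have : β = 1 := by linarith
    subst this
    linarith
  · have e1 := mul_pos (pow_pos hα' 2) (sub_pos.mpr h2)
    have e2 := mul_nonneg (pow_nonneg hβ 2) (sub_pos.mpr h2').le
    have e3 := mul_nonneg (mul_nonneg hα hβ) (sub_pos.mpr hcross).le
    linarith

theorem differentiable_Zt : Differentiable ℂ (Zt L ε) := by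
  unfold Zt vec
  rw [differentiable_pi]
  intro i
  refine Fin.addCases (fun i => ?_) (fun i => Fin.addCases (fun i => ?_) (fun i => ?_) i) i
  · fin_cases i
    · simp only [Fin.append_left, bf]
      simp
      fun_prop
    · simp [Fin.append_left]
  · fin_cases i <;> simp only [Fin.append_left, Fin.append_right] <;> simp <;> fun_prop
  · simp only [Fin.append_right]
    fun_prop

/-- Every point of the cone is a multiple of a tube point, for one of the two orientations. -/
theorem exists_eq_smul_Zt (hL : IsEvenPosDef L) (hε : ε * ε = 1) {Z : Fin (2 + (2 + r)) → ℂ}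
    (hZ : Z ∈ Cone (M2U L)) : ∃ s : ℂ, s ≠ 0 ∧ ∃ p : ℂ × (Fin r → ℂ) × ℂ, Z = s • Zt L ε p ∧
      bf L (ivec p.2.1) (ivec p.2.1) < 2 * (p.1.im * p.2.2.im) := by
  obtain ⟨z₁, z₂, z₃, z₄, z, rfl⟩ := exists_vec hε Z
  have hne : z₂ ≠ 0 := by
    rintro rfl
    obtain ⟨h1, h2⟩ := hZ
    obtain ⟨b1, b2⟩ := bf_complex hL.1 z
    rw [cpair_eq_bf, bf_vec hε] at h1
    rw [cpair_eq_bf, conj_vec, bf_vec hε, b2] at h2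
    have hcs := bf_sq_le hL (rvec z) (ivec z)
    have n1 := bf_self_nonneg hL (rvec z)
    have n2 := bf_self_nonneg hL (ivec z)
    rw [b1] at h1
    generalize bf L (rvec z) (rvec z) = X at *
    generalize bf L (ivec z) (ivec z) = Y at *
    generalize bf L (rvec z) (ivec z) = W at *
    have hn : normSq (2 * (z₃ * z₄)) = (X - Y) ^ 2 + (2 * W) ^ 2 := by
      have : 2 * (z₃ * z₄) = (X - Y : ℝ) + (2 * W : ℝ) * I := by linear_combination h1
      rw [this, normSq_add_mul_I]
    have h3 : X + Y < 2 * (z₃ * (starRingEnd ℂ) z₄).re := by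
      simp at h2 ⊢
      linarith
    have h4 : (2 * (z₃ * (starRingEnd ℂ) z₄).re) ^ 2 ≤ normSq (2 * (z₃ * z₄)) := by
      have := re_sq_le_normSq (2 * (z₃ * (starRingEnd ℂ) z₄))
      simp only [map_mul, normSq_conj] at this ⊢
      simp at this ⊢
      nlinarith
    nlinarith
  refine ⟨z₂, hne, (z₃ / z₂, z₂⁻¹ • z, z₄ / z₂), ?_⟩
  have e : vec ε z₁ z₂ z₃ z₄ z = z₂ • Zt L ε (z₃ / z₂, z₂⁻¹ • z, z₄ / z₂) := by
    have h1 := hZ.1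
    rw [cpair_eq_bf, bf_vec hε] at h1
    rw [Zt, smul_vec, smul_smul, mul_inv_cancel₀ hne, one_smul]
    simp only [bf_smul_left, bf_smul_right]
    congr 1 <;> field_simp
    linear_combination h1
  refine ⟨e, ?_⟩
  rw [← Zt_mem_cone_iff hL.1 hε]
  have : Zt L ε (z₃ / z₂, z₂⁻¹ • z, z₄ / z₂) = z₂⁻¹ • vec ε z₁ z₂ z₃ z₄ z := by
    rw [e, smul_smul, inv_mul_cancel₀ hne, one_smul]
  rw [this]
  exact smul_mem_cone (inv_ne_zero hne) hZ

end

end Refl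

namespace Refl

open Complex Filter Topology Set Matrix

section
variable {r : ℕ} {L : Matrix (Fin r) (Fin r) ℤ} {ε : ℤ} {D : Set (Fin (2 + (2 + r)) → ℂ)}

/-- The orientation of a cone vector. -/
noncomputable def orient (L : Matrix (Fin r) (Fin r) ℤ) (ε : ℤ) (Z : Fin (2 + (2 + r)) → ℂ) : ℝ :=
  (bf (M2U L) (vec ε 0 0 0 1 0) Z * (starRingEnd ℂ) (bf (M2U L) (vec ε 1 0 0 0 0) Z)).im

theorem orient_smul_Zt (hε : ε * ε = 1) (s : ℂ) (p : ℂ × (Fin r → ℂ) × ℂ) :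
    orient L ε (s • Zt L ε p) = normSq s * p.1.im := by
  rw [orient, bf_smul_right, bf_smul_right, Zt, bf_vec hε, bf_vec hε, bf_zero_left]
  simp [normSq_apply]
  ring

theorem differentiable_bf_right {n : ℕ} (B : Matrix (Fin n) (Fin n) ℤ) (w : Fin n → ℂ) :
    Differentiable ℂ (bf B w) := by
  unfold bf
  fun_prop

theorem continuous_orient : Continuous (orient L ε) := by
  unfold orient
  exact continuous_im.comp ((differentiable_bf_right _ _).continuous.mul
    (continuous_conj.comp (differentiable_bf_right _ _).continuous))

theorem Zt_neg_sign (τ ω : ℂ) (z : Fin r → ℂ) : Zt L (-ε) (-τ, z, -ω) = Zt L ε (τ, z, ω) := by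
  simp [Zt, vec]

theorem isPreconnected_smul_Zt (hL : IsEvenPosDef L) :
    IsPreconnected ((fun q : ℂ × (ℂ × (Fin r → ℂ) × ℂ) => q.1 • Zt L ε q.2) ''
      ({0}ᶜ ×ˢ Tube L)) := by
  refine IsPreconnected.image ?_ _ ?_
  · refine IsPreconnected.prod ?_ (convex_tube hL).isPreconnected
    exact (isConnected_compl_singleton_of_one_lt_rank (by simp [Complex.rank_real_complex]) _).isPreconnected
  · exact (continuous_fst.smul (differentiable_Zt.continuous.comp continuous_snd)).continuousOn

/-- The tube domain parametrizes a component of the cone. -/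
theorem IsComponent.exists_tube (hL : IsEvenPosDef L) (hD : IsComponent (M2U L) D) :
    ∃ ε : ℤ, ε * ε = 1 ∧ (∀ s : ℂ, s ≠ 0 → ∀ p ∈ Tube L, s • Zt L ε p ∈ D) ∧
      ∀ Z ∈ D, ∃ s : ℂ, s ≠ 0 ∧ ∃ p ∈ Tube L, Z = s • Zt L ε p := by
  have hne : D.Nonempty := by
    obtain ⟨Z, hZ, rfl⟩ := hD
    exact ⟨Z, mem_connectedComponentIn hZ⟩
  obtain ⟨Z₀, hZ₀⟩ := hne
  have key : ∃ ε : ℤ, ε * ε = 1 ∧ ∃ s : ℂ, s ≠ 0 ∧ ∃ p ∈ Tube L, Z₀ = s • Zt L ε p := by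
    obtain ⟨s, hs, ⟨τ, z, ω⟩, h1, h2⟩ :=
      exists_eq_smul_Zt hL (by norm_num : (1 : ℤ) * 1 = 1) (hD.subset_cone hZ₀)
    simp only at h2
    have h3 := bf_self_nonneg hL (ivec z)
    have h4 : 0 < τ.im * ω.im := by linarith
    rcases lt_trichotomy τ.im 0 with h | h | h
    · refine ⟨-1, by norm_num, s, hs, (-τ, z, -ω), ⟨by simpa using h, ?_⟩, ?_⟩
      · simpa using h2
      · rw [h1, Zt_neg_sign]
    · simp [h] at h4
    · exact ⟨1, by norm_num, s, hs, _, ⟨h, h2⟩, h1⟩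
  obtain ⟨ε, hε, s₀, hs₀, p₀, hp₀, e₀⟩ := key
  refine ⟨ε, hε, ?_, ?_⟩
  · intro s hs p hp
    refine hD.subset_of_isPreconnected (isPreconnected_smul_Zt (ε := ε) hL) ?_ hZ₀ ?_
      ⟨(s, p), ⟨hs, hp⟩, rfl⟩
    · rintro _ ⟨⟨s, p⟩, ⟨hs, hp⟩, rfl⟩
      exact smul_mem_cone hs ((Zt_mem_cone_iff hL.1 hε p).2 hp.2)
    · exact ⟨(s₀, p₀), ⟨hs₀, hp₀⟩, e₀.symm⟩
  · have hne0 : ∀ Z ∈ D, orient L ε Z ≠ 0 := by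
      intro Z hZ
      obtain ⟨s, hs, p, h1, h2⟩ := exists_eq_smul_Zt hL hε (hD.subset_cone hZ)
      rw [h1, orient_smul_Zt hε]
      have h3 := bf_self_nonneg hL (ivec p.2.1)
      refine mul_ne_zero (normSq_eq_zero.not.2 hs) fun h => ?_
      rw [h] at h2
      linarith
    have hpos0 : 0 < orient L ε Z₀ := by
      rw [e₀, orient_smul_Zt hε]
      exact mul_pos (normSq_pos.2 hs₀) hp₀.1
    have hpos : ∀ Z ∈ D, 0 < orient L ε Z := by
      intro Z hZ
      by_contra hlt
      obtain ⟨Z', hZ', h0⟩ := hD.isPreconnected.intermediate_value hZ hZ₀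
        continuous_orient.continuousOn ⟨not_lt.1 hlt, hpos0.le⟩
      exact hne0 Z' hZ' h0
    intro Z hZ
    obtain ⟨s, hs, p, h1, h2⟩ := exists_eq_smul_Zt hL hε (hD.subset_cone hZ)
    refine ⟨s, hs, p, ⟨?_, h2⟩, h1⟩
    have := hpos Z hZ
    rw [h1, orient_smul_Zt hε] at this
    exact pos_of_mul_pos_right this (normSq_nonneg s)

end

end Refl

namespace Refl

open Complex Filter Topology Set Matrix

/-- A modular form with trivial character for the full group `O⁺`. -/
structure PForm {n : ℕ} (B : Matrix (Fin n) (Fin n) ℤ) (D : Set (Fin n → ℂ)) (k : ℤ)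
    (F : (Fin n → ℂ) → ℂ) : Prop where
  holo : DifferentiableOn ℂ F D
  homogeneous : ∀ t : ℂ, t ≠ 0 → ∀ Z ∈ D, F (t • Z) = t ^ (-k) * F Z
  invariant : ∀ g ∈ OPlus B D, ∀ Z ∈ D, F (actC g Z) = F Z

section
variable {r : ℕ} {L : Matrix (Fin r) (Fin r) ℤ} {ε : ℤ} {D : Set (Fin (2 + (2 + r)) → ℂ)}
  {k : ℤ} {F : (Fin (2 + (2 + r)) → ℂ) → ℂ}

theorem PForm.tube_eq (hF : PForm (M2U L) D k F) (hL : IsEvenPosDef L) (hD : IsComponent (M2U L) D)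
    (hε : ε * ε = 1) (hmem : ∀ s : ℂ, s ≠ 0 → ∀ p ∈ Tube L, s • Zt L ε p ∈ D)
    {g : Matrix (Fin (2 + (2 + r))) (Fin (2 + (2 + r))) ℤ} (hg : gᵀ * M2U L * g = M2U L)
    {p p' : ℂ × (Fin r → ℂ) × ℂ} (hp : p ∈ Tube L) (hp' : 0 < p'.1.im) {s : ℂ} (hs : s ≠ 0)
    (he : actC g (Zt L ε p) = s • Zt L ε p') :
    F (Zt L ε p') = s ^ k * F (Zt L ε p) := by
  have hZ : Zt L ε p ∈ D := by simpa using hmem 1 one_ne_zero p hp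
  have h1 : Zt L ε p' ∈ Cone (M2U L) := by
    have := smul_mem_cone (inv_ne_zero hs) (he ▸ actC_mem_cone hg (hD.subset_cone hZ))
    rwa [smul_smul, inv_mul_cancel₀ hs, one_smul] at this
  have hpT : p' ∈ Tube L := ⟨hp', (Zt_mem_cone_iff hL.1 hε p').1 h1⟩
  have h2 : actC g (Zt L ε p) ∈ D := he ▸ hmem s hs p' hpT
  have h3 := hF.invariant g (mem_OPlus (M2U_det_ne_zero hL.det_ne_zero) hD hg hZ h2) _ hZ
  have hZ' : Zt L ε p' ∈ D := by simpa using hmem 1 one_ne_zero p' hpT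
  rw [he, hF.homogeneous s hs _ hZ', _root_.zpow_neg] at h3
  rw [← h3, ← mul_assoc, mul_inv_cancel₀ (zpow_ne_zero k hs), one_mul]

/-- The point of the tube domain over the line spanned by `u`. -/
def line (u : Fin r → ℤ) (p : ℂ × ℂ × ℂ) : ℂ × (Fin r → ℂ) × ℂ := (p.1, p.2.1 • intC u, p.2.2)

theorem bf_intR (B : Matrix (Fin r) (Fin r) ℤ) (x y : Fin r → ℤ) :
    bf B (intR x) (intR y) = ((bf B x y : ℤ) : ℝ) := bf_map B (Int.castRingHom ℝ) x y

variable {t : ℕ} {u : Fin r → ℤ}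

theorem line_mem_tube (hu : bf L u u = 2 * t) {p : ℂ × ℂ × ℂ} (hp : p ∈ Om t) :
    line u p ∈ Tube L := by
  obtain ⟨h1, h2⟩ := hp
  refine ⟨h1, ?_⟩
  have e : ivec (p.2.1 • intC u) = p.2.1.im • intR u := by
    ext i
    simp [ivec, intC, intR]
  simp only [imv] at h2
  simp only [line, e, bf_smul_left, bf_smul_right, bf_intR, hu]
  push_cast
  linarith

theorem Zt_line (hu : bf L u u = 2 * t) (p : ℂ × ℂ × ℂ) :
    Zt L ε (line u p) =
      vec ε (-(p.1 * p.2.2) + t * p.2.1 ^ 2) 1 p.1 p.2.2 (p.2.1 • intC u) := by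
  simp only [Zt, line, bf_smul_left, bf_smul_right, bf_intC, hu]
  congr 1
  push_cast
  ring

theorem intC_smul (m : ℤ) (u : Fin r → ℤ) : intC (m • u) = (m : ℂ) • intC u := by
  ext i
  simp [intC]

theorem bf_int_smul_self (hu : bf L u u = 2 * t) (a b : ℤ) :
    bf L (a • u) (b • u) = 2 * t * a * b := by
  rw [bf_smul_left, bf_smul_right, hu]
  ring

theorem PForm.line_eq (hF : PForm (M2U L) D k F) (hL : IsEvenPosDef L) (hD : IsComponent (M2U L) D)
    (hε : ε * ε = 1) (hmem : ∀ s : ℂ, s ≠ 0 → ∀ p ∈ Tube L, s • Zt L ε p ∈ D)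
    (hu : bf L u u = 2 * t)
    {g : Matrix (Fin (2 + (2 + r))) (Fin (2 + (2 + r))) ℤ} (hg : gᵀ * M2U L * g = M2U L)
    {p p' : ℂ × ℂ × ℂ} (hp : p ∈ Om t) (hp' : 0 < p'.1.im) {s : ℂ} (hs : s ≠ 0)
    (he : actC g (Zt L ε (line u p)) = s • Zt L ε (line u p')) :
    F (Zt L ε (line u p')) = s ^ k * F (Zt L ε (line u p)) :=
  hF.tube_eq hL hD hε hmem hg (line_mem_tube hu hp) hp' hs he

theorem PForm.hForm (hF : PForm (M2U L) D k F) (hL : IsEvenPosDef L) (hD : IsComponent (M2U L) D)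
    (hε : ε * ε = 1) (hmem : ∀ s : ℂ, s ≠ 0 → ∀ p ∈ Tube L, s • Zt L ε p ∈ D)
    (hu : bf L u u = 2 * t) : HForm t k (fun p => F (Zt L ε (line u p))) := by
  have hsym := M2U_isSymm hL.1
  refine ⟨?_, ?_, ?_, ?_, ?_⟩
  · refine hF.holo.comp (Differentiable.differentiableOn ?_) fun p hp => ?_
    · refine differentiable_Zt.comp ?_
      unfold line
      fun_prop
    · simpa using hmem 1 one_ne_zero _ (line_mem_tube hu hp)
  · intro a b c p hp
    have := hF.line_eq hL hD hε hmem hu (p := p) (p' := (p.1 + a, p.2.1 + b, p.2.2 + c))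
      (g := trv (M2U L) (vec ε 1 0 0 0 0) (vec ε 0 0 a c (b • u)) (a * c - t * b ^ 2)) ?_ hp
      (by simpa using show 0 < p.1.im from hp.1) one_ne_zero ?_
    · simpa using this
    · refine isometry_trv hsym ?_ ?_ ?_
      · rw [bf_vec hε, bf_zero_left]; ring
      · rw [bf_vec hε, bf_zero_left]; ring
      · rw [bf_vec hε, bf_int_smul_self hu]; ring
    · rw [actC_trv, Zt_line hu, Zt_line hu, intC_vec, intC_vec]
      have h0 : intC (0 : Fin r → ℤ) = 0 := by ext; simp [intC]
      simp only [bf_vec hε, h0, smul_vec, vec_add, bf_zero_left, intC_smul, bf_smul_left,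
        bf_smul_right, bf_intC, hu]
      congr 1
      · push_cast; ring
      · push_cast; ring
      · push_cast; ring
      · push_cast; ring
      · push_cast; module
  · intro p hp
    have := hF.line_eq hL hD hε hmem hu (p := p) (p' := (p.2.2, p.2.1, p.1))
      (g := 1 + rk (M2U L) (vec ε 0 0 1 (-1) 0) (vec ε 0 0 1 (-1) 0)) ?_ hp ?_ one_ne_zero ?_
    · simpa using this
    · refine isometry_refl hsym ?_
      rw [bf_vec hε, bf_zero_left]; ring
    · obtain ⟨h1, h2⟩ := hp
      have ht : (0 : ℝ) ≤ t := Nat.cast_nonneg t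
      have : 0 < (imv p).1 * (imv p).2.2 := lt_of_le_of_lt (by positivity) h2
      exact (pos_iff_pos_of_mul_pos this).1 h1
    · rw [actC_add, actC_one, actC_rk, Zt_line hu, Zt_line hu, intC_vec]
      have h0 : intC (0 : Fin r → ℤ) = 0 := by ext; simp [intC]
      simp only [bf_vec hε, h0, smul_vec, vec_add, bf_zero_left]
      congr 1
      · push_cast; ring
      · push_cast; ring
      · push_cast; ring
      · push_cast; ring
      · push_cast; module
  · intro a b c d hdet p hp
    have hdet' : (a : ℂ) * d - b * c = 1 := by exact_mod_cast hdet
    have him := im_moebius_pos hdet hp.1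
    have hne : (c : ℂ) * p.1 + d ≠ 0 := by
      intro h
      simp only [h, div_zero, zero_im, lt_self_iff_false] at him
    refine hF.line_eq hL hD hε hmem hu (p := p)
      (g := slm (M2U L) (vec ε 1 0 0 0 0) (vec ε 0 1 0 0 0) (vec ε 0 0 1 0 0) (vec ε 0 0 0 1 0)
      a b c d) (isometry_slm hε hdet) hp him hne ?_
    rw [Zt_line hu, Zt_line hu, actC_slm_vec hε, smul_vec]
    simp only
    generalize hsd : (c : ℂ) * p.1 + d = s at *
    congr 1
    · field_simp
      linear_combination (t * p.2.1 ^ 2) * hdet' - (t * p.2.1 ^ 2 * a) * hsd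
    · linear_combination hsd
    · field_simp
    · field_simp
      linear_combination p.2.2 * hsd
    · rw [smul_smul, mul_div_cancel₀ _ hne]
  · intro y e n hd p hp
    have := hF.line_eq hL hD hε hmem hu (p := p) (p' := eK t y e n p)
      (g := trv (M2U L) (vec ε 0 0 y.1 y.2.2 (y.2.1 • u)) (vec ε 0 0 e.1 e.2.2 (e.2.1 • u)) (-n))
      ?_ hp ?_ one_ne_zero ?_
    · simpa using this
    · refine isometry_trv hsym ?_ ?_ ?_
      · rw [bf_vec hε, bf_int_smul_self hu]; linear_combination 2 * hd.iso
      · rw [bf_vec hε, bf_int_smul_self hu]; linear_combination hd.orth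
      · rw [bf_vec hε, bf_int_smul_self hu]; linear_combination 2 * hd.norm
    · have := (eK_mem_posCone hd hp).1
      rw [← imv_eK] at this
      exact this
    · have h5 := norm_eK hd p
      rw [actC_trv, Zt_line hu, Zt_line hu, intC_vec, intC_vec]
      simp only [bf_vec hε, smul_vec, vec_add, intC_smul, bf_smul_left, bf_smul_right, bf_intC, hu]
      congr 1
      · push_cast; linear_combination h5
      · push_cast; ring
      · simp only [eK, sg]; push_cast; ring
      · simp only [eK, sg]; push_cast; ring
      · simp only [eK, sg]; push_cast; module

end

end Refl

namespace Refl

open Complex Filter Topology Set Matrix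

section
variable {n : ℕ} {B : Matrix (Fin n) (Fin n) ℤ} {D : Set (Fin n → ℂ)}
  {Γ : Set (Matrix (Fin n) (Fin n) ℤ)} {χ : Matrix (Fin n) (Fin n) ℤ → ℂ} {k : ℤ}
  {F : (Fin n → ℂ) → ℂ}

theorem differentiableOn_prod {E ι : Type*} [NormedAddCommGroup E] [NormedSpace ℂ E] {s : Set E}
    (u : Finset ι) {f : ι → E → ℂ} (hf : ∀ i ∈ u, DifferentiableOn ℂ (f i) s) :
    DifferentiableOn ℂ (fun x => ∏ i ∈ u, f i x) s := by
  induction u using Finset.cons_induction with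
  | empty => simp
  | cons a u ha ih =>
    simp only [Finset.prod_cons]
    exact (hf a (Finset.mem_cons_self a u)).fun_mul
      (ih fun i hi => hf i (Finset.mem_cons_of_mem hi))

/-- The conjugates of a function under `O⁺`, extended by zero. -/
def conjugates (B : Matrix (Fin n) (Fin n) ℤ) (D : Set (Fin n → ℂ)) (F : (Fin n → ℂ) → ℂ) :
    Set ((Fin n → ℂ) → ℂ) :=
  (fun g => D.indicator fun Z => F (actC g Z)) '' OPlus B D

theorem conjugates_finite (hB : B.det ≠ 0) (hΓ : IsFiniteIndexSubgroup B D Γ)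
    (hχ : IsCharacter Γ χ) (hF : IsModularForm B D Γ χ k F) : (conjugates B D F).Finite := by
  obtain ⟨S, hS⟩ := hΓ.finite_index
  refine ((hχ.finite_image.prod S.finite_toSet).image
    fun q => D.indicator fun Z => q.1 * F (actC q.2⁻¹ Z)).subset ?_
  rintro _ ⟨g, hg, rfl⟩
  obtain ⟨g', hg', e1, e2⟩ := OPlus_inv hB hg
  obtain ⟨s, hs, γ, hγ, rfl⟩ := hS g' hg'
  obtain ⟨γ', hγ', e3, e4⟩ := hΓ.inv_mem γ hγ
  have hinv : s⁻¹ = γ * g := Matrix.inv_eq_right_inv (by rw [← mul_assoc, e2])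
  refine ⟨(χ γ', s), ⟨mem_image_of_mem _ hγ', hs⟩, ?_⟩
  ext Z
  by_cases hZ : Z ∈ D
  · simp only [indicator_of_mem hZ]
    rw [hinv, ← hF.equivariant γ' hγ' _ (OPlus_actC_mem (OPlus_mul (hΓ.subset hγ) hg) hZ),
      ← actC_mul, ← mul_assoc, e4, one_mul]
  · simp only [indicator_of_notMem hZ]

theorem prod_conjugates_invariant (hB : B.det ≠ 0) (hfin : (conjugates B D F).Finite) (Q : ℂ → ℂ)
    {g : Matrix (Fin n) (Fin n) ℤ} (hg : g ∈ OPlus B D) {Z : Fin n → ℂ} (hZ : Z ∈ D) :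
    ∏ φ ∈ hfin.toFinset, Q (φ (actC g Z)) = ∏ φ ∈ hfin.toFinset, Q (φ Z) := by
  have key : ∀ g₁ ∈ OPlus B D, ∀ g₂ ∈ OPlus B D,
      (D.indicator fun Z => (D.indicator fun Z => F (actC g₁ Z)) (actC g₂ Z)) =
        D.indicator fun Z => F (actC (g₁ * g₂) Z) := by
    intro g₁ h1 g₂ h2
    ext W
    by_cases hW : W ∈ D
    · simp only [indicator_of_mem hW, indicator_of_mem (OPlus_actC_mem h2 hW), actC_mul]
    · simp only [indicator_of_notMem hW]
  have hmem : ∀ g₂ ∈ OPlus B D, ∀ φ ∈ hfin.toFinset,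
      (D.indicator fun Z => φ (actC g₂ Z)) ∈ hfin.toFinset := by
    intro g₂ h2 φ hφ
    rw [Finite.mem_toFinset] at hφ ⊢
    obtain ⟨g₁, h1, rfl⟩ := hφ
    exact ⟨g₁ * g₂, OPlus_mul h1 h2, (key g₁ h1 g₂ h2).symm⟩
  have hinv : ∀ g₁ ∈ OPlus B D, ∀ g₂ ∈ OPlus B D, g₁ * g₂ = 1 → ∀ φ ∈ hfin.toFinset,
      (D.indicator fun Z => (D.indicator fun Z => φ (actC g₁ Z)) (actC g₂ Z)) = φ := by
    intro g₁ h1 g₂ h2 h12 φ hφ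
    rw [Finite.mem_toFinset] at hφ
    obtain ⟨g₀, h0, rfl⟩ := hφ
    simp only []
    rw [key g₀ h0 g₁ h1, key _ (OPlus_mul h0 h1) g₂ h2, mul_assoc, h12, mul_one]
  obtain ⟨g', hg', e1, e2⟩ := OPlus_inv hB hg
  refine Finset.prod_nbij' (fun φ => D.indicator fun Z => φ (actC g Z))
    (fun φ => D.indicator fun Z => φ (actC g' Z)) (hmem g hg) (hmem g' hg')
    (hinv g hg g' hg' e1) (hinv g' hg' g hg e2) fun φ hφ => ?_
  rw [indicator_of_mem hZ]

theorem conjugates_smul (hF : IsModularForm B D Γ χ k F) {φ : (Fin n → ℂ) → ℂ}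
    (hφ : φ ∈ conjugates B D F) (hsm : ∀ t : ℂ, t ≠ 0 → ∀ Z ∈ D, t • Z ∈ D)
    {t : ℂ} (ht : t ≠ 0) {Z : Fin n → ℂ} (hZ : Z ∈ D) : φ (t • Z) = t ^ (-k) * φ Z := by
  obtain ⟨g, hg, rfl⟩ := hφ
  simp only [indicator_of_mem hZ, indicator_of_mem (hsm t ht Z hZ), actC_smul]
  exact hF.homogeneous t ht _ (OPlus_actC_mem hg hZ)

theorem conjugates_differentiableOn (hF : DifferentiableOn ℂ F D) {φ : (Fin n → ℂ) → ℂ}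
    (hφ : φ ∈ conjugates B D F) : DifferentiableOn ℂ φ D := by
  obtain ⟨g, hg, rfl⟩ := hφ
  refine (hF.comp (differentiable_actC g).differentiableOn fun Z hZ =>
    OPlus_actC_mem hg hZ).congr fun Z hZ => ?_
  simp only [indicator_of_mem hZ, Function.comp_apply]

theorem self_mem_conjugates : D.indicator F ∈ conjugates B D F :=
  ⟨1, OPlus_one, by simp only [actC_one]⟩

theorem pForm_norm (hB : B.det ≠ 0) (hF : IsModularForm B D Γ χ k F)
    (hsm : ∀ t : ℂ, t ≠ 0 → ∀ Z ∈ D, t • Z ∈ D) (hfin : (conjugates B D F).Finite) :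
    PForm B D (k * hfin.toFinset.card) fun Z => ∏ φ ∈ hfin.toFinset, φ Z := by
  refine ⟨?_, ?_, ?_⟩
  · exact differentiableOn_prod _ fun φ hφ =>
      conjugates_differentiableOn hF.holo (hfin.mem_toFinset.1 hφ)
  · intro t ht Z hZ
    rw [Finset.prod_congr rfl fun φ hφ =>
      conjugates_smul hF (hfin.mem_toFinset.1 hφ) hsm ht hZ, Finset.prod_mul_distrib,
      Finset.prod_const, ← zpow_natCast, ← _root_.zpow_mul, neg_mul]
  · intro g hg Z hZ
    exact prod_conjugates_invariant hB hfin (fun x => x) hg hZ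

theorem pForm_charpoly (hB : B.det ≠ 0) (hF : IsModularForm B D Γ χ 0 F)
    (hsm : ∀ t : ℂ, t ≠ 0 → ∀ Z ∈ D, t • Z ∈ D) (hfin : (conjugates B D F).Finite) (c : ℂ) :
    PForm B D 0 fun Z => ∏ φ ∈ hfin.toFinset, (φ Z - c) := by
  refine ⟨?_, ?_, ?_⟩
  · exact differentiableOn_prod _ fun φ hφ =>
      (conjugates_differentiableOn hF.holo (hfin.mem_toFinset.1 hφ)).sub_const c
  · intro t ht Z hZ
    rw [neg_zero, zpow_zero, one_mul]
    refine Finset.prod_congr rfl fun φ hφ => ?_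
    rw [conjugates_smul hF (hfin.mem_toFinset.1 hφ) hsm ht hZ, neg_zero, zpow_zero, one_mul]
  · intro g hg Z hZ
    exact prod_conjugates_invariant hB hfin (fun x => x - c) hg hZ

/-- A form of weight zero is constant as soon as the forms with trivial character are. -/
theorem constant_of_weight_zero (hB : B.det ≠ 0) (hD : IsPreconnected D)
    (hF : IsModularForm B D Γ χ 0 F) (hsm : ∀ t : ℂ, t ≠ 0 → ∀ Z ∈ D, t • Z ∈ D)
    (hfin : (conjugates B D F).Finite)
    (hconst : ∀ E : (Fin n → ℂ) → ℂ, PForm B D 0 E → ∃ c, ∀ Z ∈ D, E Z = c) :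
    ∃ c, ∀ Z ∈ D, F Z = c := by
  rcases D.eq_empty_or_nonempty with rfl | ⟨Z₀, hZ₀⟩
  · exact ⟨0, fun _ h => h.elim⟩
  refine ⟨F Z₀, fun Z hZ => ?_⟩
  have hT : (((fun φ : (Fin n → ℂ) → ℂ => φ Z₀) '' conjugates B D F)).Finite := hfin.image _
  refine hD.constant_of_mapsTo hT.isDiscrete hF.holo.continuousOn (fun Z₁ hZ₁ => ?_) hZ hZ₀
  obtain ⟨c, hc⟩ := hconst _ (pForm_charpoly hB hF hsm hfin (F Z₁))
  have h0 : ∏ φ ∈ hfin.toFinset, (φ Z₁ - F Z₁) = 0 := by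
    refine Finset.prod_eq_zero (hfin.mem_toFinset.2 self_mem_conjugates) ?_
    rw [indicator_of_mem hZ₁, sub_self]
  have h1 : ∏ φ ∈ hfin.toFinset, (φ Z₀ - F Z₁) = 0 := by
    rw [hc Z₀ hZ₀, ← hc Z₁ hZ₁, h0]
  obtain ⟨φ, hφ, h2⟩ := Finset.prod_eq_zero_iff.1 h1
  exact ⟨φ, hfin.mem_toFinset.1 hφ, sub_eq_zero.1 h2⟩

/-- Vectors of norm `-2` with even pairings. -/
def EvenRoot (B : Matrix (Fin n) (Fin n) ℤ) (v : Fin n → ℤ) : Prop :=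
  bf B v v = -2 ∧ ∀ x, 2 ∣ bf B v x

theorem bf_mulVec_of_isometry {g : Matrix (Fin n) (Fin n) ℤ} (hg : gᵀ * B * g = B)
    (x y : Fin n → ℤ) : bf B (g *ᵥ x) (g *ᵥ y) = bf B x y := by
  have := bf_actC_of_isometry hg (intC x) (intC y)
  rw [actC_intC, actC_intC, bf_intC, bf_intC] at this
  exact_mod_cast this

theorem exists_evenRoot_of_prod_eq_zero (hB : B.det ≠ 0)
    (hdiv : ∀ Z ∈ D, F Z = 0 → ∃ v : Fin n → ℤ, EvenRoot B v ∧ bf B Z (intC v) = 0)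
    (hfin : (conjugates B D F).Finite) {Z : Fin n → ℂ} (hZ : Z ∈ D)
    (h0 : ∏ φ ∈ hfin.toFinset, φ Z = 0) :
    ∃ v : Fin n → ℤ, EvenRoot B v ∧ bf B Z (intC v) = 0 := by
  obtain ⟨φ, hφ, h2⟩ := Finset.prod_eq_zero_iff.1 h0
  obtain ⟨g, hg, rfl⟩ := hfin.mem_toFinset.1 hφ
  simp only [indicator_of_mem hZ] at h2
  obtain ⟨v, ⟨hv, hv2⟩, hZv⟩ := hdiv _ (OPlus_actC_mem hg hZ) h2
  obtain ⟨g', hg', e1, e2⟩ := OPlus_inv hB hg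
  refine ⟨g' *ᵥ v, ⟨by rw [bf_mulVec_of_isometry hg'.1, hv], fun x => ?_⟩, ?_⟩
  · have : g' *ᵥ (g *ᵥ x) = x := by rw [mulVec_mulVec, e2, one_mulVec]
    rw [← this, bf_mulVec_of_isometry hg'.1]
    exact hv2 _
  · have : actC g' (actC g Z) = Z := by rw [← actC_mul, e2, actC_one]
    rw [← this, ← actC_intC, bf_actC_of_isometry hg'.1, hZv]

end

end Refl

namespace Refl

open Complex Filter Topology Set Matrix

section
variable {r : ℕ} {L : Matrix (Fin r) (Fin r) ℤ} {ε : ℤ} {D : Set (Fin (2 + (2 + r)) → ℂ)}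
  {E : (Fin (2 + (2 + r)) → ℂ) → ℂ}

theorem exists_common_denom (q : Fin r → ℚ) :
    ∃ N : ℕ, N ≠ 0 ∧ ∃ u : Fin r → ℤ, ∀ i, (q i : ℂ) = (N : ℂ)⁻¹ * u i := by
  have hN : ∏ i, (q i).den ≠ 0 := Finset.prod_ne_zero_iff.2 fun i _ => (q i).den_nz
  refine ⟨∏ i, (q i).den, hN, ?_⟩
  have : ∀ i, ∃ m : ℤ, ((∏ i, (q i).den : ℕ) : ℚ) * q i = m := by
    intro i
    obtain ⟨m, hm⟩ := Finset.dvd_prod_of_mem (fun i => (q i).den) (Finset.mem_univ i)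
    refine ⟨m * (q i).num, ?_⟩
    rw [hm]
    push_cast
    rw [← Rat.mul_den_eq_num (q i)]
    ring
  choose u hu using this
  refine ⟨u, fun i => ?_⟩
  have h1 : ((∏ i, (q i).den : ℕ) : ℂ) * (q i : ℂ) = u i := by exact_mod_cast hu i
  rw [← h1, inv_mul_cancel_left₀ (Nat.cast_ne_zero.2 hN)]

theorem exists_half_norm (hL : IsEvenPosDef L) {u : Fin r → ℤ} (hu : u ≠ 0) :
    ∃ t : ℕ, 0 < t ∧ bf L u u = 2 * t := by
  obtain ⟨m, hm⟩ := hL.2.1 u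
  rw [qnorm_eq_bf] at hm
  have h1 : intR u ≠ 0 := by
    intro h
    apply hu
    ext i
    have := congrFun h i
    simpa [intR] using this
  have h2 := bf_self_pos hL h1
  rw [bf_intR, hm] at h2
  have h3 : 0 < m := by
    have : (0 : ℤ) < 2 * m := by exact_mod_cast h2
    omega
  exact ⟨m.toNat, by omega, by rw [hm]; omega⟩

theorem PForm.line_eq_const (hF : PForm (M2U L) D 0 E) (hL : IsEvenPosDef L)
    (hD : IsComponent (M2U L) D) (hε : ε * ε = 1)
    (hmem : ∀ s : ℂ, s ≠ 0 → ∀ p ∈ Tube L, s • Zt L ε p ∈ D) {u : Fin r → ℤ} (hu : u ≠ 0)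
    {τ ω : ℂ} (hτ : 0 < τ.im) (hω : 0 < ω.im) (x : ℝ) :
    E (Zt L ε (τ, (x : ℂ) • intC u, ω)) = E (Zt L ε (I, 0, I)) := by
  obtain ⟨t, ht, hut⟩ := exists_half_norm hL hu
  obtain ⟨c, hc⟩ := (hF.hForm hL hD hε hmem hut).weight_zero_const ht
  have h1 := hc (τ, x, ω) ⟨hτ, by simpa [imv] using mul_pos hτ hω⟩
  have h2 := hc (I, 0, I) ⟨by simp [imv], by simp [imv]⟩
  simp only [line, zero_smul] at h1 h2
  rw [h1, h2]

theorem differentiableOn_tube (hF : DifferentiableOn ℂ E D)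
    (hmem : ∀ s : ℂ, s ≠ 0 → ∀ p ∈ Tube L, s • Zt L ε p ∈ D) :
    DifferentiableOn ℂ (fun p => E (Zt L ε p)) (Tube L) :=
  hF.comp differentiable_Zt.differentiableOn fun p hp => by simpa using hmem 1 one_ne_zero p hp

theorem ivec_add_smul (μ ν : Fin r → ℝ) (s : ℂ) :
    ivec ((fun i => (μ i : ℂ)) + s • fun i => (ν i : ℂ)) = s.im • ν := by
  ext i
  simp [ivec]

/-- A form of weight zero with trivial character is constant. -/
theorem PForm.constant (hr : 1 ≤ r) (hF : PForm (M2U L) D 0 E) (hL : IsEvenPosDef L)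
    (hD : IsComponent (M2U L) D) : ∃ c, ∀ Z ∈ D, E Z = c := by
  obtain ⟨ε, hε, hmem, hex⟩ := hD.exists_tube hL
  refine ⟨E (Zt L ε (I, 0, I)), ?_⟩
  have hdiff := differentiableOn_tube hF.holo hmem
  have hne : ∃ u : Fin r → ℤ, u ≠ 0 :=
    ⟨fun _ => 1, fun h => by simpa using congrFun h ⟨0, hr⟩⟩
  have hrat : ∀ τ ω : ℂ, 0 < τ.im → 0 < ω.im → ∀ q : Fin r → ℚ,
      E (Zt L ε (τ, fun i => ((q i : ℝ) : ℂ), ω)) = E (Zt L ε (I, 0, I)) := by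
    intro τ ω hτ hω q
    obtain ⟨N, hN, u, hu⟩ := exists_common_denom q
    have e : (fun i => ((q i : ℝ) : ℂ)) = (((N : ℝ)⁻¹ : ℝ) : ℂ) • intC u := by
      ext i
      simp only [Pi.smul_apply, smul_eq_mul, intC]
      push_cast
      exact hu i
    rw [e]
    rcases eq_or_ne u 0 with rfl | hu0
    · obtain ⟨u', hu'⟩ := hne
      have h0 : intC (0 : Fin r → ℤ) = 0 := by ext; simp [intC]
      have := hF.line_eq_const hL hD hε hmem hu' hτ hω 0
      rw [ofReal_zero, zero_smul] at this
      rwa [h0, smul_zero]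
    · exact hF.line_eq_const hL hD hε hmem hu0 hτ hω _
  have hreal : ∀ τ ω : ℂ, 0 < τ.im → 0 < ω.im → ∀ x : Fin r → ℝ,
      E (Zt L ε (τ, fun i => (x i : ℂ), ω)) = E (Zt L ε (I, 0, I)) := by
    intro τ ω hτ hω
    have hd : DenseRange (Pi.map fun (_ : Fin r) (q : ℚ) => (q : ℝ)) :=
      DenseRange.piMap fun _ => Rat.denseRange_cast
    have hcont : Continuous fun x : Fin r → ℝ => E (Zt L ε (τ, fun i => (x i : ℂ), ω)) := by
      refine hdiff.continuousOn.comp_continuous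
        (f := fun x : Fin r → ℝ => (τ, fun i => (x i : ℂ), ω)) (by fun_prop) fun x => ⟨hτ, ?_⟩
      have : ivec (fun i => (x i : ℂ)) = 0 := by ext; simp [ivec]
      simp only [this, bf_zero_left]
      positivity
    have := hd.equalizer hcont (continuous_const (y := E (Zt L ε (I, 0, I))))
      (funext fun q => hrat τ ω hτ hω q)
    exact fun x => congrFun this x
  have hall : ∀ p ∈ Tube L, E (Zt L ε p) = E (Zt L ε (I, 0, I)) := by
    rintro ⟨τ, z, ω⟩ ⟨hτ, hp⟩
    simp only at hτ hp
    have hνν := bf_self_nonneg hL (ivec z)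
    have hω : 0 < ω.im := by
      have : 0 < τ.im * ω.im := by linarith
      exact (pos_iff_pos_of_mul_pos this).1 hτ
    let S : Set ℂ := {s | bf L (ivec z) (ivec z) * s.im ^ 2 < 2 * (τ.im * ω.im)}
    let G : ℂ → ℂ × (Fin r → ℂ) × ℂ := fun s =>
      (τ, (fun i => (rvec z i : ℂ)) + s • fun i => (ivec z i : ℂ), ω)
    have hG : ∀ s ∈ S, G s ∈ Tube L := by
      intro s hs
      refine ⟨hτ, ?_⟩
      simp only [G, ivec_add_smul, bf_smul_left, bf_smul_right]
      have : bf L (ivec z) (ivec z) * s.im ^ 2 < 2 * (τ.im * ω.im) := hs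
      linarith
    have hSo : IsOpen S := isOpen_lt (by fun_prop) continuous_const
    have hSc : Convex ℝ S := by
      intro s hs s' hs' a b ha hb hab
      have h1 : bf L (ivec z) (ivec z) * s.im ^ 2 < 2 * (τ.im * ω.im) := hs
      have h2 : bf L (ivec z) (ivec z) * s'.im ^ 2 < 2 * (τ.im * ω.im) := hs'
      have h3 : (a * s.im + b * s'.im) ^ 2 ≤ a * s.im ^ 2 + b * s'.im ^ 2 := by
        have : b = 1 - a := by linarith
        subst this
        nlinarith [mul_nonneg (mul_nonneg ha hb) (sq_nonneg (s.im - s'.im))]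
      have h4 := mul_le_mul_of_nonneg_left h3 hνν
      have h5 : bf L (ivec z) (ivec z) * (a * s.im + b * s'.im) ^ 2 < 2 * (τ.im * ω.im) := by
        rcases ha.eq_or_lt with rfl | ha'
        · have : b = 1 := by linarith
          subst this; simpa using h2
        · nlinarith [mul_lt_mul_of_pos_left h1 ha', mul_le_mul_of_nonneg_left h2.le hb]
      have e : (a • s + b • s').im = a * s.im + b * s'.im := by simp
      have : bf L (ivec z) (ivec z) * (a • s + b • s').im ^ 2 < 2 * (τ.im * ω.im) := by rwa [e]
      exact this
    have hanal : AnalyticOnNhd ℂ (fun s => E (Zt L ε (G s))) S := by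
      refine DifferentiableOn.analyticOnNhd ?_ hSo
      exact hdiff.comp (by simp only [G]; fun_prop) hG
    have h0S : (0 : ℂ) ∈ S := by
      have : bf L (ivec z) (ivec z) * (0 : ℂ).im ^ 2 < 2 * (τ.im * ω.im) := by simp; positivity
      exact this
    have hIS : I ∈ S := by
      have : bf L (ivec z) (ivec z) * I.im ^ 2 < 2 * (τ.im * ω.im) := by simpa using hp
      exact this
    have hfreq : ∃ᶠ s in 𝓝[≠] (0 : ℂ), E (Zt L ε (G s)) = E (Zt L ε (I, 0, I)) := by
      have ht : Tendsto (fun x : ℝ => (x : ℂ)) (𝓝[≠] 0) (𝓝[≠] 0) := by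
        refine tendsto_nhdsWithin_iff.2 ⟨?_, ?_⟩
        · exact (Complex.continuous_ofReal.tendsto' 0 0 (by simp)).mono_left nhdsWithin_le_nhds
        · filter_upwards [self_mem_nhdsWithin] with x hx
          simpa using hx
      refine ht.frequently (Frequently.of_forall fun x => ?_)
      have e : G (x : ℂ) = (τ, fun i => ((rvec z i + x * ivec z i : ℝ) : ℂ), ω) := by
        simp only [G]
        congr 2
        ext i
        simp
      rw [e]
      exact hreal τ ω hτ hω _
    have := hanal.eqOn_of_preconnected_of_frequently_eq (analyticOnNhd_const) hSc.isPreconnected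
      h0S hfreq hIS
    have e : G I = (τ, z, ω) := by
      simp only [G]
      congr 2
      ext i
      simp only [Pi.add_apply, Pi.smul_apply, rvec, ivec, smul_eq_mul, mul_comm I, re_add_im]
    simpa [e] using this
  intro Z hZ
  obtain ⟨s, hs, p, hp, rfl⟩ := hex Z hZ
  rw [hF.homogeneous s hs _ (by simpa using hmem 1 one_ne_zero p hp), neg_zero, zpow_zero, one_mul]
  exact hall p hp

end

end Refl

namespace Refl

open Complex Filter Topology Set Matrix

theorem humbert_estimate {t v l m τ o w A D a₁ a₄ j : ℝ} (ht : 0 < t) (hv : 0 < v)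
    (hre : A * (t * (l * τ + m) ^ 2 - t * (l * v) ^ 2 - τ * (o + 2 * t * l * (l * τ + m) -
      t * l ^ 2 * τ) + v * (w + t * l ^ 2 * v)) + a₁ + a₄ * τ + D * (o + 2 * t * l * (l * τ + m) -
      t * l ^ 2 * τ) - j * (l * τ + m) = 0)
    (him : A * (2 * t * (l * τ + m) * (l * v) - τ * (w + t * l ^ 2 * v) -
      v * (o + 2 * t * l * (l * τ + m) - t * l ^ 2 * τ)) + a₄ * v + D * (w + t * l ^ 2 * v) -
      j * (l * v) = 0)
    (hdisc : j ^ 2 ≤ t + 4 * t * (a₁ * A + D * a₄)) :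
    w * ((D - A * τ) ^ 2 + A ^ 2 * v ^ 2) ≤ v / 4 := by
  have h1 : w * ((D - A * τ) ^ 2 + A ^ 2 * v ^ 2) =
      -v * (a₁ * A + D * a₄ + t * (A * m + D * l) ^ 2 - j * (A * m + D * l)) := by
    linear_combination (D - A * τ) * him + A * v * hre
  have h2 : -(1 / 4) ≤ a₁ * A + D * a₄ + t * (A * m + D * l) ^ 2 - j * (A * m + D * l) := by
    have h3 : 0 ≤ (2 * t * (A * m + D * l) - j) ^ 2 := sq_nonneg _
    have h4 : 0 ≤ (4 * t) * (a₁ * A + D * a₄ + t * (A * m + D * l) ^ 2 - j * (A * m + D * l) +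
        1 / 4) := by nlinarith
    linarith [nonneg_of_mul_nonneg_right h4 (by positivity)]
  rw [h1]
  nlinarith

theorem one_le_sq_of_ne_zero {a : ℤ} (ha : a ≠ 0) : (1 : ℝ) ≤ (a : ℝ) ^ 2 := by
  have : 1 ≤ a ^ 2 := Int.add_one_le_iff.2 (by positivity : 0 < a ^ 2)
  exact_mod_cast this

section
variable {r : ℕ} {L : Matrix (Fin r) (Fin r) ℤ} {ε : ℤ} {t : ℕ} {u : Fin r → ℤ}

theorem not_orth_of_mem_reg (hL : IsEvenPosDef L) (hε : ε * ε = 1) (ht : 0 < t)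
    (hu : bf L u u = 2 * t)
    (hroot : ∀ w, bf L w w = 2 → (∀ x, 2 ∣ bf L w x) → bf L w u = 2 ∨ bf L w u = -2)
    {p : ℂ × ℂ × ℂ} (hp : imv p ∈ Reg t) {z : Fin (2 + (2 + r)) → ℤ}
    (hz : EvenRoot (M2U L) z) : bf (M2U L) (Zt L ε (line u p)) (intC z) ≠ 0 := by
  obtain ⟨hz1, hz2⟩ := hz
  obtain ⟨a, b, c, d, w, rfl⟩ := exists_vec hε z
  obtain ⟨a₁, rfl⟩ : 2 ∣ a := by
    have := hz2 (vec ε 0 1 0 0 0)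
    rw [bf_vec hε, bf_zero_right] at this
    simpa using this
  obtain ⟨a₂, rfl⟩ : 2 ∣ b := by
    have := hz2 (vec ε 1 0 0 0 0)
    rw [bf_vec hε, bf_zero_right] at this
    simpa using this
  obtain ⟨a₃, rfl⟩ : 2 ∣ c := by
    have := hz2 (vec ε 0 0 0 1 0)
    rw [bf_vec hε, bf_zero_right] at this
    simpa using this
  obtain ⟨a₄, rfl⟩ : 2 ∣ d := by
    have := hz2 (vec ε 0 0 1 0 0)
    rw [bf_vec hε, bf_zero_right] at this
    simpa using this
  have hw : ∀ x, 2 ∣ bf L w x := by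
    intro x
    have := hz2 (vec ε 0 0 0 0 x)
    rw [bf_vec hε] at this
    simpa using this
  obtain ⟨j, hj⟩ := hw u
  rw [bf_vec hε] at hz1
  rw [Zt_line hu, intC_vec, bf_vec hε, bf_smul_left, bf_intC, bf_comm hL.1 u w, hj]
  intro h0
  have hv : 0 < p.1.im := hp.1.1
  have htv : (t : ℝ) * p.2.1.im ^ 2 + 1 / 4 * p.1.im ^ 2 < p.1.im * p.2.2.im := hp.1.2
  have hq : (t : ℝ) * p.2.1.im ^ 2 + 1 / 4 < p.1.im * p.2.2.im := hp.2.1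
  have hy : 0 < p.2.1.im := hp.2.2.1
  have hyv : p.2.1.im < p.1.im := hp.2.2.2
  obtain ⟨τ, x, ω⟩ := p
  simp only at h0 hv htv hq hy hyv
  have hE : (a₂ : ℂ) * (t * x ^ 2 - τ * ω) + a₁ + a₄ * τ + a₃ * ω - j * x = 0 := by
    push_cast at h0
    linear_combination h0 / 2
  have hre := congrArg Complex.re hE
  have him := congrArg Complex.im hE
  simp [pow_two] at hre him
  by_cases h23 : a₂ = 0 ∧ a₃ = 0
  · obtain ⟨rfl, rfl⟩ := h23
    have hj2 := hroot w (by linarith) hw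
    rw [hj] at hj2
    simp at him
    have hlt : |(a₄ : ℝ)| < 1 ∧ 0 < |(a₄ : ℝ)| := by
      have h1 : |(a₄ : ℝ)| * τ.im = x.im := by
        have h2 : (a₄ : ℝ) * τ.im = j * x.im := by linarith
        have h3 : |(j : ℝ)| = 1 := by
          rcases hj2 with h | h
          · have : j = 1 := by omega
            simp [this]
          · have : j = -1 := by omega
            simp [this]
        calc |(a₄ : ℝ)| * τ.im = |(a₄ : ℝ) * τ.im| := by rw [abs_mul, abs_of_pos hv]
          _ = x.im := by rw [h2, abs_mul, h3, one_mul, abs_of_pos hy]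
      constructor
      · by_contra! h; nlinarith
      · by_contra! h; nlinarith
    have h1 : |a₄| < 1 := by exact_mod_cast hlt.1
    have h2 : 0 < |a₄| := by exact_mod_cast hlt.2
    omega
  · have htR : (0 : ℝ) < t := Nat.cast_pos.2 ht
    have hcs := bf_sq_le hL (intR w) (intR u)
    rw [bf_intR, bf_intR, bf_intR, hj, hu] at hcs
    have hww : bf L w w = 2 + 8 * (a₁ * a₂ + a₃ * a₄) := by linarith
    rw [hww] at hcs
    push_cast at hcs
    have hl : x.im / τ.im * τ.im = x.im := div_mul_cancel₀ _ hv.ne'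
    set l := x.im / τ.im with hl'
    have hest := humbert_estimate (t := t) (v := τ.im) (l := l) (m := x.re - l * τ.re) (τ := τ.re)
      (o := ω.re - (2 * t * l * x.re - t * l ^ 2 * τ.re)) (w := ω.im - t * l ^ 2 * τ.im)
      (A := a₂) (D := a₃) (a₁ := a₁) (a₄ := a₄) (j := j) htR hv ?_ ?_ ?_
    · have hw0 : τ.im * (ω.im - t * l ^ 2 * τ.im) = τ.im * ω.im - t * x.im ^ 2 := by
        rw [← hl]; ring
      generalize ω.im - t * l ^ 2 * τ.im = w₀ at *
      have hw0pos : 0 < w₀ := by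
        have : 0 < τ.im * w₀ := by linarith
        exact (pos_iff_pos_of_mul_pos this).1 hv
      rcases eq_or_ne a₂ 0 with rfl | h2
      · have h3 := one_le_sq_of_ne_zero (fun h => h23 ⟨rfl, h⟩)
        have h4 : w₀ * 1 ≤ w₀ * (a₃ : ℝ) ^ 2 := mul_le_mul_of_nonneg_left h3 hw0pos.le
        have h5 : w₀ * (a₃ : ℝ) ^ 2 ≤ τ.im / 4 := by simpa using hest
        have h6 : τ.im * w₀ ≤ τ.im * (τ.im / 4) := mul_le_mul_of_nonneg_left (by linarith) hv.le
        nlinarith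
      · have h3 := one_le_sq_of_ne_zero h2
        have h4 : w₀ * τ.im ^ 2 * 1 ≤ w₀ * τ.im ^ 2 * (a₂ : ℝ) ^ 2 :=
          mul_le_mul_of_nonneg_left h3 (by positivity)
        have h5 : 0 ≤ w₀ * ((a₃ : ℝ) - a₂ * τ.re) ^ 2 := by positivity
        have h6 : τ.im * (τ.im * w₀) ≤ τ.im * (1 / 4) := by nlinarith
        have := le_of_mul_le_mul_left h6 hv
        linarith
    · rw [hl]; linear_combination hre
    · rw [hl]; linear_combination him
    · nlinarith

end

end Refl

namespace Refl

open Complex Filter Topology Set Matrix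

section
variable {r k : ℕ} {L : Matrix (Fin r) (Fin r) ℤ}

theorem bf_int_self_nonneg (hL : IsEvenPosDef L) (u : Fin r → ℤ) : 0 ≤ bf L u u := by
  have := bf_self_nonneg hL (intR u)
  rw [bf_intR] at this
  exact_mod_cast this

theorem eq_zero_of_bf_self (hL : IsEvenPosDef L) {u : Fin r → ℤ} (h : bf L u u = 0) : u = 0 := by
  by_contra hu
  obtain ⟨t, ht, h1⟩ := exists_half_norm hL hu
  omega

/-- Vectors of norm `2` with even pairings. -/
def PosRoot (L : Matrix (Fin r) (Fin r) ℤ) (w : Fin r → ℤ) : Prop :=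
  bf L w w = 2 ∧ ∀ x, 2 ∣ bf L w x

theorem PosRoot.eq_or_orth (hL : IsEvenPosDef L) {w w' : Fin r → ℤ} (hw : PosRoot L w)
    (hw' : PosRoot L w') : w = w' ∨ w = -w' ∨ bf L w w' = 0 := by
  obtain ⟨m, hm⟩ := hw.2 w'
  have h1 : bf L (w + (-1 : ℤ) • w') (w + (-1 : ℤ) • w') = 4 - 4 * m := by
    simp only [bf_add_left, bf_add_right, bf_smul_left, bf_smul_right]
    rw [bf_comm hL.1 w' w, hw.1, hw'.1, hm]
    ring
  have h2 : bf L (w + w') (w + w') = 4 + 4 * m := by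
    simp only [bf_add_left, bf_add_right]
    rw [bf_comm hL.1 w' w, hw.1, hw'.1, hm]
    ring
  have h3 := bf_int_self_nonneg hL (w + (-1 : ℤ) • w')
  have h4 := bf_int_self_nonneg hL (w + w')
  have h5 : m = 1 ∨ m = -1 ∨ m = 0 := by omega
  rcases h5 with rfl | rfl | rfl
  · left
    have := eq_zero_of_bf_self hL (h1.trans (by norm_num))
    rw [neg_one_smul] at this
    exact eq_of_sub_eq_zero (by rw [sub_eq_add_neg, this])
  · right; left
    exact eq_neg_of_add_eq_zero_left (eq_zero_of_bf_self hL (h2.trans (by norm_num)))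
  · right; right
    rw [hm, mul_zero]

/-- An orthogonal family of roots. -/
def OrthoRoots (L : Matrix (Fin r) (Fin r) ℤ) (f : Fin k → Fin r → ℤ) : Prop :=
  (∀ i, PosRoot L (f i)) ∧ ∀ i j, i ≠ j → bf L (f i) (f j) = 0

theorem bf_sum_right {R ι : Type*} [CommRing R] (s : Finset ι) (x : Fin r → R)
    (f : ι → Fin r → R) : bf L x (∑ i ∈ s, f i) = ∑ i ∈ s, bf L x (f i) := by
  induction s using Finset.cons_induction with
  | empty => simp [bf_zero_right]
  | cons a s ha ih => rw [Finset.sum_cons, Finset.sum_cons, bf_add_right, ih]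

/-- Linear combinations of a family. -/
def comb (f : Fin k → Fin r → ℤ) : (Fin k → ℤ) →ₗ[ℤ] (Fin r → ℤ) := Fintype.linearCombination ℤ f

theorem OrthoRoots.bf_comb {f : Fin k → Fin r → ℤ} (hf : OrthoRoots L f) (j : Fin k)
    (c : Fin k → ℤ) : bf L (f j) (comb f c) = 2 * c j := by
  rw [comb, Fintype.linearCombination_apply, bf_sum_right, Finset.sum_eq_single j]
  · rw [bf_smul_right, (hf.1 j).1, mul_comm]
  · intro i _ hi
    rw [bf_smul_right, hf.2 j i hi.symm, mul_zero]
  · simp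

theorem OrthoRoots.comb_injective {f : Fin k → Fin r → ℤ} (hf : OrthoRoots L f) :
    Function.Injective (comb f) := by
  intro c c' h
  ext j
  have h1 := hf.bf_comb j c
  rw [h, hf.bf_comb] at h1
  omega

theorem OrthoRoots.card_le {f : Fin k → Fin r → ℤ} (hf : OrthoRoots L f) : k ≤ r := by
  simpa using card_le_of_injective ℤ _ hf.comb_injective

theorem exists_maximal_orthoRoots (hL : IsEvenPosDef L) :
    ∃ (k : ℕ) (f : Fin k → Fin r → ℤ), OrthoRoots L f ∧
      ∀ w, PosRoot L w → ∃ i, w = f i ∨ w = -f i := by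
  classical
  let P : ℕ → Prop := fun k => ∃ f : Fin k → Fin r → ℤ, OrthoRoots L f
  have h0 : P 0 := ⟨fun i => i.elim0, fun i => i.elim0, fun i => i.elim0⟩
  obtain ⟨f, hf⟩ : P (Nat.findGreatest P r) := Nat.findGreatest_spec (Nat.zero_le r) h0
  refine ⟨_, f, hf, fun w hw => ?_⟩
  by_contra! hne
  have hort : ∀ i, bf L w (f i) = 0 := by
    intro i
    rcases hw.eq_or_orth hL (hf.1 i) with h | h | h
    · exact absurd h (hne i).1
    · exact absurd h (hne i).2
    · exact h
  have hP : P (Nat.findGreatest P r + 1) := by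
    refine ⟨Fin.cons w f, ?_, ?_⟩
    · intro i
      refine Fin.cases ?_ (fun i => ?_) i
      · simpa using hw
      · simpa using hf.1 i
    · intro i j
      refine Fin.cases ?_ (fun i => ?_) i <;> refine Fin.cases ?_ (fun j => ?_) j
      · simp
      · intro _
        simpa using hort j
      · intro _
        simpa [bf_comm hL.1 _ w] using hort i
      · intro hij
        simpa using hf.2 i j (fun h => hij (congrArg Fin.succ h))
  obtain ⟨g, hg⟩ := id hP
  have := Nat.le_findGreatest hg.card_le hP
  omega

theorem latIso_of_orthoRoots (hL : IsEvenPosDef L) {f : Fin k → Fin r → ℤ} (hf : OrthoRoots L f)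
    (hsurj : Function.Surjective (comb f)) {G : Matrix (Fin k) (Fin k) ℤ}
    (hG : ∀ i j, G i j = if i = j then 2 else 0) : LatIso L G := by
  let e := LinearEquiv.ofBijective (comb f) ⟨hf.comb_injective, hsurj⟩
  have key : ∀ c c' : Fin k → ℤ, bf G c c' = bf L (comb f c) (comb f c') := by
    intro c c'
    have h1 : comb f c = ∑ i, c i • f i := Fintype.linearCombination_apply ..
    have h2 : bf G c c' = ∑ i, 2 * c i * c' i := by
      refine Finset.sum_congr rfl fun i _ => ?_
      rw [Finset.sum_eq_single i]
      · simp [hG]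
      · intro j _ hj
        simp [hG, hj.symm]
      · simp
    rw [h2, bf_comm hL.1, h1, bf_sum_right]
    refine Finset.sum_congr rfl fun i _ => ?_
    rw [bf_smul_right, bf_comm hL.1, hf.bf_comb]
    ring
  refine ⟨e.symm, fun x y => ?_⟩
  rw [← bf_int, ← bf_int, key]
  have : ∀ z, comb f (e.symm z) = z := fun z => e.apply_symm_apply z
  rw [this, this]

theorem gramA_one_apply (i j : Fin 1) : gramA 1 i j = if i = j then 2 else 0 := by
  simp [gramA, Subsingleton.elim i j]

theorem dsum_apply_of_diagonal {m n : ℕ} {A : Matrix (Fin m) (Fin m) ℤ}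
    {B : Matrix (Fin n) (Fin n) ℤ} (hA : ∀ i j, A i j = if i = j then 2 else 0)
    (hB : ∀ i j, B i j = if i = j then 2 else 0) (i j : Fin (m + n)) :
    dsum A B i j = if i = j then 2 else 0 := by
  obtain ⟨i, rfl⟩ := finSumFinEquiv.surjective i
  obtain ⟨j, rfl⟩ := finSumFinEquiv.surjective j
  rw [dsum, reindex_apply, submatrix_apply, Equiv.symm_apply_apply, Equiv.symm_apply_apply]
  simp only [EmbeddingLike.apply_eq_iff_eq]
  rcases i with i | i <;> rcases j with j | j <;> simp [hA, hB]

/-- If no vector of large norm has pairing `±2` with all roots, the lattice is `nA₁`. -/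
theorem classification_of_bounded (hr : 1 ≤ r) (hL : IsEvenPosDef L)
    (hbd : ∀ u, (∀ w, PosRoot L w → bf L w u = 2 ∨ bf L w u = -2) → bf L u u ≤ 8) :
    LatIso L (gramA 1) ∨ LatIso L (dsum (gramA 1) (gramA 1)) ∨
      LatIso L (dsum (gramA 1) (dsum (gramA 1) (gramA 1))) ∨
      LatIso L (dsum (gramA 1) (dsum (gramA 1) (dsum (gramA 1) (gramA 1)))) := by
  obtain ⟨k, f, hf, hmax⟩ := exists_maximal_orthoRoots hL
  have hneg : ∀ x y, bf L (-x) y = -bf L x y := by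
    intro x y
    rw [← neg_one_smul ℤ, bf_smul_left, neg_one_mul]
  have hu₀ : ∀ i, bf L (f i) (comb f 1) = 2 := fun i => by rw [hf.bf_comb]; simp
  have hpair : ∀ v, (∀ i, bf L (f i) v = 0) → ∀ j : ℤ,
      bf L (comb f 1 + j • v) (comb f 1 + j • v) ≤ 8 := by
    intro v hv j
    refine hbd _ fun w hw => ?_
    obtain ⟨i, rfl | rfl⟩ := hmax w hw
    · left
      rw [bf_add_right, bf_smul_right, hv, hu₀]; norm_num
    · right
      rw [hneg, bf_add_right, bf_smul_right, hv, hu₀]; norm_num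
  have hcomb : ∀ v, (∀ i, bf L (f i) v = 0) → bf L v (comb f 1) = 0 := by
    intro v hv
    rw [comb, Fintype.linearCombination_apply, bf_sum_right]
    refine Finset.sum_eq_zero fun i _ => ?_
    rw [bf_smul_right, bf_comm hL.1, hv, mul_zero]
  have horth : ∀ v, (∀ i, bf L (f i) v = 0) → v = 0 := by
    intro v hv
    by_contra hne
    obtain ⟨t, ht, h1⟩ := exists_half_norm hL hne
    have h2 := hpair v hv 5
    have h3 := hcomb v hv
    simp only [bf_add_left, bf_add_right, bf_smul_left, bf_smul_right] at h2
    rw [bf_comm hL.1 _ v, h3, h1] at h2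
    have := bf_int_self_nonneg hL (comb f 1)
    omega
  have hsurj : Function.Surjective (comb f) := by
    intro x
    choose c hc using fun i => (hf.1 i).2 x
    refine ⟨c, (eq_of_sub_eq_zero (horth _ fun i => ?_)).symm⟩
    rw [sub_eq_add_neg, ← neg_one_smul ℤ, bf_add_right, bf_smul_right, hf.bf_comb, hc]
    ring
  have hk4 : k ≤ 4 := by
    have h1 := hpair 0 (fun i => bf_zero_right _ _) 0
    have h2 : bf L (comb f 1) (comb f 1) = 2 * k := by
      nth_rewrite 2 [comb]
      rw [Fintype.linearCombination_apply, bf_sum_right]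
      simp only [bf_smul_right]
      rw [Finset.sum_congr rfl fun i _ => by rw [bf_comm hL.1, hu₀]]
      simp [mul_comm]
    rw [smul_zero, add_zero, h2] at h1
    omega
  have hk0 : k ≠ 0 := by
    rintro rfl
    obtain ⟨c, hc⟩ := hsurj (fun _ => 1)
    obtain ⟨c', hc'⟩ := hsurj 0
    have := congrFun (hc.symm.trans ((congrArg (comb f) (Subsingleton.elim c c')).trans hc'))
      ⟨0, hr⟩
    simp at this
  have hk : k = 1 ∨ k = 1 + 1 ∨ k = 1 + (1 + 1) ∨ k = 1 + (1 + (1 + 1)) := by omega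
  have h1 := gramA_one_apply
  have h2 := dsum_apply_of_diagonal h1 h1
  have h3 := dsum_apply_of_diagonal h1 h2
  rcases hk with rfl | rfl | rfl | rfl
  · exact Or.inl (latIso_of_orthoRoots hL hf hsurj h1)
  · exact Or.inr (Or.inl (latIso_of_orthoRoots hL hf hsurj h2))
  · exact Or.inr (Or.inr (Or.inl (latIso_of_orthoRoots hL hf hsurj h3)))
  · exact Or.inr (Or.inr (Or.inr (latIso_of_orthoRoots hL hf hsurj
      (dsum_apply_of_diagonal h1 h3))))

end

end Refl

namespace Refl

/-- If M = 2U ⊕ L(−1) (rank L ≥ 1) admits a nonconstant modular form whose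
zeros lie only on hyperplanes of vectors r with (r,r) = −2 and div(r) = 2, then L ≅ nA₁
for some 1 ≤ n ≤ 4. -/
theorem divisor_div_two_classification {r : ℕ} (hr : 1 ≤ r)
    (L : Matrix (Fin r) (Fin r) ℤ) (hL : IsEvenPosDef L)
    (h : ∃ D : Set (Fin (2 + (2 + r)) → ℂ), IsComponent (M2U L) D ∧
      ∃ (Γ : Set (Matrix (Fin (2 + (2 + r))) (Fin (2 + (2 + r))) ℤ))
        (χ : Matrix (Fin (2 + (2 + r))) (Fin (2 + (2 + r))) ℤ → ℂ)
        (k : ℤ) (F : (Fin (2 + (2 + r)) → ℂ) → ℂ),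
        IsFiniteIndexSubgroup (M2U L) D Γ ∧ IsCharacter Γ χ ∧
        IsModularForm (M2U L) D Γ χ k F ∧ NonConstantOn D F ∧
        ∀ Z ∈ D, F Z = 0 → ∃ v : Fin (2 + (2 + r)) → ℤ,
          qnorm (M2U L) v = -2 ∧ DivEq (M2U L) v 2 ∧ OrthZ (M2U L) Z v) :
    LatIso L (gramA 1) ∨ LatIso L (dsum (gramA 1) (gramA 1)) ∨ LatIso L (dsum (gramA 1) (dsum (gramA 1) (gramA 1))) ∨ LatIso L (dsum (gramA 1) (dsum (gramA 1) (dsum (gramA 1) (gramA 1)))) := by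
  obtain ⟨D, hD, Γ, χ, k, F, hΓ, hχ, hF, hnc, hzero⟩ := h
  obtain ⟨ε, hε, hmem, hex⟩ := hD.exists_tube hL
  have hdet := M2U_det_ne_zero hL.det_ne_zero
  have hsm : ∀ t : ℂ, t ≠ 0 → ∀ Z ∈ D, t • Z ∈ D := by
    intro t ht Z hZ
    obtain ⟨s, hs, p, hp, rfl⟩ := hex Z hZ
    rw [smul_smul]
    exact hmem _ (mul_ne_zero ht hs) p hp
  have hdiv : ∀ Z ∈ D, F Z = 0 → ∃ v, EvenRoot (M2U L) v ∧ bf (M2U L) Z (intC v) = 0 := by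
    intro Z hZ h0
    obtain ⟨v, hv, hv2, hvZ⟩ := hzero Z hZ h0
    refine ⟨v, ⟨by rw [← qnorm_eq_bf, hv], fun x => ?_⟩, hvZ⟩
    rw [← Ideal.mem_span_singleton, ← hv2, bf_int]
    exact Ideal.subset_span ⟨x, rfl⟩
  have hfin := conjugates_finite hdet hΓ hχ hF
  refine classification_of_bounded hr hL fun u hu => ?_
  by_contra! hlt
  have hu0 : u ≠ 0 := by
    rintro rfl
    rw [bf_zero_left] at hlt
    omega
  obtain ⟨t, ht, hut⟩ := exists_half_norm hL hu0
  have hk := ((pForm_norm hdet hF hsm hfin).hForm hL hD hε hmem hut).weight_eq_zero (by omega)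
    fun p hp h0 => by
      have hpD := hmem 1 one_ne_zero _ (line_mem_tube hut (p := p) (reg_subset hp))
      rw [one_smul] at hpD
      obtain ⟨z, hz, hz0⟩ := exists_evenRoot_of_prod_eq_zero hdet hdiv hfin hpD h0
      exact not_orth_of_mem_reg hL hε ht hut (fun w hw hw2 => hu w ⟨hw, hw2⟩) hp hz hz0
  have hcard : (hfin.toFinset.card : ℤ) ≠ 0 :=
    Nat.cast_ne_zero.mpr (Finset.card_ne_zero_of_mem (hfin.mem_toFinset.mpr self_mem_conjugates))
  obtain rfl := (mul_eq_zero.mp hk).resolve_right hcard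
  exact hnc (constant_of_weight_zero hdet hD.isPreconnected hF hsm hfin
    fun E hE => hE.constant hr hL hD)

end Refl
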